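/- arXiv:1602.06440 — 6 statements merged into one kernel-verified Lean document; each statement's English description precedes it below -/
import Mathlib

section
/- Let (M,d) be a closed, connected metric manifold of dimension n ≥ 1 that is L-linearly locally contractible. If S ⊆ M is a closed set, U and V are two distinct connected components of M ∖ S, and r > 0 is such that there exist points x, y ∈ M with B(x,r) ⊆ U and B(y,r) ⊆ V, then diam(S) ≥ r/L. -/
open Metric MeasureTheory

/-- `M` is a topological `n`-manifold: every point has an open neighborhood
homeomorphic to an open subset of `ℝⁿ`. -/
def IsTopManifold (n : ℕ) (M : Type*) [TopologicalSpace M] : Prop :=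
  ∀ x : M, ∃ (U : Set M) (V : Set (EuclideanSpace ℝ (Fin n))),
    IsOpen U ∧ x ∈ U ∧ IsOpen V ∧ Nonempty (U ≃ₜ V)

/-- `M` is `D`-doubling: every open ball `B(z,r)` contains at most `D` points that are
pairwise at distance `≥ r/2` from each other. -/
def IsDoubling (D : ℕ) (M : Type*) [MetricSpace M] : Prop :=
  ∀ (z : M) (r : ℝ) (s : Finset M), (↑s ⊆ ball z r) →
    (∀ a ∈ s, ∀ b ∈ s, a ≠ b → r / 2 ≤ dist a b) → s.card ≤ D

/-- `M` is `L`-linearly locally contractible: every ball `B(z,r)` with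
`0 < r ≤ diam M / L` can be contracted to a point inside `B(z,Lr)`. -/
def IsLLC (L : ℝ) (M : Type*) [MetricSpace M] : Prop :=
  ∀ (z : M) (r : ℝ), 0 < r → r ≤ diam (Set.univ : Set M) / L →
    ∃ h : ℝ → M → M,
      ContinuousOn (fun p : ℝ × M => h p.1 p.2) (Set.Icc 0 1 ×ˢ ball z r) ∧
      (∀ x ∈ ball z r, h 0 x = x) ∧
      (∃ c : M, ∀ x ∈ ball z r, h 1 x = c) ∧
      (∀ t ∈ Set.Icc (0:ℝ) 1, ∀ x ∈ ball z r, h t x ∈ ball z (L * r))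

section

open Set Filter Topology
open scoped ContDiff Manifold

namespace SepDeg

/-- The partial derivative of `u` in the `j`-th coordinate direction. -/
noncomputable def pd {n : ℕ} (u : (Fin n → ℝ) → ℝ) (j : Fin n) (x : Fin n → ℝ) : ℝ :=
  fderiv ℝ u x (Pi.single j 1)

/-- The (transposed) Jacobian matrix of a family of functions. -/
noncomputable def jac {n : ℕ} (h : Fin n → (Fin n → ℝ) → ℝ) (x : Fin n → ℝ) :
    Matrix (Fin n) (Fin n) ℝ :=
  Matrix.of fun j k => pd (h k) j x

variable {n : ℕ}

theorem contDiff_pd {u : (Fin n → ℝ) → ℝ} (hu : ContDiff ℝ ∞ u) (j : Fin n) :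
    ContDiff ℝ ∞ (pd u j) :=
  (hu.fderiv_right (m := ∞) (by simp)).clm_apply contDiff_const

theorem pd_pd_comm {u : (Fin n → ℝ) → ℝ} (hu : ContDiff ℝ ∞ u) (i j : Fin n)
    (x : Fin n → ℝ) : pd (pd u i) j x = pd (pd u j) i x := by
  have hd : DifferentiableAt ℝ (fderiv ℝ u) x :=
    ((hu.fderiv_right (m := ∞) (by simp)).differentiable (by simp)) x
  have key : ∀ i j, pd (pd u i) j x
      = fderiv ℝ (fderiv ℝ u) x (Pi.single j 1) (Pi.single i 1) := by
    intro i j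
    have := (hd.hasFDerivAt.clm_apply (hasFDerivAt_const (Pi.single i (1 : ℝ)) x)).fderiv
    change fderiv ℝ (fun y => fderiv ℝ u y (Pi.single i 1)) x (Pi.single j 1) = _
    rw [this]
    simp
  have hs : IsSymmSndFDerivAt ℝ u x :=
    hu.contDiffAt.isSymmSndFDerivAt (by simpa using WithTop.coe_le_coe.2 (le_top (a := (2 : ℕ∞))))
  rw [key, key, hs.eq]

theorem continuous_det_jac {h : Fin n → (Fin n → ℝ) → ℝ} (hh : ∀ k, ContDiff ℝ ∞ (h k)) :
    Continuous fun x => (jac h x).det := by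
  refine Continuous.matrix_det (continuous_matrix fun j k => ?_)
  exact (contDiff_pd (hh k) j).continuous

theorem sum_sign_mul_prod_pd_pd {h : Fin n → (Fin n → ℝ) → ℝ} (hh : ∀ k, ContDiff ℝ ∞ (h k))
    {i k : Fin n} (hik : k ≠ i) (x : Fin n → ℝ) :
    ∑ σ : Equiv.Perm (Fin n), ((Equiv.Perm.sign σ : ℤ) : ℝ) *
      ((∏ l ∈ (Finset.univ.erase i).erase k, pd (h l) (σ l) x) *
        pd (pd (h k) (σ k)) (σ i) x) = 0 := by
  set g : Equiv.Perm (Fin n) → ℝ := fun σ => ((Equiv.Perm.sign σ : ℤ) : ℝ) *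
      ((∏ l ∈ (Finset.univ.erase i).erase k, pd (h l) (σ l) x) *
        pd (pd (h k) (σ k)) (σ i) x) with hg
  have h1 : ∀ σ, g (σ * Equiv.swap i k) = - g σ := by
    intro σ
    simp only [hg, Equiv.Perm.sign_mul, Equiv.Perm.sign_swap hik.symm, Equiv.Perm.mul_apply,
      Equiv.swap_apply_left, Equiv.swap_apply_right]
    rw [pd_pd_comm (hh k)]
    have : ∏ l ∈ (Finset.univ.erase i).erase k, pd (h l) (σ (Equiv.swap i k l)) x
        = ∏ l ∈ (Finset.univ.erase i).erase k, pd (h l) (σ l) x := by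
      refine Finset.prod_congr rfl fun l hl => ?_
      simp only [Finset.mem_erase] at hl
      rw [Equiv.swap_apply_of_ne_of_ne hl.2.1 hl.1]
    rw [this]
    push_cast
    ring
  have h2 : ∑ σ, g σ = - ∑ σ, g σ := by
    rw [← Finset.sum_neg_distrib, ← Equiv.sum_comp (Equiv.mulRight (Equiv.swap i k)) g]
    exact Finset.sum_congr rfl fun σ _ => h1 σ
  linarith

theorem integral_pd_eq_zero {u : (Fin n → ℝ) → ℝ} (hu : ContDiff ℝ ∞ u)
    (hc : HasCompactSupport u) (j : Fin n) : ∫ x, pd u j x = 0 := by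
  have hi : Integrable (pd u j) :=
    (contDiff_pd hu j).continuous.integrable_of_hasCompactSupport (hc.fderiv_apply ℝ _)
  have := integral_mul_fderiv_eq_neg_fderiv_mul_of_integrable (μ := volume)
    (f := fun _ : Fin n → ℝ => (1 : ℝ)) (g := u) (v := Pi.single j 1)
    (by simp) (by simp only [one_mul]; exact hi)
    (by simpa using hu.continuous.integrable_of_hasCompactSupport hc)
    (by fun_prop) (fun x _ => (hu.differentiable (by simp)) x)
  simpa [pd] using this

theorem pd_mul {u v : (Fin n → ℝ) → ℝ} (hu : ContDiff ℝ ∞ u) (hv : ContDiff ℝ ∞ v)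
    (j : Fin n) (x : Fin n → ℝ) :
    pd (fun y => u y * v y) j x = pd u j x * v x + u x * pd v j x := by
  have h1 := (hu.differentiable (by simp)) x
  have h2 := (hv.differentiable (by simp)) x
  simp only [pd]
  rw [fderiv_fun_mul h1 h2]
  simp
  ring

theorem pd_prod {ι : Type*} [DecidableEq ι] (s : Finset ι) {u : ι → (Fin n → ℝ) → ℝ}
    (hu : ∀ k, ContDiff ℝ ∞ (u k)) (j : Fin n) (x : Fin n → ℝ) :
    pd (fun y => ∏ k ∈ s, u k y) j x = ∑ k ∈ s, (∏ l ∈ s.erase k, u l x) * pd (u k) j x := by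
  simp only [pd]
  rw [fderiv_finsetProd fun k _ => ((hu k).differentiable (by simp)) x]
  simp

/-- The Jacobian determinant of a family of smooth functions, one of which has compact support,
integrates to zero. -/
theorem integral_det_jac_eq_zero {h : Fin n → (Fin n → ℝ) → ℝ}
    (hh : ∀ k, ContDiff ℝ ∞ (h k)) (i : Fin n) (hc : HasCompactSupport (h i)) :
    ∫ x, (jac h x).det = 0 := by
  set P : Equiv.Perm (Fin n) → (Fin n → ℝ) → ℝ :=
    fun σ x => ∏ k ∈ Finset.univ.erase i, pd (h k) (σ k) x with hP
  have hPs : ∀ σ, ContDiff ℝ ∞ (P σ) := fun σ =>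
    contDiff_prod fun k _ => contDiff_pd (hh k) _
  have hprod : ∀ σ, ContDiff ℝ ∞ fun y => h i y * P σ y := fun σ => (hh i).mul (hPs σ)
  have hcs : ∀ σ, HasCompactSupport fun y => h i y * P σ y := fun σ => hc.mul_right
  have piola : ∀ x, ∑ σ : Equiv.Perm (Fin n), ((Equiv.Perm.sign σ : ℤ) : ℝ) *
      pd (P σ) (σ i) x = 0 := by
    intro x
    have : ∀ σ : Equiv.Perm (Fin n), pd (P σ) (σ i) x = ∑ k ∈ Finset.univ.erase i,
        (∏ l ∈ (Finset.univ.erase i).erase k, pd (h l) (σ l) x) *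
          pd (pd (h k) (σ k)) (σ i) x := fun σ =>
      pd_prod _ (u := fun k => pd (h k) (σ k)) (fun k => contDiff_pd (hh k) _) _ _
    simp only [this, Finset.mul_sum]
    rw [Finset.sum_comm]
    refine Finset.sum_eq_zero fun k hk => ?_
    exact sum_sign_mul_prod_pd_pd hh (Finset.ne_of_mem_erase hk) x
  have hdet : ∀ x, (jac h x).det = ∑ σ : Equiv.Perm (Fin n), ((Equiv.Perm.sign σ : ℤ) : ℝ) *
      pd (fun y => h i y * P σ y) (σ i) x := by
    intro x
    have e1 : ∀ σ : Equiv.Perm (Fin n), pd (fun y => h i y * P σ y) (σ i) x =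
        pd (h i) (σ i) x * P σ x + h i x * pd (P σ) (σ i) x := fun σ => pd_mul (hh i) (hPs σ) _ _
    simp only [e1, mul_add, Finset.sum_add_distrib]
    have e2 : ∑ σ : Equiv.Perm (Fin n), ((Equiv.Perm.sign σ : ℤ) : ℝ) *
        (h i x * pd (P σ) (σ i) x) = 0 := by
      rw [← mul_zero (h i x), ← piola x, Finset.mul_sum]
      exact Finset.sum_congr rfl fun σ _ => by ring
    rw [e2, add_zero, Matrix.det_apply']
    refine Finset.sum_congr rfl fun σ _ => ?_
    congr 1
    exact (Finset.mul_prod_erase Finset.univ (fun k => pd (h k) (σ k) x)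
      (Finset.mem_univ i)).symm
  simp only [hdet]
  rw [integral_finsetSum]
  · refine Finset.sum_eq_zero fun σ _ => ?_
    rw [integral_const_mul, integral_pd_eq_zero (hprod σ) (hcs σ), mul_zero]
  · intro σ _
    exact ((contDiff_pd (hprod σ) _).continuous.integrable_of_hasCompactSupport
      ((hcs σ).fderiv_apply ℝ _)).const_mul _

theorem det_jac_update_sub {h : Fin n → (Fin n → ℝ) → ℝ} (i : Fin n)
    {a b : (Fin n → ℝ) → ℝ} (ha : ContDiff ℝ ∞ a) (hb : ContDiff ℝ ∞ b) (x : Fin n → ℝ) :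
    (jac (Function.update h i a) x).det - (jac (Function.update h i b) x).det
      = (jac (Function.update h i (fun y => a y - b y)) x).det := by
  have key : ∀ u : (Fin n → ℝ) → ℝ, jac (Function.update h i u) x
      = (jac h x).updateCol i (fun j => pd u j x) := by
    intro u
    ext j k
    by_cases hk : k = i
    · subst hk; simp [jac]
    · simp [jac, hk]
  have e : (fun j => pd a j x) = (fun j => pd (fun y => a y - b y) j x) + fun j => pd b j x := by
    ext j
    simp only [pd, Pi.add_apply]
    rw [fderiv_fun_sub ((ha.differentiable (by simp)) x) ((hb.differentiable (by simp)) x)]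
    simp
  rw [key, key, key, e, Matrix.det_updateCol_add]
  ring

/-- The integral of the Jacobian determinant over `Ω` does not change when the map is modified in
a compact part of `Ω`. -/
theorem setIntegral_det_jac_congr {Ω : Set (Fin n → ℝ)} (hΩ : Bornology.IsBounded Ω)
    {F G : Fin n → (Fin n → ℝ) → ℝ}
    (hF : ∀ k, ContDiff ℝ ∞ (F k)) (hG : ∀ k, ContDiff ℝ ∞ (G k)) {K : Set (Fin n → ℝ)}
    (hK : IsCompact K) (hKΩ : K ⊆ Ω) (hFG : ∀ k, ∀ x ∉ K, F k x = G k x) :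
    ∫ x in Ω, (jac F x).det = ∫ x in Ω, (jac G x).det := by
  have hint : ∀ H : Fin n → (Fin n → ℝ) → ℝ, (∀ k, ContDiff ℝ ∞ (H k)) →
      IntegrableOn (fun x => (jac H x).det) Ω := fun H hH =>
    (((continuous_det_jac hH).continuousOn).integrableOn_compact hΩ.isCompact_closure).mono_set
      subset_closure
  suffices H : ∀ s : Finset (Fin n), ∫ x in Ω, (jac (fun k => if k ∈ s then F k else G k) x).det
      = ∫ x in Ω, (jac G x).det by
    simpa using H Finset.univ
  intro s
  induction s using Finset.induction_on with
  | empty => simp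
  | insert i s hi ih =>
    rw [← ih]
    set h := fun k => if k ∈ s then F k else G k with hh
    have hs : ∀ k, ContDiff ℝ ∞ (h k) := fun k => by
      simp only [hh]; split_ifs
      exacts [hF k, hG k]
    have e1 : (fun k => if k ∈ insert i s then F k else G k) = Function.update h i (F i) := by
      ext k : 1
      by_cases hk : k = i
      · subst hk; simp
      · simp [hh, hk]
    have e2 : h = Function.update h i (G i) := by
      ext k : 1
      by_cases hk : k = i
      · subst hk; simp [hh, hi]
      · simp [hk]
    have hup : ∀ u, ContDiff ℝ ∞ u → ∀ k, ContDiff ℝ ∞ (Function.update h i u k) := by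
      intro u hu k
      by_cases hk : k = i
      · subst hk; simpa using hu
      · simpa [hk] using hs k
    rw [← sub_eq_zero, e1]
    conv_lhs => enter [2, 2, x]; rw [e2]
    rw [← integral_sub (hint _ (hup _ (hF i))) (hint _ (hup _ (hG i)))]
    simp only [det_jac_update_sub i (hF i) (hG i)]
    have hsupp : Function.support (fun y => F i y - G i y) ⊆ K := by
      intro y hy
      by_contra hyK
      exact hy (by simp [hFG i y hyK])
    have hcs : HasCompactSupport (fun y => F i y - G i y) :=
      HasCompactSupport.of_support_subset_isCompact hK hsupp
    have hts : tsupport (fun y => F i y - G i y) ⊆ K :=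
      closure_minimal hsupp hK.isClosed
    rw [setIntegral_eq_integral_of_forall_compl_eq_zero]
    · exact integral_det_jac_eq_zero (hup _ ((hF i).sub (hG i))) i (by simpa using hcs)
    · intro x hx
      refine Matrix.det_eq_zero_of_column_eq_zero i fun j => ?_
      simp only [jac, Matrix.of_apply, Function.update_self, pd]
      have : x ∉ tsupport (fderiv ℝ (fun y => F i y - G i y)) := fun h' =>
        hx (hKΩ (hts (tsupport_fderiv_subset ℝ h')))
      rw [image_eq_zero_of_notMem_tsupport this]
      simp

theorem det_fderiv_eq_det_jac {g : (Fin n → ℝ) → Fin n → ℝ} {x : Fin n → ℝ}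
    (hg : DifferentiableAt ℝ g x) :
    (fderiv ℝ g x).det = (jac (fun k y => g y k) x).det := by
  rw [ContinuousLinearMap.det, ← LinearMap.det_toMatrix', ← Matrix.det_transpose]
  congr 1
  ext j k
  rw [Matrix.transpose_apply, LinearMap.toMatrix'_apply]
  simp only [jac, Matrix.of_apply, pd]
  rw [fderiv_apply hg]
  rfl

theorem det_jac_comp {g : (Fin n → ℝ) → Fin n → ℝ} (hg : ContDiff ℝ ∞ g) {φ : ℝ → ℝ}
    (hφ : ContDiff ℝ ∞ φ) (x : Fin n → ℝ) :
    (jac (fun k y => φ (g y k)) x).det = (∏ k, deriv φ (g x k)) * (fderiv ℝ g x).det := by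
  have hgx := (hg.differentiable (by simp)) x
  rw [det_fderiv_eq_det_jac hgx, ← Matrix.det_mul_row]
  congr 1
  ext j k
  simp only [jac, Matrix.of_apply, pd]
  have h1 : HasFDerivAt (fun y => g y k) (fderiv ℝ (fun y => g y k) x) x :=
    (differentiableAt_pi.1 hgx k).hasFDerivAt
  have h2 := ((hφ.differentiable (by simp)) (g x k)).hasDerivAt.comp_hasFDerivAt x h1
  have := h2.fderiv
  simp only [Function.comp_def] at this
  rw [this]
  simp

/-- A smooth monotone step from `0` to `1` across `[-ε, ε]`. -/
noncomputable def step (ε s : ℝ) : ℝ := Real.smoothTransition ((s + ε) / (2 * ε))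

theorem contDiff_step (ε : ℝ) : ContDiff ℝ ∞ (step ε) :=
  Real.smoothTransition.contDiff.comp ((contDiff_id.add contDiff_const).div_const _)

theorem step_of_le {ε s : ℝ} (hε : 0 < ε) (h : s ≤ -ε) : step ε s = 0 :=
  Real.smoothTransition.zero_of_nonpos (div_nonpos_of_nonpos_of_nonneg (by linarith) (by linarith))

theorem step_of_ge {ε s : ℝ} (hε : 0 < ε) (h : ε ≤ s) : step ε s = 1 :=
  Real.smoothTransition.one_of_one_le ((one_le_div (by linarith)).2 (by linarith))

theorem deriv_step_eq_zero {ε s : ℝ} (hε : 0 < ε) (h : ε < |s|) : deriv (step ε) s = 0 := by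
  rcases lt_abs.1 h with h | h
  · have : step ε =ᶠ[𝓝 s] fun _ => 1 := by
      filter_upwards [lt_mem_nhds h] with t ht using step_of_ge hε ht.le
    rw [this.deriv_eq, deriv_const]
  · have : step ε =ᶠ[𝓝 s] fun _ => 0 := by
      filter_upwards [gt_mem_nhds (show s < -ε by linarith)] with t ht using step_of_le hε ht.le
    rw [this.deriv_eq, deriv_const]

theorem integral_deriv_step {ε : ℝ} (hε : 0 < ε) : ∫ s, deriv (step ε) s = 1 := by
  have hd : ∀ s, HasDerivAt (step ε) (deriv (step ε) s) s := fun s =>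
    ((contDiff_step ε).differentiable (by simp) s).hasDerivAt
  have hc : Continuous (deriv (step ε)) := (contDiff_step ε).continuous_deriv (by simp)
  have hs : HasCompactSupport (deriv (step ε)) := by
    refine HasCompactSupport.intro (isCompact_Icc (a := -ε) (b := ε)) fun s hs => ?_
    refine deriv_step_eq_zero hε ?_
    rwa [mem_Icc, ← abs_le, not_le] at hs
  have := integral_of_hasDerivAt_of_tendsto hd (hc.integrable_of_hasCompactSupport hs)
    (m := 0) (n := 1)
    (tendsto_const_nhds.congr' (by
      filter_upwards [eventually_le_atBot (-ε)] with t ht using (step_of_le hε ht).symm))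
    (tendsto_const_nhds.congr' (by
      filter_upwards [eventually_ge_atTop ε] with t ht using (step_of_ge hε ht).symm))
  simpa using this

theorem prod_deriv_step_eq_zero {ε : ℝ} (hε : 0 < ε) {y : Fin n → ℝ} (h : ε < ‖y‖) :
    ∏ k, deriv (step ε) (y k) = 0 := by
  by_contra hne
  refine h.not_ge ((pi_norm_le_iff_of_nonneg hε.le).2 fun k => ?_)
  by_contra! hk
  exact hne (Finset.prod_eq_zero (Finset.mem_univ k) (deriv_step_eq_zero hε hk))

theorem setIntegral_prod_deriv_step {ε : ℝ} (hε : 0 < ε) {A : Set (Fin n → ℝ)}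
    (h : closedBall 0 ε ⊆ A) :
    ∫ y in A, ∏ k, deriv (step ε) (y k) = 1 := by
  have : ∫ y : Fin n → ℝ, ∏ k, deriv (step ε) (y k) = 1 := by
    rw [integral_fintype_prod_volume_eq_prod (fun _ => deriv (step ε))]
    simp [integral_deriv_step hε]
  rw [← this, setIntegral_eq_integral_of_forall_compl_eq_zero]
  intro y hy
  refine prod_deriv_step_eq_zero hε ?_
  by_contra! hy'
  exact hy (h (by simpa using hy'))

/-- `g` is smooth and has `0` as a regular value on `Ω`. -/
def RegOn (g : (Fin n → ℝ) → Fin n → ℝ) (Ω : Set (Fin n → ℝ)) : Prop :=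
  ContDiff ℝ ∞ g ∧ ∀ x ∈ Ω, g x = 0 → (fderiv ℝ g x).det ≠ 0

theorem exists_nhds_integral {g : (Fin n → ℝ) → Fin n → ℝ} (hg : ContDiff ℝ ∞ g)
    {z : Fin n → ℝ} (hz : g z = 0) (hd : (fderiv ℝ g z).det ≠ 0) {U : Set (Fin n → ℝ)}
    (hU : U ∈ 𝓝 z) :
    ∃ V, IsOpen V ∧ z ∈ V ∧ V ⊆ U ∧ InjOn g V ∧ ∃ s : ℤ, (s : ZMod 2) = 1 ∧
      ∀ᶠ ε in 𝓝[>] (0 : ℝ), ∫ x in V, (jac (fun k y => step ε (g y k)) x).det = s := by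
  have hgd : ∀ x, HasFDerivAt g (fderiv ℝ g x) x := fun x =>
    (hg.differentiable (by simp) x).hasFDerivAt
  have hsd : HasStrictFDerivAt g
      (((fderiv ℝ g z).toContinuousLinearEquivOfDetNeZero hd : (Fin n → ℝ) ≃L[ℝ] (Fin n → ℝ)) :
        (Fin n → ℝ) →L[ℝ] (Fin n → ℝ)) z := by
    rw [ContinuousLinearMap.coe_toContinuousLinearEquivOfDetNeZero]
    exact hg.contDiffAt.hasStrictFDerivAt (by simp)
  set e := hsd.toOpenPartialHomeomorph g with he
  have hcoe : (e : (Fin n → ℝ) → Fin n → ℝ) = g := hsd.toOpenPartialHomeomorph_coe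
  have hze : z ∈ e.source := hsd.mem_toOpenPartialHomeomorph_source
  have hcd : Continuous fun x => (fderiv ℝ g x).det :=
    ContinuousLinearMap.continuous_det.comp (hg.continuous_fderiv (by simp))
  obtain ⟨s, hs1, hs2, hsV⟩ : ∃ s : ℤ, (s : ZMod 2) = 1 ∧ (s = 1 ∨ s = -1) ∧
      ∀ᶠ x in 𝓝 z, (fderiv ℝ g x).det = s * |(fderiv ℝ g x).det| := by
    rcases lt_or_gt_of_ne hd with h | h
    · refine ⟨-1, by decide, Or.inr rfl, ?_⟩
      filter_upwards [hcd.continuousAt.eventually (gt_mem_nhds h)] with x hx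
      rw [abs_of_neg hx]; simp
    · refine ⟨1, by decide, Or.inl rfl, ?_⟩
      filter_upwards [hcd.continuousAt.eventually (lt_mem_nhds h)] with x hx
      rw [abs_of_pos hx]; simp
  obtain ⟨V, hVsub, hVo, hzV⟩ := _root_.mem_nhds_iff.1
    (inter_mem (inter_mem hU (e.open_source.mem_nhds hze)) hsV)
  have hVe : V ⊆ e.source := fun x hx => (hVsub hx).1.2
  have hinj : InjOn g V := by rw [← hcoe]; exact e.injOn.mono hVe
  have hgV : IsOpen (g '' V) := by
    rw [← hcoe]; exact e.isOpen_image_of_subset_source hVo hVe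
  refine ⟨V, hVo, hzV, fun x hx => (hVsub hx).1.1, hinj, s, hs1, ?_⟩
  have h0 : g '' V ∈ 𝓝 (0 : Fin n → ℝ) := hgV.mem_nhds ⟨z, hzV, hz⟩
  filter_upwards [(eventually_closedBall_subset h0).filter_mono nhdsWithin_le_nhds,
    self_mem_nhdsWithin] with ε hε hε0
  have hε0 : 0 < ε := hε0
  have := integral_image_eq_integral_abs_det_fderiv_smul volume hVo.measurableSet
    (fun x _ => (hgd x).hasFDerivWithinAt) hinj (fun y => ∏ k, deriv (step ε) (y k))
  rw [setIntegral_prod_deriv_step hε0 hε] at this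
  have h2 : ∫ x in V, (jac (fun k y => step ε (g y k)) x).det
      = ∫ x in V, (s : ℝ) * (|(fderiv ℝ g x).det| • ∏ k, deriv (step ε) (g x k)) := by
    refine setIntegral_congr_fun hVo.measurableSet fun x hx => ?_
    have hx' : (fderiv ℝ g x).det = s * |(fderiv ℝ g x).det| := (hVsub hx).2
    simp only [smul_eq_mul]
    rw [det_jac_comp hg (contDiff_step ε), mul_comm, ← mul_assoc, ← hx']
  rw [h2, integral_const_mul, ← this, mul_one]

theorem finite_zeros_of_injOn {X Y : Type*} [TopologicalSpace X] {Z : Set X} (hZ : IsCompact Z)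
    {f : X → Y} {q : Y} (hf : ∀ z ∈ Z, f z = q) (h : ∀ z ∈ Z, ∃ U ∈ 𝓝 z, InjOn f U) :
    Z.Finite := by
  choose! U hU hinj using h
  obtain ⟨t, ht, hcov⟩ := hZ.elim_nhds_subcover U hU
  refine (t.finite_toSet).subset fun z hz => ?_
  obtain ⟨a, ha, hza⟩ := mem_iUnion₂.1 (hcov hz)
  have : z = a := hinj a (ht a ha) hza (mem_of_mem_nhds (hU a (ht a ha)))
    ((hf z hz).trans (hf a (ht a ha)).symm)
  exact this ▸ ha

theorem RegOn.finite {Ω : Set (Fin n → ℝ)} (hb : Bornology.IsBounded Ω)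
    {g : (Fin n → ℝ) → Fin n → ℝ} (hg : RegOn g Ω) (hfr : ∀ x ∈ frontier Ω, g x ≠ 0) :
    {x ∈ Ω | g x = 0}.Finite := by
  have heq : {x ∈ Ω | g x = 0} = closure Ω ∩ {x | g x = 0} := by
    ext x
    refine ⟨fun h => ⟨subset_closure h.1, h.2⟩, fun h => ⟨?_, h.2⟩⟩
    by_contra hx
    exact hfr x ⟨h.1, fun hi => hx (interior_subset hi)⟩ h.2
  refine finite_zeros_of_injOn (f := g) (q := 0) ?_ (fun z hz => hz.2) fun z hz => ?_
  · rw [heq]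
    exact hb.isCompact_closure.inter_right (isClosed_eq hg.1.continuous continuous_const)
  · obtain ⟨V, hV, hzV, -, hinj, -⟩ :=
      exists_nhds_integral hg.1 hz.2 (hg.2 z hz.1 hz.2) univ_mem
    exact ⟨V, hV.mem_nhds hzV, hinj⟩

theorem exists_int_count {Ω : Set (Fin n → ℝ)} (hΩ : IsOpen Ω) (hb : Bornology.IsBounded Ω)
    {g : (Fin n → ℝ) → Fin n → ℝ} (hg : RegOn g Ω) (hfr : ∀ x ∈ frontier Ω, g x ≠ 0) :
    ∃ m : ℤ, (m : ZMod 2) = ({x ∈ Ω | g x = 0}.ncard : ZMod 2) ∧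
      ∀ᶠ ε in 𝓝[>] (0 : ℝ), ∫ x in Ω, (jac (fun k y => step ε (g y k)) x).det = m := by
  classical
  set Z := {x ∈ Ω | g x = 0} with hZ
  have hfin : Z.Finite := hg.finite hb hfr
  obtain ⟨U, hU, hdisj⟩ := hfin.t2_separation
  have : ∀ z ∈ Z, ∃ V, IsOpen V ∧ z ∈ V ∧ V ⊆ U z ∩ Ω ∧ ∃ s : ℤ, (s : ZMod 2) = 1 ∧
      ∀ᶠ ε in 𝓝[>] (0 : ℝ), ∫ x in V, (jac (fun k y => step ε (g y k)) x).det = s := by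
    intro z hz
    obtain ⟨V, h1, h2, h3, -, h4⟩ := exists_nhds_integral hg.1 hz.2 (hg.2 z hz.1 hz.2)
      (inter_mem ((hU z).2.mem_nhds (hU z).1) (hΩ.mem_nhds hz.1))
    exact ⟨V, h1, h2, h3, h4⟩
  choose! V hVo hzV hVsub s hs hint using this
  refine ⟨∑ z ∈ hfin.toFinset, s z, ?_, ?_⟩
  · rw [Int.cast_sum, Finset.sum_congr rfl (fun z hz => hs z (hfin.mem_toFinset.1 hz)),
      ncard_eq_toFinset_card Z hfin]
    simp
  · set K := closure Ω \ ⋃ z ∈ Z, V z with hK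
    have hKc : IsCompact K := hb.isCompact_closure.diff (isOpen_biUnion fun z hz => hVo z hz)
    have hK0 : ∀ x ∈ K, 0 < ‖g x‖ := by
      rintro x ⟨hx, hx'⟩
      rw [norm_pos_iff]
      intro h0
      by_cases hxΩ : x ∈ Ω
      · exact hx' (mem_iUnion₂.2 ⟨x, ⟨hxΩ, h0⟩, hzV x ⟨hxΩ, h0⟩⟩)
      · exact hfr x ⟨hx, fun hi => hxΩ (interior_subset hi)⟩ h0
    obtain ⟨δ, hδ, hδK⟩ := hKc.exists_forall_le' hg.1.continuous.norm.continuousOn hK0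
    have hall : ∀ᶠ ε in 𝓝[>] (0 : ℝ), ∀ z ∈ Z,
        ∫ x in V z, (jac (fun k y => step ε (g y k)) x).det = s z :=
      (hfin.eventually_all).2 fun z hz => hint z hz
    filter_upwards [hall, self_mem_nhdsWithin,
      (gt_mem_nhds hδ).filter_mono nhdsWithin_le_nhds] with ε h1 hε hεδ
    have hε : 0 < ε := hε
    rw [setIntegral_eq_of_subset_of_forall_sdiff_eq_zero (s := ⋃ z ∈ hfin.toFinset, V z)
      hΩ.measurableSet, integral_biUnion_finset, Int.cast_sum]
    · exact Finset.sum_congr rfl fun z hz => h1 z (hfin.mem_toFinset.1 hz)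
    · exact fun z hz => (hVo z (hfin.mem_toFinset.1 hz)).measurableSet
    · intro a ha b hb hab
      exact (hdisj (hfin.mem_toFinset.1 ha) (hfin.mem_toFinset.1 hb) hab).mono
        (fun x hx => (hVsub a (hfin.mem_toFinset.1 ha) hx).1)
        (fun x hx => (hVsub b (hfin.mem_toFinset.1 hb) hx).1)
    · intro z hz
      refine ((continuous_det_jac fun k => ?_).continuousOn.integrableOn_compact
        hb.isCompact_closure).mono_set
        (((hVsub z (hfin.mem_toFinset.1 hz)).trans inter_subset_right).trans subset_closure)
      exact (contDiff_step ε).comp (contDiff_pi.1 hg.1 k)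
    · exact iUnion₂_subset fun z hz x hx => (hVsub z (hfin.mem_toFinset.1 hz) hx).2
    · rintro x ⟨hx, hx'⟩
      rw [det_jac_comp hg.1 (contDiff_step ε), prod_deriv_step_eq_zero hε, zero_mul]
      refine hεδ.trans_le (hδK x ⟨subset_closure hx, fun h => hx' ?_⟩)
      simpa using h

theorem exists_cutoff {A Ω : Set (Fin n → ℝ)} (hA : IsClosed A) (hΩ : IsOpen Ω)
    (hb : Bornology.IsBounded Ω) (hAΩ : A ⊆ Ω) :
    ∃ κ : (Fin n → ℝ) → ℝ, ContDiff ℝ ∞ κ ∧ IsCompact (tsupport κ) ∧ tsupport κ ⊆ Ω ∧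
      (∀ x ∈ A, ∀ᶠ y in 𝓝 x, κ y = 1) ∧ ∀ x, κ x ∈ Icc (0 : ℝ) 1 := by
  obtain ⟨κ, h0, h1, h⟩ := exists_contMDiffMap_zero_one_nhds_of_isClosed 𝓘(ℝ, Fin n → ℝ)
    (n := (⊤ : ℕ∞)) hΩ.isClosed_compl hA (disjoint_compl_left_iff_subset.2 hAΩ)
  have hsub : tsupport κ ⊆ Ω := by
    intro x hx
    by_contra hxΩ
    exact notMem_tsupport_iff_eventuallyEq.2 (eventually_nhdsSet_iff_forall.1 h0 x hxΩ) hx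
  exact ⟨κ, κ.contMDiff.contDiff,
    hb.isCompact_closure.of_isClosed_subset (isClosed_tsupport _) (hsub.trans subset_closure),
    hsub, eventually_nhdsSet_iff_forall.1 h1, h⟩

/-- The parity of the number of zeros of `f` in `Ω`. -/
noncomputable def par {X Y : Type*} [Zero Y] (f : X → Y) (Ω : Set X) : ZMod 2 :=
  ({x ∈ Ω | f x = 0}.ncard : ZMod 2)

theorem par_eq_of_boundary_eq {Ω : Set (Fin n → ℝ)} (hΩ : IsOpen Ω)
    (hb : Bornology.IsBounded Ω) {g₀ g₁ : (Fin n → ℝ) → Fin n → ℝ} (h₀ : RegOn g₀ Ω)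
    (h₁ : RegOn g₁ Ω) {K : Set (Fin n → ℝ)} (hK : IsCompact K) (hKΩ : K ⊆ Ω)
    (heq : ∀ x ∉ K, g₀ x = g₁ x) (hfr : ∀ x ∈ frontier Ω, g₀ x ≠ 0) : par g₀ Ω = par g₁ Ω := by
  have hfr₁ : ∀ x ∈ frontier Ω, g₁ x ≠ 0 := fun x hx => by
    rw [← heq x fun hxK => ?_]
    · exact hfr x hx
    · rw [hΩ.frontier_eq] at hx
      exact hx.2 (hKΩ hxK)
  obtain ⟨m₀, e₀, i₀⟩ := exists_int_count hΩ hb h₀ hfr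
  obtain ⟨m₁, e₁, i₁⟩ := exists_int_count hΩ hb h₁ hfr₁
  obtain ⟨ε, hε₀, hε₁⟩ := (i₀.and i₁).exists
  have : (m₀ : ℝ) = m₁ := by
    rw [← hε₀, ← hε₁]
    refine setIntegral_det_jac_congr hb (fun k => (contDiff_step ε).comp (contDiff_pi.1 h₀.1 k))
      (fun k => (contDiff_step ε).comp (contDiff_pi.1 h₁.1 k)) hK hKΩ fun k x hx => ?_
    rw [heq x hx]
  rw [par, par, ← e₀, ← e₁, Int.cast_injective this]

theorem RegOn.par_eq {Ω : Set (Fin n → ℝ)} (hΩ : IsOpen Ω)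
    (hb : Bornology.IsBounded Ω) {g₀ g₁ : (Fin n → ℝ) → Fin n → ℝ} (h₀ : RegOn g₀ Ω)
    (h₁ : RegOn g₁ Ω)
    (hfr : ∀ x ∈ frontier Ω, ∀ t ∈ Icc (0 : ℝ) 1, g₀ x + t • (g₁ x - g₀ x) ≠ 0) :
    par g₀ Ω = par g₁ Ω := by
  set A : Set (Fin n → ℝ) :=
    {x | x ∈ closure Ω ∧ ∃ t ∈ Icc (0 : ℝ) 1, g₀ x + t • (g₁ x - g₀ x) = 0} with hA
  have hAc : IsClosed A := by
    have h1 : IsCompact ((Icc (0 : ℝ) 1 ×ˢ closure Ω) ∩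
        {p : ℝ × (Fin n → ℝ) | g₀ p.2 + p.1 • (g₁ p.2 - g₀ p.2) = 0}) := by
      refine (isCompact_Icc.prod hb.isCompact_closure).inter_right (isClosed_eq ?_ ?_)
      · have := h₀.1.continuous
        have := h₁.1.continuous
        fun_prop
      · exact continuous_const
    convert (h1.image continuous_snd).isClosed using 1
    ext x
    constructor
    · rintro ⟨hx, t, ht, h⟩
      exact ⟨(t, x), ⟨⟨ht, hx⟩, h⟩, rfl⟩
    · rintro ⟨⟨t, y⟩, ⟨⟨ht, hy⟩, h⟩, rfl⟩
      exact ⟨hy, t, ht, h⟩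
  have hAΩ : A ⊆ Ω := by
    rintro x ⟨hx, t, ht, h⟩
    by_contra hxΩ
    refine hfr x ?_ t ht h
    rw [hΩ.frontier_eq]
    exact ⟨hx, hxΩ⟩
  obtain ⟨κ, hκ, hκc, hκs, hκ1, hκI⟩ := exists_cutoff hAc hΩ hb hAΩ
  set g : (Fin n → ℝ) → Fin n → ℝ := fun x => g₀ x + κ x • (g₁ x - g₀ x) with hg
  have hgA : ∀ x ∈ A, g =ᶠ[𝓝 x] g₁ := by
    intro x hx
    filter_upwards [hκ1 x hx] with y hy
    simp [hg, hy]
  have hz : ∀ x ∈ Ω, g x = 0 → x ∈ A := fun x hx h => ⟨subset_closure hx, κ x, hκI x, h⟩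
  have hz₁ : ∀ x ∈ Ω, g₁ x = 0 → x ∈ A := fun x hx h =>
    ⟨subset_closure hx, 1, ⟨zero_le_one, le_rfl⟩, by simp [h]⟩
  have hreg : RegOn g Ω := by
    refine ⟨h₀.1.add (hκ.smul (h₁.1.sub h₀.1)), fun x hx h => ?_⟩
    have := hgA x (hz x hx h)
    rw [this.fderiv_eq]
    exact h₁.2 x hx (this.eq_of_nhds ▸ h)
  have hpar : par g Ω = par g₁ Ω := by
    unfold par
    congr 2
    ext x
    refine ⟨fun h => ⟨h.1, ?_⟩, fun h => ⟨h.1, ?_⟩⟩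
    · rw [← (hgA x (hz x h.1 h.2)).eq_of_nhds]; exact h.2
    · rw [(hgA x (hz₁ x h.1 h.2)).eq_of_nhds]; exact h.2
  rw [← hpar]
  refine par_eq_of_boundary_eq hΩ hb h₀ hreg hκc hκs (fun x hx => ?_) fun x hx => ?_
  · simp [hg, image_eq_zero_of_notMem_tsupport hx]
  · simpa using hfr x hx 0 ⟨le_rfl, zero_le_one⟩

/-- Smooth approximation on a compact set, with finitely many prescribed regular values. -/
theorem exists_smooth_approx {K : Set (Fin n → ℝ)} (hK : IsCompact K)
    {f : (Fin n → ℝ) → Fin n → ℝ} (hf : ContinuousOn f K) {δ : ℝ} (hδ : 0 < δ)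
    (P : Set (Fin n → ℝ)) (hP : P.Finite) :
    ∃ g : (Fin n → ℝ) → Fin n → ℝ, ContDiff ℝ ∞ g ∧ (∀ x ∈ K, ‖g x - f x‖ < δ) ∧
      ∀ p ∈ P, ∀ x, g x = p → (fderiv ℝ g x).det ≠ 0 := by
  classical
  set t : (Fin n → ℝ) → Set (Fin n → ℝ) := fun x => if x ∈ K then ball (f x) (δ / 2) else univ
    with ht
  obtain ⟨g, hg⟩ := exists_contMDiffMap_forall_mem_convex_of_local_const 𝓘(ℝ, Fin n → ℝ)
    (n := (⊤ : ℕ∞)) (t := t) (fun x => by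
      by_cases hx : x ∈ K
      · simpa [ht, hx] using convex_ball _ _
      · simpa [ht, hx] using convex_univ) (fun x => by
      by_cases hx : x ∈ K
      · refine ⟨f x, ?_⟩
        have := (hf x hx).eventually (ball_mem_nhds (f x) (half_pos hδ))
        rw [eventually_nhdsWithin_iff] at this
        filter_upwards [this] with y hy
        by_cases hyK : y ∈ K
        · simpa [ht, hyK, dist_comm] using hy hyK
        · simp [ht, hyK]
      · refine ⟨0, ?_⟩
        filter_upwards [hK.isClosed.isOpen_compl.mem_nhds hx] with y hy
        have : y ∉ K := hy
        simp [ht, this])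
  have hgs : ContDiff ℝ ∞ g := g.contMDiff.contDiff
  have hgd : ∀ x, HasFDerivAt g (fderiv ℝ g x) x := fun x =>
    (hgs.differentiable (by simp) x).hasFDerivAt
  set C : Set (Fin n → ℝ) := g '' {x | (fderiv ℝ g x).det = 0} with hC
  have hC0 : volume C = 0 := by
    refine addHaar_image_eq_zero_of_det_fderivWithin_eq_zero volume
      (fun x _ => (hgd x).hasFDerivWithinAt) fun x hx => hx
  have hbad : volume (⋃ p ∈ P, (fun c => p - c) ⁻¹' C) = 0 := by
    rw [measure_biUnion_null_iff hP.countable]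
    intro p hp
    rw [(Measure.measurePreserving_sub_left volume p).quasiMeasurePreserving.preimage_null hC0]
  obtain ⟨c, hc, hcb⟩ : ∃ c ∈ ball (0 : Fin n → ℝ) (δ / 2),
      c ∉ ⋃ p ∈ P, (fun c => p - c) ⁻¹' C := by
    by_contra! hcon
    exact (measure_ball_pos volume (0 : Fin n → ℝ) (half_pos hδ)).ne' (measure_mono_null hcon hbad)
  refine ⟨fun x => g x + c, hgs.add contDiff_const, fun x hx => ?_, fun p hp x hx h0 => hcb ?_⟩
  · have h1 : ‖g x - f x‖ < δ / 2 := by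
      have := hg x
      simp only [ht, hx, if_true, mem_ball, dist_eq_norm] at this
      exact this
    calc ‖g x + c - f x‖ = ‖(g x - f x) + c‖ := by congr 1; abel
      _ ≤ ‖g x - f x‖ + ‖c‖ := norm_add_le _ _
      _ < δ := by
        have : ‖c‖ < δ / 2 := by simpa using hc
        linarith
  · rw [fderiv_add_const] at h0
    exact mem_iUnion₂.2 ⟨p, hp, x, h0, by simp [← hx]⟩

theorem par_eq_sum {X Y ι : Type*} [Zero Y] {f : X → Y} {Ω : Set X}
    (hfin : {x ∈ Ω | f x = 0}.Finite) (I : Finset ι) (A : ι → Set X)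
    (hA : ∀ i ∈ I, A i ⊆ Ω) (hd : ∀ i ∈ I, ∀ j ∈ I, i ≠ j → Disjoint (A i) (A j))
    (hcov : ∀ x ∈ Ω, f x = 0 → ∃ i ∈ I, x ∈ A i) :
    par f Ω = ∑ i ∈ I, par f (A i) := by
  classical
  have hfi : ∀ i ∈ I, {x ∈ A i | f x = 0}.Finite := fun i hi =>
    hfin.subset fun x hx => ⟨hA i hi hx.1, hx.2⟩
  have : {x ∈ Ω | f x = 0} = ⋃ i ∈ I, {x ∈ A i | f x = 0} := by
    ext x
    simp only [mem_ofPred_eq, mem_iUnion, exists_prop]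
    constructor
    · rintro ⟨hx, h⟩
      obtain ⟨i, hi, hxi⟩ := hcov x hx h
      exact ⟨i, hi, hxi, h⟩
    · rintro ⟨i, hi, hxi, h⟩
      exact ⟨hA i hi hxi, h⟩
  unfold par
  rw [this]
  clear this hcov hfin
  induction I using Finset.induction_on with
  | empty => simp
  | insert a s ha ih =>
    have hfa := hfi a (Finset.mem_insert_self _ _)
    have hfs : (⋃ i ∈ s, {x ∈ A i | f x = 0}).Finite :=
      s.finite_toSet.biUnion fun i hi => hfi i (Finset.mem_insert_of_mem hi)
    rw [Finset.set_biUnion_insert, ncard_union_eq ?_ hfa hfs, Finset.sum_insert ha, Nat.cast_add,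
      ih]
    · exact fun i hi => hA i (Finset.mem_insert_of_mem hi)
    · exact fun i hi j hj => hd i (Finset.mem_insert_of_mem hi) j (Finset.mem_insert_of_mem hj)
    · exact fun i hi => hfi i (Finset.mem_insert_of_mem hi)
    · rw [disjoint_iUnion₂_right]
      intro i hi
      exact (hd a (Finset.mem_insert_self _ _) i (Finset.mem_insert_of_mem hi)
        (fun h => ha (h ▸ hi))).mono (fun x hx => hx.1) (fun x hx => hx.1)

theorem RegOn.exists_injOn {g : (Fin n → ℝ) → Fin n → ℝ} {Ω : Set (Fin n → ℝ)} (hg : RegOn g Ω)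
    {z : Fin n → ℝ} (hz : z ∈ Ω) (h0 : g z = 0) : ∃ U ∈ 𝓝 z, InjOn g U := by
  obtain ⟨V, hV, hzV, -, hinj, -⟩ := exists_nhds_integral hg.1 h0 (hg.2 z hz h0) univ_mem
  exact ⟨V, hV.mem_nhds hzV, hinj⟩

/-- `d` is the degree mod 2 over `0` of `f` on `Ω`, computed by a regular approximation. -/
def IsDeg (f : (Fin n → ℝ) → Fin n → ℝ) (Ω : Set (Fin n → ℝ)) (d : ZMod 2) : Prop :=
  ∃ g, RegOn g Ω ∧ (∀ x ∈ frontier Ω, ‖g x - f x‖ < ‖f x‖) ∧ par g Ω = d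

theorem IsDeg.congr {f f' : (Fin n → ℝ) → Fin n → ℝ} {Ω : Set (Fin n → ℝ)} {d : ZMod 2}
    (h : IsDeg f Ω d) (hff' : ∀ x ∈ frontier Ω, f x = f' x) : IsDeg f' Ω d := by
  obtain ⟨g, hg, hfr, hd⟩ := h
  exact ⟨g, hg, fun x hx => hff' x hx ▸ hfr x hx, hd⟩

theorem IsDeg.unique {f : (Fin n → ℝ) → Fin n → ℝ} {Ω : Set (Fin n → ℝ)} {d d' : ZMod 2}
    (hΩ : IsOpen Ω) (hb : Bornology.IsBounded Ω) (h : IsDeg f Ω d) (h' : IsDeg f Ω d') :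
    d = d' := by
  obtain ⟨g, hg, hfr, rfl⟩ := h
  obtain ⟨g', hg', hfr', rfl⟩ := h'
  refine hg.par_eq hΩ hb hg' fun x hx t ht h0 => ?_
  have := (convex_ball (f x) ‖f x‖).add_smul_sub_mem (x := g x) (y := g' x)
    (by simpa [dist_eq_norm] using hfr x hx) (by simpa [dist_eq_norm] using hfr' x hx) ht
  rw [h0] at this
  simp at this

theorem isDeg_ball_of_injOn {f : (Fin n → ℝ) → Fin n → ℝ} {z : Fin n → ℝ} {r : ℝ} (hr : 0 < r)
    (hf : ContinuousOn f (closedBall z r)) (hinj : InjOn f (closedBall z r)) (h0 : f z = 0) :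
    IsDeg f (ball z r) 1 := by
  classical
  set B := closedBall z r with hB
  have hBc : IsCompact B := isCompact_closedBall z r
  have hzB : z ∈ B := mem_closedBall_self hr.le
  have hfB : IsCompact (f '' B) := hBc.image_of_continuousOn hf
  have : CompactSpace B := isCompact_iff_compactSpace.1 hBc
  have hemb : IsClosedEmbedding (B.domRestrict f) :=
    (continuousOn_iff_continuous_domRestrict.1 hf).isClosedEmbedding hinj.injective
  obtain ⟨k, hk⟩ := ContinuousMap.exists_extension hemb
    (⟨fun b : B => (b : Fin n → ℝ) - z, by fun_prop⟩ : C(B, Fin n → ℝ))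
  have hkf : ∀ b ∈ B, k (f b) = b - z := fun b hb => DFunLike.congr_fun hk ⟨b, hb⟩
  have hsB : sphere z r ⊆ B := sphere_subset_closedBall
  obtain ⟨β₀, hβ₀, hβs⟩ := (isCompact_sphere z r).exists_forall_le' (a := 0)
    (f := fun x => ‖f x‖) (hf.mono hsB).norm (fun x hx => by
      rw [norm_pos_iff]
      intro h
      have : x = z := hinj (hsB hx) hzB (h.trans h0.symm)
      subst this
      simp at hx
      exact hr.ne hx)
  set β := β₀ / 2 with hβ
  have hβ0 : 0 < β := half_pos hβ₀
  obtain ⟨η, hη, hηk⟩ := (hfB.diff (isOpen_ball (x := 0) (ε := β))).exists_forall_le' (a := 0)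
    (f := fun x => ‖k x‖) k.continuous.norm.continuousOn (by
      rintro _ ⟨⟨b, hb, rfl⟩, hb'⟩
      rw [norm_pos_iff, hkf b hb]
      intro h
      rw [sub_eq_zero.1 h, h0] at hb'
      exact hb' (mem_ball_self hβ0))
  obtain ⟨g, hgs, hgk, hgr⟩ := exists_smooth_approx hfB k.continuous.continuousOn
    (lt_min hη (half_pos hr)) {0} (finite_singleton _)
  have hgr : ∀ x, g x = 0 → (fderiv ℝ g x).det ≠ 0 := hgr 0 rfl
  set P := closedBall (0 : Fin n → ℝ) β ∩ {x | g x = 0} with hP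
  have hPfin : P.Finite := by
    refine finite_zeros_of_injOn (f := g) (q := 0) ((isCompact_closedBall 0 β).inter_right
      (isClosed_eq hgs.continuous continuous_const)) (fun x hx => hx.2) fun x hx => ?_
    exact RegOn.exists_injOn (Ω := univ) ⟨hgs, fun x _ => hgr x⟩ (mem_univ _) hx.2
  have hO : IsOpen ({x | g x ≠ 0} ∪ ball 0 β) :=
    (isOpen_ne_fun hgs.continuous continuous_const).union isOpen_ball
  have hfBO : f '' B ⊆ {x | g x ≠ 0} ∪ ball 0 β := by
    intro y hy
    by_contra hcon
    simp only [mem_union, mem_ofPred_eq, not_or, not_not] at hcon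
    have h1 := hηk y ⟨hy, hcon.2⟩
    have h2 := hgk y hy
    rw [hcon.1, zero_sub, norm_neg] at h2
    exact absurd (h2.trans_le (min_le_left _ _)) h1.not_gt
  obtain ⟨δ, hδ, hδO⟩ := hfB.exists_thickening_subset_open hO hfBO
  obtain ⟨δ', hδ', hδu⟩ := Metric.mem_uniformity_dist.1
    (hfB.uniformContinuousAt_of_continuousAt g (fun a _ => hgs.continuous.continuousAt)
      (Metric.dist_mem_uniformity (half_pos hr)))
  obtain ⟨f', hfs, hff, hfr⟩ := exists_smooth_approx hBc hf (lt_min hβ0 (lt_min hδ hδ')) P hPfin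
  have hfP : ∀ x ∈ B, g (f' x) = 0 → f' x ∈ P := by
    intro x hx h
    have : f' x ∈ thickening δ (f '' B) := mem_thickening_iff.2 ⟨f x, ⟨x, hx, rfl⟩, by
      rw [dist_eq_norm]
      exact (hff x hx).trans_le ((min_le_right _ _).trans (min_le_left _ _))⟩
    rcases hδO this with h' | h'
    · exact absurd h h'
    · exact ⟨ball_subset_closedBall h', h⟩
  have hfro : frontier (ball z r) ⊆ sphere z r := frontier_ball_subset_sphere
  have hbB : ball z r ⊆ B := ball_subset_closedBall
  have hfd : ∀ x, HasFDerivAt f' (fderiv ℝ f' x) x := fun x =>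
    (hfs.differentiable (by simp) x).hasFDerivAt
  have hgd : ∀ x, HasFDerivAt g (fderiv ℝ g x) x := fun x =>
    (hgs.differentiable (by simp) x).hasFDerivAt
  have hregc : RegOn (g ∘ f') (ball z r) := by
    refine ⟨hgs.comp hfs, fun x hx h => ?_⟩
    rw [((hgd (f' x)).comp x (hfd x)).fderiv, ContinuousLinearMap.det,
      ContinuousLinearMap.toLinearMap_comp, LinearMap.det_comp]
    exact mul_ne_zero (hgr _ h) (hfr _ (hfP x (hbB hx) h) x rfl)
  have hregi : RegOn (fun x => x - z) (ball z r) := by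
    refine ⟨contDiff_id.sub contDiff_const, fun x _ _ => ?_⟩
    rw [fderiv_sub_const, fderiv_fun_id, ContinuousLinearMap.det]
    simp
  have hregp : ∀ p ∈ P, RegOn (fun x => f' x - p) (ball z r) := by
    intro p hp
    refine ⟨hfs.sub contDiff_const, fun x _ h => ?_⟩
    rw [fderiv_sub_const]
    exact hfr p hp x (sub_eq_zero.1 h)
  have hf's : ∀ x ∈ sphere z r, β < ‖f' x‖ := by
    intro x hx
    have h1 := hβs x hx
    have h2 := (hff x (hsB hx)).trans_le (min_le_left _ _)
    have h3 := norm_sub_norm_le (f x) (f' x)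
    rw [norm_sub_rev] at h3
    linarith
  have hpar1 : par (fun x => x - z) (ball z r) = 1 := by
    have : {x | x ∈ ball z r ∧ x - z = 0} = {z} := by
      ext x
      simp only [mem_ofPred_eq, mem_singleton_iff, sub_eq_zero]
      exact ⟨fun h => h.2, fun h => ⟨h ▸ mem_ball_self hr, h⟩⟩
    rw [par, this]
    simp
  have hparc : par (fun x => x - z) (ball z r) = par (g ∘ f') (ball z r) := by
    refine hregi.par_eq isOpen_ball isBounded_ball hregc fun x hx t ht h => ?_
    have hxs := hfro hx
    have hxB := hsB hxs
    have h1 : ‖g (f' x) - (x - z)‖ < r := by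
      have e1 : ‖g (f' x) - g (f x)‖ < r / 2 := by
        have := @hδu (f x) (f' x) (by
          rw [dist_comm, dist_eq_norm]
          exact (hff x hxB).trans_le ((min_le_right _ _).trans (min_le_right _ _))) ⟨x, hxB, rfl⟩
        rw [← dist_eq_norm, dist_comm]
        exact this
      have e2 : ‖g (f x) - k (f x)‖ < r / 2 :=
        (hgk _ ⟨x, hxB, rfl⟩).trans_le (min_le_right _ _)
      rw [← hkf x hxB]
      linarith [norm_sub_le_norm_sub_add_norm_sub (g (f' x)) (g (f x)) (k (f x))]
    have h2 : ‖x - z‖ = r := by simpa [dist_eq_norm] using hxs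
    have h3 : x - z = -(t • (g (f' x) - (x - z))) := eq_neg_of_add_eq_zero_left h
    have h4 : ‖x - z‖ ≤ ‖g (f' x) - (x - z)‖ := by
      conv_lhs => rw [h3]
      rw [norm_neg, norm_smul, Real.norm_of_nonneg ht.1]
      exact mul_le_of_le_one_left (norm_nonneg _) ht.2
    linarith
  have hparp : ∀ p ∈ P, ∀ q ∈ P,
      par (fun x => f' x - p) (ball z r) = par (fun x => f' x - q) (ball z r) := by
    intro p hp q hq
    refine (hregp p hp).par_eq isOpen_ball isBounded_ball (hregp q hq) fun x hx t ht h => ?_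
    have hm := (convex_closedBall (0 : Fin n → ℝ) β).add_smul_sub_mem hp.1 hq.1 ht
    have h1 : f' x = p + t • (q - p) := by
      have : f' x - (p + t • (q - p)) = 0 := by
        rw [← h]
        module
      exact sub_eq_zero.1 this
    rw [← h1, mem_closedBall_zero_iff] at hm
    exact absurd hm (hf's x (hfro hx)).not_ge
  have hsum : par (g ∘ f') (ball z r) = ∑ p ∈ hPfin.toFinset,
      par (fun x => f' x - p) (ball z r) := by
    rw [par_eq_sum (hregc.finite isBounded_ball fun x hx h => ?_) hPfin.toFinset
      (fun p => {x ∈ ball z r | f' x = p}) (fun p _ x hx => hx.1) ?_ ?_]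
    · refine Finset.sum_congr rfl fun p hp => ?_
      unfold par
      congr 2
      ext x
      simp only [mem_ofPred_eq, Function.comp_apply, sub_eq_zero]
      refine ⟨fun h => h.1, fun h => ⟨h, ?_⟩⟩
      rw [h.2]
      exact (hPfin.mem_toFinset.1 hp).2
    · intro p _ q _ hpq
      exact Set.disjoint_left.2 fun x hx hx' => hpq (hx.2.symm.trans hx'.2)
    · exact fun x hx h => ⟨f' x, hPfin.mem_toFinset.2 (hfP x (hbB hx) h), hx, rfl⟩
    · have := (hfP x (hsB (hfro hx)) h).1
      rw [mem_closedBall_zero_iff] at this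
      exact absurd this (hf's x (hfro hx)).not_ge
  have htot : ∑ p ∈ hPfin.toFinset, par (fun x => f' x - p) (ball z r) = 1 := by
    rw [← hsum, ← hparc, hpar1]
  have hne : P.Nonempty := by
    by_contra hne
    rw [not_nonempty_iff_eq_empty] at hne
    have : hPfin.toFinset = ∅ := by simp [hne]
    rw [this] at htot
    simp at htot
  obtain ⟨p, hp⟩ := hne
  rw [Finset.sum_congr rfl fun q hq => hparp q (hPfin.mem_toFinset.1 hq) p hp,
    Finset.sum_const, nsmul_eq_mul] at htot
  refine ⟨fun x => f' x - p, hregp p hp, fun x hx => ?_, ?_⟩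
  · have h1 := hβs x (hfro hx)
    have h2 := (hff x (hsB (hfro hx))).trans_le (min_le_left _ _)
    have h3 : ‖p‖ ≤ β := by simpa using hp.1
    have h4 : f' x - p - f x = (f' x - f x) - p := by abel
    rw [h4]
    have h5 := norm_sub_le (f' x - f x) p
    linarith
  · revert htot
    generalize par (fun x => f' x - p) (ball z r) = m
    generalize ((hPfin.toFinset.card : ℕ) : ZMod 2) = a
    revert a m
    decide

/-- All solutions of `f = 0` in `Ω` are points of local injectivity. -/
def Simple {X Y : Type*} [TopologicalSpace X] [Zero Y] (f : X → Y) (Ω : Set X) : Prop :=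
  ∀ x ∈ Ω, f x = 0 → ∃ U ∈ 𝓝 x, InjOn f U

theorem isDeg_of_simple {Ω : Set (Fin n → ℝ)} (hΩ : IsOpen Ω) (hb : Bornology.IsBounded Ω)
    {f : (Fin n → ℝ) → Fin n → ℝ} (hf : ContinuousOn f (closure Ω))
    (hfr : ∀ x ∈ frontier Ω, f x ≠ 0) (hs : Simple f Ω) : IsDeg f Ω (par f Ω) := by
  classical
  set Z := {x ∈ Ω | f x = 0} with hZ
  have hcΩ : ∀ x ∈ closure Ω, f x = 0 → x ∈ Ω := by
    intro x hx h
    by_contra hxΩ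
    exact hfr x (hΩ.frontier_eq ▸ ⟨hx, hxΩ⟩) h
  have hZfin : Z.Finite := by
    refine finite_zeros_of_injOn (f := f) (q := 0) ?_ (fun x hx => hx.2) fun x hx => hs x hx.1 hx.2
    have : Z = closure Ω ∩ f ⁻¹' {0} := by
      ext x
      exact ⟨fun h => ⟨subset_closure h.1, h.2⟩, fun h => ⟨hcΩ x h.1 h.2, h.2⟩⟩
    rw [this]
    exact hb.isCompact_closure.of_isClosed_subset
      (hf.preimage_isClosed_of_isClosed isClosed_closure isClosed_singleton) inter_subset_left
  obtain ⟨U, hU, hdisj⟩ := hZfin.t2_separation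
  have : ∀ z ∈ Z, ∃ r > 0, closedBall z r ⊆ U z ∩ Ω ∧ IsDeg f (ball z r) 1 := by
    intro z hz
    obtain ⟨W, hW, hinj⟩ := hs z hz.1 hz.2
    obtain ⟨r, hr, hrs⟩ := Metric.nhds_basis_closedBall.mem_iff.1
      (inter_mem (inter_mem ((hU z).2.mem_nhds (hU z).1) (hΩ.mem_nhds hz.1)) hW)
    refine ⟨r, hr, fun x hx => (hrs hx).1, isDeg_ball_of_injOn hr (hf.mono fun x hx => ?_)
      (hinj.mono fun x hx => (hrs hx).2) hz.2⟩
    exact subset_closure (hrs hx).1.2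
  choose! r hr hrs hdeg using this
  have hbd : ∀ z ∈ Z, ∀ w ∈ Z, z ≠ w → Disjoint (closedBall z (r z)) (closedBall w (r w)) :=
    fun z hz w hw h => (hdisj hz hw h).mono (fun x hx => (hrs z hz hx).1)
      (fun x hx => (hrs w hw hx).1)
  set K := closure Ω \ ⋃ z ∈ Z, ball z (r z) with hK
  have hKc : IsCompact K := hb.isCompact_closure.diff (isOpen_biUnion fun z _ => isOpen_ball)
  obtain ⟨δ, hδ, hδK⟩ := hKc.exists_forall_le' (a := 0) (f := fun x => ‖f x‖)
    (hf.mono sdiff_subset).norm (by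
      rintro x ⟨hx, hx'⟩
      rw [norm_pos_iff]
      intro h
      have hz : x ∈ Z := ⟨hcΩ x hx h, h⟩
      exact hx' (mem_iUnion₂.2 ⟨x, hz, mem_ball_self (hr x hz)⟩))
  obtain ⟨g, hgs, hgf, hgr⟩ := exists_smooth_approx hb.isCompact_closure hf hδ {0}
    (finite_singleton _)
  have hreg : ∀ A, RegOn g A := fun A => ⟨hgs, fun x _ => hgr 0 rfl x⟩
  have hgK : ∀ x ∈ K, ‖g x - f x‖ < ‖f x‖ := fun x hx => (hgf x hx.1).trans_le (hδK x hx)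
  have hfrK : frontier Ω ⊆ K := by
    intro x hx
    refine ⟨frontier_subset_closure hx, fun h => ?_⟩
    obtain ⟨z, hz, hxz⟩ := mem_iUnion₂.1 h
    rw [hΩ.frontier_eq] at hx
    exact hx.2 (hrs z hz (ball_subset_closedBall hxz)).2
  have hball : ∀ z ∈ Z, par g (ball z (r z)) = 1 := by
    intro z hz
    refine IsDeg.unique isOpen_ball isBounded_ball ⟨g, hreg _, fun x hx => hgK x ?_, rfl⟩
      (hdeg z hz)
    have hxs : x ∈ sphere z (r z) := frontier_ball_subset_sphere hx
    refine ⟨subset_closure (hrs z hz (sphere_subset_closedBall hxs)).2, fun h => ?_⟩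
    obtain ⟨w, hw, hxw⟩ := mem_iUnion₂.1 h
    by_cases hzw : z = w
    · subst hzw
      rw [mem_ball, mem_sphere.1 hxs] at hxw
      exact lt_irrefl _ hxw
    · exact Set.disjoint_left.1 (hbd z hz w hw hzw) (sphere_subset_closedBall hxs)
        (ball_subset_closedBall hxw)
  refine ⟨g, hreg _, fun x hx => hgK x (hfrK hx), ?_⟩
  have hg0 : ∀ x ∈ K, g x ≠ 0 := by
    intro x hx h
    have := hgK x hx
    rw [h, zero_sub, norm_neg] at this
    exact lt_irrefl _ this
  rw [par_eq_sum ((hreg Ω).finite hb fun x hx => hg0 x (hfrK hx)) hZfin.toFinset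
    (fun z => ball z (r z))]
  · rw [Finset.sum_congr rfl fun z hz => hball z (hZfin.mem_toFinset.1 hz)]
    rw [par, ncard_eq_toFinset_card _ hZfin]
    simp
  · exact fun z hz x hx => (hrs z (hZfin.mem_toFinset.1 hz) (ball_subset_closedBall hx)).2
  · exact fun z hz w hw h => (hbd z (hZfin.mem_toFinset.1 hz) w (hZfin.mem_toFinset.1 hw) h).mono
      ball_subset_closedBall ball_subset_closedBall
  · intro x hx h
    by_contra! hcon
    refine hg0 x ⟨subset_closure hx, fun hmem => ?_⟩ h
    obtain ⟨z, hz, hxz⟩ := mem_iUnion₂.1 hmem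
    exact hcon z (hZfin.mem_toFinset.2 hz) hxz

theorem par_eq_of_simple {Ω : Set (Fin n → ℝ)} (hΩ : IsOpen Ω) (hb : Bornology.IsBounded Ω)
    {f f' : (Fin n → ℝ) → Fin n → ℝ} (hf : ContinuousOn f (closure Ω))
    (hf' : ContinuousOn f' (closure Ω)) (hfr : ∀ x ∈ frontier Ω, f x ≠ 0)
    (heq : ∀ x ∈ frontier Ω, f x = f' x) (hs : Simple f Ω) (hs' : Simple f' Ω) :
    par f Ω = par f' Ω :=
  ((isDeg_of_simple hΩ hb hf hfr hs).congr heq).unique hΩ hb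
    (isDeg_of_simple hΩ hb hf' (fun x hx => heq x hx ▸ hfr x hx) hs')

section Gluing

variable {W : Type*}

theorem exists_level {F : Set W} (hF : F.Finite) (ρ : W → ℝ) {a b : ℝ} (hab : a < b) :
    ∃ s ∈ Ioo a b, ∀ x ∈ F, ρ x ≠ s := by
  obtain ⟨s, hs, hs'⟩ := (Ioo_infinite hab).exists_notMem_finite (hF.image ρ)
  exact ⟨s, hs, fun x hx h => hs' ⟨x, hx, h⟩⟩

theorem par_split {Y : Type*} [Zero Y] {f : W → Y} (hfin : {x | f x = 0}.Finite) (O : Set W) :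
    par f univ = par f O + par f Oᶜ := by
  have hfin' : {x | x ∈ univ ∧ f x = 0}.Finite := by simpa using hfin
  rw [par_eq_sum hfin' Finset.univ (fun b : Bool => if b then O else Oᶜ)
    (fun _ _ => subset_univ _)]
  · simp
  · rintro (_ | _) _ (_ | _) _ h <;> simp_all [disjoint_compl_left, disjoint_compl_right]
  · intro x _ _
    by_cases hx : x ∈ O
    · exact ⟨true, Finset.mem_univ _, by simpa using hx⟩
    · exact ⟨false, Finset.mem_univ _, by simpa using hx⟩

theorem par_congr {Y : Type*} [Zero Y] {f g : W → Y} {O : Set W} (h : ∀ x ∈ O, f x = g x) :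
    par f O = par g O := by
  unfold par
  congr 2
  ext x
  exact and_congr_right fun hx => by rw [h x hx]

variable [TopologicalSpace W]

theorem Simple.congr {Y : Type*} [Zero Y] {f g : W → Y} {x : W}
    (h : ∃ U ∈ 𝓝 x, InjOn f U) (hfg : f =ᶠ[𝓝 x] g) : ∃ U ∈ 𝓝 x, InjOn g U := by
  obtain ⟨U, hU, hinj⟩ := h
  refine ⟨U ∩ {y | f y = g y}, inter_mem hU hfg, fun a ha b hb hab => hinj ha.1 hb.1 ?_⟩
  rw [show f a = g a from ha.2, show f b = g b from hb.2, hab]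

theorem Simple.finite {Y : Type*} [Zero Y] {f : W → Y} (hf : Simple f univ)
    (hc : IsCompact {x | f x = 0}) : {x | f x = 0}.Finite :=
  finite_zeros_of_injOn hc (fun _ h => h) fun x hx => hf x (mem_univ x) hx

/-- The piecewise linear retraction of the line to `[0, 1]`. -/
noncomputable def clamp (t : ℝ) : ℝ := max 0 (min 1 t)

theorem continuous_clamp : Continuous clamp := by unfold clamp; fun_prop

theorem clamp_mem (t : ℝ) : clamp t ∈ Icc (0 : ℝ) 1 := ⟨le_max_left _ _, by simp [clamp]⟩

theorem clamp_of_nonpos {t : ℝ} (h : t ≤ 0) : clamp t = 0 := by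
  simp [clamp, min_eq_right (h.trans zero_le_one), h]

theorem clamp_of_one_le {t : ℝ} (h : 1 ≤ t) : clamp t = 1 := by simp [clamp, h]

theorem exists_perturb_chart [T2Space W] (e : OpenPartialHomeomorph W (Fin n → ℝ)) {χ : W → ℝ}
    (hχ : Continuous χ) (hχI : ∀ x, χ x ∈ Icc (0 : ℝ) 1) (hχc : HasCompactSupport χ)
    (hχs : tsupport χ ⊆ e.source) {f : W → Fin n → ℝ} (hf : Continuous f) {K : Set W}
    (hK : IsCompact K) (hfK : ∀ x ∈ K, f x ≠ 0) {δ : ℝ} (hδ : 0 < δ) :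
    ∃ f₁ : W → Fin n → ℝ, Continuous f₁ ∧ (∀ x, ‖f₁ x - f x‖ < δ) ∧
      (∀ x, χ x = 0 → f₁ x = f x) ∧ (∀ x ∈ K, f₁ x ≠ 0) ∧
      ∀ x, (∀ᶠ y in 𝓝 x, χ y = 1) → f₁ x = 0 → ∃ U ∈ 𝓝 x, InjOn f₁ U := by
  obtain ⟨μ, hμ, hμK⟩ := hK.exists_forall_le' (a := 0) (f := fun x => ‖f x‖)
    hf.norm.continuousOn (fun x hx => norm_pos_iff.2 (hfK x hx))
  have hC : IsCompact (tsupport χ) := hχc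
  obtain ⟨g, hgs, hgf, hgr⟩ := exists_smooth_approx
    (hC.image_of_continuousOn (e.continuousOn.mono hχs)) (f := f ∘ e.symm) (by
      refine hf.comp_continuousOn (e.continuousOn_symm.mono ?_)
      rintro _ ⟨x, hx, rfl⟩
      exact e.map_source (hχs hx)) (lt_min hδ hμ) {0} (finite_singleton _)
  have hgf : ∀ x ∈ tsupport χ, ‖g (e x) - f x‖ < min δ μ := by
    intro x hx
    simpa [e.left_inv (hχs hx)] using hgf (e x) ⟨x, hx, rfl⟩
  have hdist : ∀ x, ‖χ x • (g (e x) - f x)‖ < min δ μ := by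
    intro x
    by_cases hx : χ x = 0
    · simpa [hx] using ⟨hδ, hμ⟩
    · rw [norm_smul, Real.norm_of_nonneg (hχI x).1]
      exact (mul_le_of_le_one_left (norm_nonneg _) (hχI x).2).trans_lt
        (hgf x (subset_tsupport _ hx))
  refine ⟨fun x => f x + χ x • (g (e x) - f x), ?_, ?_, ?_, ?_, ?_⟩
  · rw [continuous_iff_continuousAt]
    intro x
    by_cases hx : x ∈ tsupport χ
    · have he : ContinuousAt e x := e.continuousAt (hχs hx)
      exact hf.continuousAt.add (hχ.continuousAt.smul
        ((hgs.continuous.continuousAt.comp he).sub hf.continuousAt))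
    · refine hf.continuousAt.congr ?_
      filter_upwards [notMem_tsupport_iff_eventuallyEq.1 hx] with y hy
      simp [hy]
  · intro x
    rw [add_sub_cancel_left]
    exact (hdist x).trans_le (min_le_left _ _)
  · intro x hx
    simp [hx]
  · intro x hx h
    have h1 := (hdist x).trans_le (min_le_right _ _)
    rw [← norm_neg, ← eq_neg_of_add_eq_zero_left h] at h1
    exact absurd (hμK x hx) h1.not_ge
  · intro x hx h0
    have hxs : x ∈ e.source := hχs (subset_tsupport _ (by simp [hx.self_of_nhds]))
    have h0' : g (e x) = 0 := by simpa [hx.self_of_nhds] using h0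
    obtain ⟨V, hV, hinj⟩ := RegOn.exists_injOn (Ω := univ)
      ⟨hgs, fun y _ => hgr 0 rfl y⟩ (mem_univ (e x)) h0'
    refine Simple.congr (f := g ∘ e) ⟨e.source ∩ e ⁻¹' V, inter_mem (e.open_source.mem_nhds hxs)
      (e.continuousAt hxs hV), ?_⟩ ?_
    · exact hinj.comp (e.injOn.mono inter_subset_left) fun y hy => hy.2
    · filter_upwards [hx] with y hy
      simp [hy]

theorem exists_bump [T2Space W] [LocallyCompactSpace W] {C A : Set W} (hC : IsCompact C)
    (hA : IsOpen A) (hCA : C ⊆ A) :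
    ∃ ρ : W → ℝ, Continuous ρ ∧ (∀ x, ρ x ∈ Icc (0 : ℝ) 1) ∧ HasCompactSupport ρ ∧
      tsupport ρ ⊆ A ∧ ∀ x ∈ C, ρ x = 1 := by
  obtain ⟨L, hL, hCL, hLA⟩ := exists_compact_between hC hA hCA
  obtain ⟨ρ, h1, h0, hs, hI⟩ := exists_continuous_one_zero_of_isCompact hC
    (isOpen_interior (s := L)).isClosed_compl (disjoint_compl_right_iff_subset.2 hCL)
  refine ⟨ρ, ρ.continuous, hI, hs, ?_, fun x hx => h1 hx⟩
  refine (closure_minimal (fun x hx => ?_) hL.isClosed).trans hLA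
  by_contra hxL
  exact hx (h0 fun hi => hxL (interior_subset hi))

theorem isCompact_superlevel {ρ : W → ℝ} (hρ : Continuous ρ) (hc : HasCompactSupport ρ)
    {s : ℝ} (hs : 0 < s) : IsCompact {x | s ≤ ρ x} :=
  hc.isCompact.of_isClosed_subset (isClosed_le continuous_const hρ) fun _ hx =>
    subset_tsupport _ (hs.trans_le hx).ne'

theorem superlevel_subset {ρ : W → ℝ} {A : Set W} (h : tsupport ρ ⊆ A) {s : ℝ} (hs : 0 < s) :
    {x | s ≤ ρ x} ⊆ A := fun _ hx => h (subset_tsupport _ (hs.trans_le hx).ne')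

theorem par_eq_chart [T2Space W] (e : OpenPartialHomeomorph W (Fin n → ℝ)) {O : Set W}
    (hO : IsOpen O) (hOc : IsCompact (closure O)) (hOe : closure O ⊆ e.source)
    {f f' : W → Fin n → ℝ} (hf : Continuous f) (hf' : Continuous f') (hs : Simple f O)
    (hs' : Simple f' O) (hfr : ∀ x ∈ closure O, x ∉ O → f x ≠ 0)
    (heq : ∀ x ∉ O, f x = f' x) : par f O = par f' O := by
  have hOe' : O ⊆ e.source := subset_closure.trans hOe
  have hΩ : IsOpen (e '' O) := e.isOpen_image_of_subset_source hO hOe'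
  have hΩc : IsCompact (e '' closure O) := hOc.image_of_continuousOn (e.continuousOn.mono hOe)
  have hcl : closure (e '' O) ⊆ e '' closure O :=
    closure_minimal (image_mono subset_closure) hΩc.isClosed
  have hfrΩ : ∀ y ∈ frontier (e '' O), ∃ x ∈ closure O, x ∉ O ∧ e x = y := by
    intro y hy
    rw [hΩ.frontier_eq] at hy
    obtain ⟨x, hx, rfl⟩ := hcl hy.1
    exact ⟨x, hx, fun h => hy.2 ⟨x, h, rfl⟩, rfl⟩
  have hsymm : ContinuousOn e.symm (closure (e '' O)) := by
    refine e.continuousOn_symm.mono fun y hy => ?_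
    obtain ⟨x, hx, rfl⟩ := hcl hy
    exact e.map_source (hOe hx)
  have hpar : ∀ f : W → Fin n → ℝ, par f O = par (f ∘ e.symm) (e '' O) := by
    intro f
    unfold par
    rw [← (e.injOn.mono (fun x hx => hOe' hx.1 : {x | x ∈ O ∧ f x = 0} ⊆ e.source)).ncard_image]
    congr 2
    ext y
    constructor
    · rintro ⟨x, ⟨hx, h⟩, rfl⟩
      exact ⟨⟨x, hx, rfl⟩, by simp [e.left_inv (hOe' hx), h]⟩
    · rintro ⟨⟨x, hx, rfl⟩, h⟩
      exact ⟨x, ⟨hx, by simpa [e.left_inv (hOe' hx)] using h⟩, rfl⟩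
  have hsimp : ∀ f : W → Fin n → ℝ, Simple f O → Simple (f ∘ e.symm) (e '' O) := by
    rintro f hs _ ⟨x, hx, rfl⟩ h
    obtain ⟨U, hU, hinj⟩ := hs x hx (by simpa [e.left_inv (hOe' hx)] using h)
    have hex := e.map_source (hOe' hx)
    refine ⟨e.target ∩ e.symm ⁻¹' U, inter_mem (e.open_target.mem_nhds hex)
      (e.symm.continuousAt hex ?_),
      hinj.comp (e.symm.injOn.mono inter_subset_left) fun y hy => hy.2⟩
    rwa [e.left_inv (hOe' hx)]
  rw [hpar f, hpar f']
  refine par_eq_of_simple hΩ (hΩc.isBounded.subset (image_mono subset_closure))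
    (hf.comp_continuousOn hsymm) (hf'.comp_continuousOn hsymm) (fun y hy => ?_) (fun y hy => ?_)
    (hsimp f hs) (hsimp f' hs')
  · obtain ⟨x, hx, hxO, rfl⟩ := hfrΩ y hy
    simpa [e.left_inv (hOe hx)] using hfr x hx hxO
  · obtain ⟨x, hx, hxO, rfl⟩ := hfrΩ y hy
    simpa [e.left_inv (hOe hx)] using heq x hxO

/-- Parities of numbers of zeros do not change under modifications inside compact subsets of `A`. -/
def ParInv (n : ℕ) (A : Set W) : Prop :=
  ∀ f f' : W → Fin n → ℝ, Continuous f → Continuous f' → Simple f univ → Simple f' univ →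
    IsCompact {x | f x = 0} → IsCompact {x | f' x = 0} →
    ∀ C : Set W, IsCompact C → C ⊆ A → (∀ x ∉ C, f x = f' x) → par f univ = par f' univ

theorem exists_finset_charts
    (hch : ∀ p : W, ∃ e : OpenPartialHomeomorph W (Fin n → ℝ), p ∈ e.source)
    {C : Set W} (hC : IsCompact C) :
    ∃ s : Finset (OpenPartialHomeomorph W (Fin n → ℝ)), C ⊆ ⋃ e ∈ s, e.source :=
  hC.elim_finite_subcover _ (fun e => e.open_source) fun p _ => mem_iUnion.2 (hch p)

variable [T2Space W] [LocallyCompactSpace W]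

theorem parInv_chart (e : OpenPartialHomeomorph W (Fin n → ℝ)) : ParInv n e.source := by
  intro f f' hf hf' hs hs' hc hc' C hC hCe heq
  obtain ⟨ρ, hρ, hρI, hρc, hρs, hρ1⟩ := exists_bump hC e.open_source hCe
  obtain ⟨s, hs01, hsF⟩ := exists_level (hs.finite hc) ρ zero_lt_one
  have hcl : closure {x | s < ρ x} ⊆ {x | s ≤ ρ x} :=
    closure_minimal (fun x (hx : s < ρ x) => hx.le) (isClosed_le continuous_const hρ)
  have hCO : C ⊆ {x | s < ρ x} := fun x hx => by
    change s < ρ x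
    rw [hρ1 x hx]; exact hs01.2
  rw [par_split (hs.finite hc) {x | s < ρ x}, par_split (hs'.finite hc') {x | s < ρ x}]
  congr 1
  · refine par_eq_chart e (isOpen_lt continuous_const hρ)
      ((isCompact_superlevel hρ hρc hs01.1).of_isClosed_subset isClosed_closure hcl)
      (hcl.trans (superlevel_subset hρs hs01.1)) hf hf' (fun x _ => hs x (mem_univ x))
      (fun x _ => hs' x (mem_univ x)) (fun x hx hx' h => ?_) (fun x hx => heq x fun h => hx (hCO h))
    exact hsF x h (le_antisymm (not_lt.1 hx') (hcl hx))
  · exact par_congr fun x hx => heq x fun h => hx (hCO h)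

theorem ParInv.union_chart (e : OpenPartialHomeomorph W (Fin n → ℝ)) {A : Set W} (hA : IsOpen A)
    (h : ParInv n A) : ParInv n (e.source ∪ A) := by
  intro f f' hf hf' hs hs' hc hc' C hC hCA heq
  obtain ⟨C₁, C₂, hC₁, hC₂, hC₁e, hC₂A, rfl⟩ := hC.binary_compact_cover e.open_source hA hCA
  obtain ⟨ρ, hρ, hρI, hρc, hρs, hρ1⟩ := exists_bump hC₁ e.open_source hC₁e
  obtain ⟨τ, hτ, hτI, hτc, hτs, hτ1⟩ := exists_bump hC₂ hA hC₂A
  have hF := (hs.finite hc).union (hs'.finite hc')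
  obtain ⟨s, hs01, hsF⟩ := exists_level hF τ zero_lt_one
  obtain ⟨a, ha01, haF⟩ := exists_level hF ρ zero_lt_one
  obtain ⟨b, hb01, hbF⟩ := exists_level hF ρ ha01.2
  have hab : a < b := hb01.1
  set σ : W → ℝ := fun x => clamp ((ρ x - a) / (b - a)) with hσ
  have hσc : Continuous σ := continuous_clamp.comp (by fun_prop)
  have hσ0 : ∀ x, ρ x ≤ a → σ x = 0 := fun x hx =>
    clamp_of_nonpos (div_nonpos_of_nonpos_of_nonneg (by linarith) (by linarith))
  have hσ1 : ∀ x, b ≤ ρ x → σ x = 1 := fun x hx =>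
    clamp_of_one_le ((one_le_div (by linarith)).2 (by linarith))
  set g : W → Fin n → ℝ := fun x => f x + σ x • (f' x - f x) with hg
  have hgc : Continuous g := by fun_prop
  have hg0 : ∀ x, ρ x ≤ a → g x = f x := fun x hx => by simp [hg, hσ0 x hx]
  have hg1 : ∀ x, b ≤ ρ x → g x = f' x := fun x hx => by simp [hg, hσ1 x hx]
  have hge : ∀ x, f x = f' x → g x = f x := fun x hx => by simp [hg, hx]
  have hout : ∀ x, ρ x < b → τ x ≤ s → f x = f' x := by
    intro x h1 h2
    refine heq x ?_
    rintro (hx | hx)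
    · rw [hρ1 x hx] at h1; linarith [hb01.2]
    · rw [hτ1 x hx] at h2; linarith [hs01.2]
  set T : Set W := {x | a < ρ x} ∩ {x | ρ x < b} ∩ {x | s < τ x} with hT
  have hTo : IsOpen T := ((isOpen_lt continuous_const hρ).inter
    (isOpen_lt hρ continuous_const)).inter (isOpen_lt continuous_const hτ)
  have hTcl : closure T ⊆ {x | a ≤ ρ x} ∩ {x | ρ x ≤ b} ∩ {x | s ≤ τ x} :=
    closure_minimal (fun x hx => ⟨⟨le_of_lt (b := ρ x) hx.1.1, le_of_lt (a := ρ x) hx.1.2⟩,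
      le_of_lt (b := τ x) hx.2⟩)
      (((isClosed_le continuous_const hρ).inter
        (isClosed_le hρ continuous_const)).inter (isClosed_le continuous_const hτ))
  have hTe : closure T ⊆ e.source := fun x hx =>
    superlevel_subset hρs ha01.1 (hTcl hx).1.1
  have hTc : IsCompact (closure T) :=
    (isCompact_superlevel hρ hρc ha01.1).of_isClosed_subset isClosed_closure
      fun x hx => (hTcl hx).1.1
  have hfrT : ∀ x ∈ closure T, x ∉ T → g x ≠ 0 := by
    intro x hx hxT h
    obtain ⟨⟨h1, h2⟩, h3⟩ := hTcl hx
    have h1 : a ≤ ρ x := h1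
    have h2 : ρ x ≤ b := h2
    have h3 : s ≤ τ x := h3
    rcases h1.eq_or_lt with h1 | h1
    · rw [hg0 x h1.ge] at h
      exact haF x (Or.inl h) h1.symm
    rcases h2.eq_or_lt with h2 | h2
    · rw [hg1 x h2.ge] at h
      exact hbF x (Or.inr h) h2
    rcases h3.eq_or_lt with h3 | h3
    · rw [hge x (hout x h2 h3.ge)] at h
      exact hsF x (Or.inl h) h3.symm
    · exact hxT ⟨⟨h1, h2⟩, h3⟩
  have hgT : ∀ x, x ∉ closure T → g x = 0 → ∃ U ∈ 𝓝 x, InjOn g U := by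
    intro x hx h
    have hxT : x ∉ T := fun h => hx (subset_closure h)
    rcases lt_trichotomy (ρ x) a with h1 | h1 | h1
    · refine Simple.congr (hs x (mem_univ x) (hg0 x h1.le ▸ h)) ?_
      filter_upwards [(isOpen_lt hρ continuous_const).mem_nhds h1] with y hy
      exact (hg0 y (le_of_lt hy)).symm
    · exact absurd h1 (haF x (Or.inl ((hg0 x h1.le).symm.trans h)))
    rcases lt_trichotomy (ρ x) b with h2 | h2 | h2
    · have h3 : τ x ≤ s := by
        by_contra! h3
        exact hxT ⟨⟨h1, h2⟩, h3⟩
      have hfx : f x = 0 := hge x (hout x h2 h3) ▸ h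
      have h3 := h3.lt_of_ne (hsF x (Or.inl hfx))
      refine Simple.congr (hs x (mem_univ x) hfx) ?_
      filter_upwards [(isOpen_lt hρ continuous_const).mem_nhds h2,
        (isOpen_lt hτ continuous_const).mem_nhds h3] with y hy hy'
      exact (hge y (hout y hy (le_of_lt hy'))).symm
    · exact absurd h2 (hbF x (Or.inr ((hg1 x h2.ge).symm.trans h)))
    · refine Simple.congr (hs' x (mem_univ x) (hg1 x h2.le ▸ h)) ?_
      filter_upwards [(isOpen_lt continuous_const hρ).mem_nhds h2] with y hy
      exact (hg1 y (le_of_lt hy)).symm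
  set Zt : Set W := closure T ∩ {x | g x = 0} with hZt
  have hZtc : IsCompact Zt := hTc.inter_right (isClosed_eq hgc continuous_const)
  have hZtT : Zt ⊆ T := fun x hx => by
    by_contra hxT
    exact hfrT x hx.1 hxT hx.2
  obtain ⟨L, hL, hZL, hLT⟩ := exists_compact_between hZtc hTo hZtT
  obtain ⟨χ, hχ, hχI, hχc, hχs, hχ1⟩ := exists_bump hL hTo hLT
  obtain ⟨g', hg'c, -, hg'g, hg'K, hg's⟩ := exists_perturb_chart e hχ hχI hχc
    ((hχs.trans subset_closure).trans hTe) hgc (hTc.diff (isOpen_interior (s := L)))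
    (fun x hx h => hx.2 (hZL ⟨hx.1, h⟩)) one_pos
  have hg'T : ∀ x, x ∉ T → g' x = g x := fun x hx =>
    hg'g x (image_eq_zero_of_notMem_tsupport fun h => hx (hχs h))
  have hg'cl : ∀ x, x ∉ closure T → g' =ᶠ[𝓝 x] g := fun x hx => by
    filter_upwards [isClosed_closure.isOpen_compl.mem_nhds hx] with y hy
    exact hg'T y fun h => hy (subset_closure h)
  have hg'S : Simple g' univ := by
    intro x _ h
    by_cases hx : x ∈ closure T
    · by_cases hxL : x ∈ interior L
      · refine hg's x ?_ h
        filter_upwards [isOpen_interior.mem_nhds hxL] with y hy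
        exact hχ1 y (interior_subset hy)
      · exact absurd h (hg'K x ⟨hx, hxL⟩)
    · exact Simple.congr (hgT x hx ((hg'cl x hx).eq_of_nhds ▸ h)) (hg'cl x hx).symm
  have hg'Z : IsCompact {x | g' x = 0} := by
    refine ((hc.union hc').union hTc).of_isClosed_subset (isClosed_eq hg'c continuous_const)
      fun x hx => ?_
    by_cases hxT : x ∈ closure T
    · exact Or.inr hxT
    left
    have hxT' : x ∉ T := fun h => hxT (subset_closure h)
    have hx : g x = 0 := hg'T x hxT' ▸ hx
    rcases le_or_gt (ρ x) a with h1 | h1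
    · exact Or.inl ((hg0 x h1).symm.trans hx)
    rcases lt_or_ge (ρ x) b with h2 | h2
    · have h3 : τ x ≤ s := by
        by_contra! h3
        exact hxT' ⟨⟨h1, h2⟩, h3⟩
      exact Or.inl ((hge x (hout x h2 h3)).symm.trans hx)
    · exact Or.inr ((hg1 x h2).symm.trans hx)
  trans par g' univ
  · refine parInv_chart e f g' hf hg'c hs hg'S hc hg'Z {x | a ≤ ρ x}
      (isCompact_superlevel hρ hρc ha01.1) (superlevel_subset hρs ha01.1) fun x hx => ?_
    have hx : ρ x < a := not_le.1 hx
    rw [hg'T x fun h => absurd h.1.1 hx.not_gt, hg0 x hx.le]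
  · refine h g' f' hg'c hf' hg'S hs' hg'Z hc' {x | s ≤ τ x}
      (isCompact_superlevel hτ hτc hs01.1) (superlevel_subset hτs hs01.1) fun x hx => ?_
    have hx : τ x < s := not_le.1 hx
    rw [hg'T x fun h => absurd h.2 hx.not_gt]
    rcases lt_or_ge (ρ x) b with h2 | h2
    · rw [hge x (hout x h2 hx.le), hout x h2 hx.le]
    · exact hg1 x h2

theorem parInv_univ (hch : ∀ p : W, ∃ e : OpenPartialHomeomorph W (Fin n → ℝ), p ∈ e.source) :
    ParInv n (univ : Set W) := by
  classical
  intro f f' hf hf' hs hs' hc hc' C hC _ heq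
  obtain ⟨t, ht⟩ := exists_finset_charts hch hC
  have : ∀ t : Finset (OpenPartialHomeomorph W (Fin n → ℝ)), ParInv n (⋃ e ∈ t, e.source) := by
    intro t
    induction t using Finset.induction_on with
    | empty =>
      intro f f' _ _ _ _ _ _ C _ hCe heq
      simp only [Finset.notMem_empty, iUnion_of_empty, iUnion_empty, subset_empty_iff] at hCe
      subst hCe
      exact par_congr fun x _ => heq x (by simp)
    | insert e t _ ih =>
      rw [Finset.set_biUnion_insert]
      exact ih.union_chart e (isOpen_biUnion fun e _ => e.open_source)
  exact this t f f' hf hf' hs hs' hc hc' C hC ht heq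

theorem exists_simple_approx_aux (t : Finset (OpenPartialHomeomorph W (Fin n → ℝ))) :
    ∀ (f : W → Fin n → ℝ), Continuous f → IsCompact {x | f x = 0} → ∀ ε > (0 : ℝ),
      (∀ x, f x = 0 → x ∉ ⋃ e ∈ t, e.source → ∃ U ∈ 𝓝 x, InjOn f U) →
      ∃ f' : W → Fin n → ℝ, Continuous f' ∧ (∀ x, ‖f' x - f x‖ < ε) ∧
        (∃ C, IsCompact C ∧ ∀ x ∉ C, f' x = f x) ∧ Simple f' univ := by
  classical
  induction t using Finset.induction_on with
  | empty =>
    intro f hf _ ε hε hs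
    exact ⟨f, hf, fun x => by simpa using hε, ⟨∅, isCompact_empty, fun _ _ => rfl⟩,
      fun x _ hx => hs x hx (by simp)⟩
  | insert e t _ ih =>
    intro f hf hZ ε hε hs
    set G := ⋃ e ∈ t, e.source with hG
    rw [Finset.set_biUnion_insert] at hs
    have hGo : IsOpen G := isOpen_biUnion fun e _ => e.open_source
    set S : Set W := {x | ∃ U ∈ 𝓝 x, InjOn f U} with hS
    have hSo : IsOpen S := by
      rw [isOpen_iff_mem_nhds]
      rintro x ⟨U, hU, hinj⟩
      filter_upwards [eventually_mem_nhds_iff.2 hU] with y hy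
      exact ⟨U, hy, hinj⟩
    set Z := {x | f x = 0} with hZdef
    have hB : IsCompact ((Z \ S) \ G) := (hZ.diff hSo).diff hGo
    obtain ⟨ρ, hρ, hρI, hρc, hρs, hρ1⟩ := exists_bump hB e.open_source (by
      rintro x ⟨⟨hxZ, hxS⟩, hxG⟩
      by_contra hxe
      exact hxS (hs x hxZ (by rintro (h | h); exacts [hxe h, hxG h])))
    have hFfin : ((Z \ G) ∩ {x | ρ x ≤ 1 / 2}).Finite := by
      refine finite_zeros_of_injOn (f := f) (q := 0) ((hZ.diff hGo).inter_right
        (isClosed_le hρ continuous_const)) (fun x hx => hx.1.1) fun x hx => ?_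
      by_contra hxS
      have h1 := hρ1 x ⟨⟨hx.1.1, hxS⟩, hx.1.2⟩
      have h2 : ρ x ≤ 1 / 2 := hx.2
      linarith
    obtain ⟨a, ha, haF⟩ := exists_level hFfin ρ (a := 0) (b := 1 / 2) (by norm_num)
    obtain ⟨b, hab, hb2, hbF⟩ : ∃ b, a < b ∧ b ≤ 1 / 2 ∧
        ∀ x ∈ (Z \ G) ∩ {x | ρ x ≤ 1 / 2}, ρ x ∉ Icc a b := by
      have h1 : (ρ '' ((Z \ G) ∩ {x | ρ x ≤ 1 / 2}))ᶜ ∈ 𝓝 a :=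
        (hFfin.image ρ).isClosed.isOpen_compl.mem_nhds fun ⟨x, hx, h⟩ => haF x hx h
      obtain ⟨b, hb, hbs⟩ := (mem_nhdsGE_iff_exists_Icc_subset).1
        (mem_nhdsWithin_of_mem_nhds h1)
      exact ⟨min b (1 / 2), lt_min hb ha.2, min_le_right _ _,
        fun x hx h => hbs ⟨h.1, h.2.trans (min_le_left _ _)⟩ ⟨x, hx, rfl⟩⟩
    set χ : W → ℝ := fun x => clamp ((ρ x - a) / (b - a)) with hχ
    have hχc : Continuous χ := continuous_clamp.comp (by fun_prop)
    have hχ0 : ∀ x, ρ x ≤ a → χ x = 0 := fun x hx =>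
      clamp_of_nonpos (div_nonpos_of_nonpos_of_nonneg (by linarith) (by linarith))
    have hχ1 : ∀ x, b ≤ ρ x → χ x = 1 := fun x hx =>
      clamp_of_one_le ((one_le_div (by linarith)).2 (by linarith))
    have hχs : tsupport χ ⊆ {x | a ≤ ρ x} := closure_minimal (fun x hx => by
      by_contra hxa
      exact hx (hχ0 x (le_of_lt (not_le.1 hxa)))) (isClosed_le continuous_const hρ)
    have hlc := isCompact_superlevel hρ hρc ha.1
    have hK : IsCompact (({x | a ≤ ρ x} ∩ {x | ρ x ≤ b}) \ G) :=
      (hlc.inter_right (isClosed_le hρ continuous_const)).diff hGo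
    obtain ⟨f₁, hf₁, hd₁, he₁, hK₁, hs₁⟩ := exists_perturb_chart e hχc (fun x => clamp_mem _)
      (hlc.of_isClosed_subset (isClosed_tsupport _) hχs)
      (hχs.trans (superlevel_subset hρs ha.1)) hf hK (fun x hx h => by
        have h2 : ρ x ≤ b := hx.1.2
        exact hbF x ⟨⟨h, hx.2⟩, h2.trans hb2⟩ hx.1) (half_pos hε)
    have hout : ∀ x ∉ {x | a ≤ ρ x}, f₁ x = f x := fun x hx =>
      he₁ x (hχ0 x (le_of_lt (not_le.1 hx)))
    have hZ₁ : IsCompact {x | f₁ x = 0} := by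
      refine (hZ.union hlc).of_isClosed_subset (isClosed_eq hf₁ continuous_const) fun x hx => ?_
      by_cases h : x ∈ {x | a ≤ ρ x}
      · exact Or.inr h
      · exact Or.inl ((hout x h).symm.trans hx)
    obtain ⟨f', hf', hd, ⟨C, hC, hCeq⟩, hs'⟩ := ih f₁ hf₁ hZ₁ (ε / 2) (half_pos hε) (by
      intro x hx hxG
      rcases lt_or_ge (ρ x) a with h1 | h1
      · have hfx : f x = 0 := hout x (not_le.2 h1) ▸ hx
        refine Simple.congr (f := f) ?_ ?_
        · by_contra hxS
          have := hρ1 x ⟨⟨hfx, hxS⟩, hxG⟩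
          linarith [ha.2]
        · filter_upwards [(isOpen_lt hρ continuous_const).mem_nhds h1] with y hy
          exact (hout y (not_le.2 hy)).symm
      rcases le_or_gt (ρ x) b with h2 | h2
      · exact absurd hx (hK₁ x ⟨⟨h1, h2⟩, hxG⟩)
      · refine hs₁ x ?_ hx
        filter_upwards [(isOpen_lt continuous_const hρ).mem_nhds h2] with y hy
        exact hχ1 y (le_of_lt hy))
    refine ⟨f', hf', fun x => ?_, ⟨C ∪ {x | a ≤ ρ x}, hC.union hlc, fun x hx => ?_⟩, hs'⟩
    · linarith [norm_sub_le_norm_sub_add_norm_sub (f' x) (f₁ x) (f x), hd x, hd₁ x]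
    · rw [hCeq x fun h => hx (Or.inl h), hout x fun h => hx (Or.inr h)]

theorem exists_simple_approx
    (hch : ∀ p : W, ∃ e : OpenPartialHomeomorph W (Fin n → ℝ), p ∈ e.source)
    {f : W → Fin n → ℝ} (hf : Continuous f) (hZ : IsCompact {x | f x = 0}) {ε : ℝ} (hε : 0 < ε) :
    ∃ f' : W → Fin n → ℝ, Continuous f' ∧ (∀ x, ‖f' x - f x‖ < ε) ∧
      (∃ C, IsCompact C ∧ ∀ x ∉ C, f' x = f x) ∧ Simple f' univ := by
  obtain ⟨t, ht⟩ := exists_finset_charts hch hZ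
  exact exists_simple_approx_aux t f hf hZ ε hε fun x hx hxt => absurd (ht hx) hxt

theorem par_sub_eq_par_sub
    (hch : ∀ p : W, ∃ e : OpenPartialHomeomorph W (Fin n → ℝ), p ∈ e.source)
    {f : W → Fin n → ℝ} {R : ℝ} (hR : IsCompact {x | ‖f x‖ ≤ R})
    {f₁ f₂ : W → Fin n → ℝ} (hf₁ : Continuous f₁) (hf₂ : Continuous f₂) {C : Set W}
    (hC : IsCompact C) (h₁ : ∀ x ∉ C, f₁ x = f x) (h₂ : ∀ x ∉ C, f₂ x = f x)
    {v₁ v₂ : Fin n → ℝ} (hv₁ : ‖v₁‖ < R) (hv₂ : ‖v₂‖ < R)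
    (hs₁ : Simple (fun x => f₁ x - v₁) univ) (hs₂ : Simple (fun x => f₂ x - v₂) univ) :
    par (fun x => f₁ x - v₁) univ = par (fun x => f₂ x - v₂) univ := by
  obtain ⟨b, hb, hbR⟩ := exists_between (max_lt hv₁ hv₂)
  have hb₁ : ‖v₁‖ < b := (le_max_left _ _).trans_lt hb
  have hb₂ : ‖v₂‖ < b := (le_max_right _ _).trans_lt hb
  set χ : (Fin n → ℝ) → ℝ := fun y => clamp ((R - ‖y‖) / (R - b)) with hχ
  have hχc : Continuous χ := continuous_clamp.comp (by fun_prop)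
  have hχ1 : ∀ y, ‖y‖ ≤ b → χ y = 1 := fun y hy =>
    clamp_of_one_le ((one_le_div (by linarith)).2 (by linarith))
  have hχ0 : ∀ y, R ≤ ‖y‖ → χ y = 0 := fun y hy =>
    clamp_of_nonpos (div_nonpos_of_nonpos_of_nonneg (by linarith) (by linarith))
  have key : ∀ (g : W → Fin n → ℝ) (v : Fin n → ℝ), Continuous g → (∀ x ∉ C, g x = f x) →
      ‖v‖ < b → Simple (fun x => g x - v) univ →
      Continuous (fun x => g x - χ (g x) • v) ∧ Simple (fun x => g x - χ (g x) • v) univ ∧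
      IsCompact {x | g x - χ (g x) • v = 0} ∧
      par (fun x => g x - χ (g x) • v) univ = par (fun x => g x - v) univ := by
    intro g v hg hgC hv hs
    have hz : ∀ x, g x - χ (g x) • v = 0 → g x = v := by
      intro x hx
      have h1 : g x = χ (g x) • v := sub_eq_zero.1 hx
      have h2 : ‖g x‖ ≤ b := by
        rw [h1, norm_smul, Real.norm_of_nonneg (clamp_mem _).1]
        exact (mul_le_of_le_one_left (norm_nonneg _) (clamp_mem _).2).trans hv.le
      rw [h1, hχ1 _ h2, one_smul]
    have hc : Continuous (fun x => g x - χ (g x) • v) := by fun_prop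
    refine ⟨hc, fun x _ hx => ?_, ?_, ?_⟩
    · have hgx := hz x hx
      refine Simple.congr (hs x (mem_univ x) (sub_eq_zero.2 hgx)) ?_
      filter_upwards [(isOpen_lt hg.norm continuous_const).mem_nhds
        (show ‖g x‖ < b by rw [hgx]; exact hv)] with y hy
      rw [hχ1 _ (le_of_lt hy), one_smul]
    · refine (hC.union hR).of_isClosed_subset (isClosed_eq hc continuous_const) fun x hx => ?_
      by_cases hxC : x ∈ C
      · exact Or.inl hxC
      · right
        change ‖f x‖ ≤ R
        rw [← hgC x hxC, hz x hx]
        exact (hv.trans hbR).le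
    · unfold par
      congr 2
      ext x
      simp only [mem_univ, true_and, mem_ofPred_eq]
      refine ⟨fun h => sub_eq_zero.2 (hz x h), fun h => ?_⟩
      rw [sub_eq_zero.1 h, hχ1 v hv.le, one_smul, sub_self]
  obtain ⟨c₁, s₁, z₁, p₁⟩ := key f₁ v₁ hf₁ h₁ hb₁ hs₁
  obtain ⟨c₂, s₂, z₂, p₂⟩ := key f₂ v₂ hf₂ h₂ hb₂ hs₂
  rw [← p₁, ← p₂]
  refine parInv_univ hch _ _ c₁ c₂ s₁ s₂ z₁ z₂ _ (hC.union hR) (subset_univ _) fun x hx => ?_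
  have hxC : x ∉ C := fun h => hx (Or.inl h)
  have hxR : R ≤ ‖f x‖ := le_of_lt (not_le.1 fun h => hx (Or.inr h))
  rw [h₁ x hxC, h₂ x hxC, hχ0 _ hxR, zero_smul, zero_smul]

end Gluing

section Global

variable {M : Type*} [MetricSpace M]

/-- The map `F` is locally injective at every point of the fibre over `q`. -/
def GoodAt (F : M → M) (q : M) : Prop := ∀ p, F p = q → ∃ U ∈ 𝓝 p, InjOn F U

/-- The part of `M` which `F` maps into the ball of radius `R` about `q₀` in the chart `e`. -/
def chartPreimage (e : OpenPartialHomeomorph M (Fin n → ℝ)) {F : M → M} (hF : Continuous F)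
    (q₀ : M) (R : ℝ) : TopologicalSpace.Opens M :=
  ⟨F ⁻¹' (e.source ∩ e ⁻¹' ball (e q₀) R), (e.isOpen_inter_preimage isOpen_ball).preimage hF⟩

section Chart

variable (e : OpenPartialHomeomorph M (Fin n → ℝ)) {F : M → M} (hF : Continuous F) {q₀ : M} {R : ℝ}

theorem continuous_chart_comp :
    Continuous fun w : chartPreimage e hF q₀ R => e (F w) - e q₀ := by
  refine Continuous.sub ?_ continuous_const
  exact e.continuousOn.comp_continuous (hF.comp continuous_subtype_val) fun w => w.2.1

theorem isCompact_chart_norm_le [CompactSpace M] (hR : closedBall (e q₀) R ⊆ e.target) {R₁ : ℝ}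
    (h : R₁ < R) :
    IsCompact {w : chartPreimage e hF q₀ R | ‖e (F w) - e q₀‖ ≤ R₁} := by
  rw [Subtype.isCompact_iff]
  have hsub : closedBall (e q₀) R₁ ⊆ e.target := (closedBall_subset_closedBall h.le).trans hR
  have hK : IsCompact (e.symm '' closedBall (e q₀) R₁) :=
    (isCompact_closedBall _ _).image_of_continuousOn (e.continuousOn_symm.mono hsub)
  convert (hK.isClosed.preimage hF).isCompact using 1
  ext p
  constructor
  · rintro ⟨w, hw, rfl⟩
    exact ⟨e (F w), by simpa [dist_eq_norm] using hw, e.left_inv w.2.1⟩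
  · rintro ⟨y, hy, hyp⟩
    have h1 : F p ∈ e.source := hyp ▸ e.map_target (hsub hy)
    have h2 : e (F p) = y := by rw [← hyp, e.right_inv (hsub hy)]
    refine ⟨⟨p, h1, ?_⟩, ?_, rfl⟩
    · rw [mem_preimage, h2]
      exact closedBall_subset_ball h hy
    · change ‖e (F p) - e q₀‖ ≤ R₁
      rw [h2, ← dist_eq_norm]
      exact hy

theorem exists_chart_opens
    (hch : ∀ p : M, ∃ e : OpenPartialHomeomorph M (Fin n → ℝ), p ∈ e.source)
    (O : TopologicalSpace.Opens M) (w : O) :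
    ∃ e : OpenPartialHomeomorph O (Fin n → ℝ), w ∈ e.source := by
  obtain ⟨e, he⟩ := hch w
  exact ⟨e.subtypeRestr ⟨w⟩, by simpa [OpenPartialHomeomorph.subtypeRestr_source] using he⟩

end Chart

theorem exists_chart_closedBall
    (hch : ∀ p : M, ∃ e : OpenPartialHomeomorph M (Fin n → ℝ), p ∈ e.source) (q₀ : M) :
    ∃ e : OpenPartialHomeomorph M (Fin n → ℝ), q₀ ∈ e.source ∧
      ∃ R > 0, closedBall (e q₀) R ⊆ e.target := by
  obtain ⟨e, he⟩ := hch q₀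
  obtain ⟨R, hR, h⟩ := Metric.nhds_basis_closedBall.mem_iff.1
    (e.open_target.mem_nhds (e.map_source he))
  exact ⟨e, he, R, hR, h⟩

variable [CompactSpace M]

theorem exists_goodAt_approx
    (hch : ∀ p : M, ∃ e : OpenPartialHomeomorph M (Fin n → ℝ), p ∈ e.source)
    {F : M → M} (hF : Continuous F) (q₀ : M) {ε : ℝ} (hε : 0 < ε) :
    ∃ F' : M → M, Continuous F' ∧ (∀ p, dist (F p) (F' p) < ε) ∧ GoodAt F' q₀ := by
  classical
  obtain ⟨e, he, R₂, hR₂, hRt⟩ := exists_chart_closedBall hch q₀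
  set R := R₂ / 2 with hRdef
  have hR : 0 < R := half_pos hR₂
  have hRt1 : closedBall (e q₀) R ⊆ e.target :=
    (closedBall_subset_closedBall (by linarith)).trans hRt
  set W := chartPreimage e hF q₀ R with hW
  set f : W → Fin n → ℝ := fun w => e (F w) - e q₀ with hf
  have hfc : Continuous f := continuous_chart_comp e hF
  have hfR : ∀ w : W, ‖f w‖ < R := fun w => by
    have : e (F w) ∈ ball (e q₀) R := w.2.2
    rwa [mem_ball, dist_eq_norm] at this
  have : LocallyCompactSpace W := W.isOpen.locallyCompactSpace
  have hZ : IsCompact {w | f w = 0} := by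
    have := isCompact_chart_norm_le e hF hRt1 hR
    simpa only [norm_le_zero_iff] using this
  obtain ⟨δ, hδ, hδu⟩ := Metric.uniformContinuousOn_iff.1
    ((isCompact_closedBall (e q₀) R₂).uniformContinuousOn_of_continuous
      (e.continuousOn_symm.mono hRt)) ε hε
  obtain ⟨g, hg, hgf, ⟨C, hC, hgC⟩, hgs⟩ := exists_simple_approx (exists_chart_opens hch W) hfc hZ
    (lt_min hδ hR)
  have hgt : ∀ w, g w + e q₀ ∈ closedBall (e q₀) R₂ := fun w => by
    rw [mem_closedBall, dist_eq_norm, add_sub_cancel_right]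
    have h1 := norm_sub_norm_le (g w) (f w)
    linarith [(hgf w).trans_le (min_le_right _ _), hfR w]
  set F' : M → M := fun p => if h : p ∈ W then e.symm (g ⟨p, h⟩ + e q₀) else F p with hF'
  have hF'W : ∀ w : W, F' w = e.symm (g w + e q₀) := fun w => by simp [hF', w.2]
  have hF'n : ∀ p, p ∉ ((↑) : W → M) '' C → F' p = F p := by
    intro p hp
    by_cases h : p ∈ W
    · have h1 := hF'W ⟨p, h⟩
      rw [hgC ⟨p, h⟩ fun h' => hp ⟨_, h', rfl⟩] at h1
      rw [h1, hf]
      simp only [sub_add_cancel]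
      exact e.left_inv h.1
    · simp [hF', h]
  have hC' : IsClosed (((↑) : W → M) '' C) := (hC.image continuous_subtype_val).isClosed
  refine ⟨F', ?_, fun p => ?_, fun p hp => ?_⟩
  · rw [continuous_iff_continuousAt]
    intro p
    by_cases h : p ∈ W
    · have h1 : Continuous fun w : W => F' w := by
        simp only [hF'W]
        exact e.continuousOn_symm.comp_continuous (hg.add continuous_const) fun w => hRt (hgt w)
      exact (continuousOn_iff_continuous_domRestrict.2 h1).continuousAt (W.isOpen.mem_nhds h)
    · refine hF.continuousAt.congr ?_
      filter_upwards [hC'.isOpen_compl.mem_nhds (x := p) (by rintro ⟨w, -, rfl⟩; exact h w.2)]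
        with q hq
      exact (hF'n q hq).symm
  · by_cases h : p ∈ W
    · have h1 := hF'W ⟨p, h⟩
      have h2 : e.symm (e (F p)) = F p := e.left_inv h.1
      simp only at h1
      rw [h1, ← h2]
      refine hδu _ ?_ _ (hgt _) ?_
      · exact (ball_subset_closedBall.trans (closedBall_subset_closedBall (by linarith))) h.2
      · rw [dist_comm, dist_eq_norm]
        have h3 := (hgf ⟨p, h⟩).trans_le (min_le_left _ _)
        rwa [hf, ← sub_add, sub_add_eq_add_sub] at h3
    · simpa [hF', h] using hε
  · by_cases h : p ∈ W
    · have h1 := hF'W ⟨p, h⟩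
      simp only at h1
      have h0 : g ⟨p, h⟩ = 0 := by
        rw [h1] at hp
        have := congrArg e hp
        rw [e.right_inv (hRt (hgt _))] at this
        simpa using this
      obtain ⟨U, hU, hinj⟩ := hgs _ (mem_univ _) h0
      refine ⟨(↑) '' U, W.isOpen.isOpenEmbedding_subtypeVal.image_mem_nhds.2 hU, ?_⟩
      rintro _ ⟨a, ha, rfl⟩ _ ⟨b, hb, rfl⟩ hab
      rw [hF'W, hF'W] at hab
      have := e.symm.injOn (hRt (hgt a)) (hRt (hgt b)) hab
      rw [hinj ha hb (add_right_cancel this)]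
    · have h1 : F p = q₀ := by simpa [hF', h] using hp
      refine absurd ?_ h
      change F p ∈ e.source ∩ e ⁻¹' ball (e q₀) R
      rw [h1]
      exact ⟨he, mem_ball_self hR⟩

/-- The parity of the number of points in the fibre over `q`. -/
noncomputable def fiberPar (F : M → M) (q : M) : ZMod 2 := ({p | F p = q}.ncard : ZMod 2)

theorem exists_fiberPar_eq
    (hch : ∀ p : M, ∃ e : OpenPartialHomeomorph M (Fin n → ℝ), p ∈ e.source)
    {F : M → M} (hF : Continuous F) (q₀ : M) :
    ∃ ε > 0, ∀ q₁ ∈ ball q₀ ε, ∀ q₂ ∈ ball q₀ ε, ∀ F₁ F₂ : M → M, Continuous F₁ → Continuous F₂ →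
      (∀ p, dist (F p) (F₁ p) < ε) → (∀ p, dist (F p) (F₂ p) < ε) → GoodAt F₁ q₁ → GoodAt F₂ q₂ →
      fiberPar F₁ q₁ = fiberPar F₂ q₂ := by
  obtain ⟨e, he, R, hR, hRt⟩ := exists_chart_closedBall hch q₀
  set W := chartPreimage e hF q₀ R with hW
  set f : W → Fin n → ℝ := fun w => e (F w) - e q₀ with hf
  have hfc : Continuous f := continuous_chart_comp e hF
  have : LocallyCompactSpace W := W.isOpen.locallyCompactSpace
  set K := e.symm '' closedBall (e q₀) R with hK
  have hKc : IsCompact K :=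
    (isCompact_closedBall _ _).image_of_continuousOn (e.continuousOn_symm.mono hRt)
  have hKs : K ⊆ e.source := by
    rintro _ ⟨y, hy, rfl⟩
    exact e.map_target (hRt hy)
  obtain ⟨ε₁, hε₁, hKε⟩ := hKc.exists_thickening_subset_open e.open_source hKs
  have hR8 : 0 < R / 8 := by linarith
  obtain ⟨ε₂, hε₂, hu⟩ := Metric.mem_uniformity_dist.1
    (hKc.uniformContinuousAt_of_continuousAt e (fun a ha => e.continuousAt (hKs ha))
      (Metric.dist_mem_uniformity hR8))
  obtain ⟨ε₃, hε₃, h3⟩ := Metric.mem_nhds_iff.1 (inter_mem (e.open_source.mem_nhds he)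
    ((e.continuousAt he) (ball_mem_nhds (e q₀) hR8)))
  set ε := min (min ε₁ ε₂) (ε₃ / 2) with hε
  have hεε₁ : ε ≤ ε₁ := (min_le_left _ _).trans (min_le_left _ _)
  have hεε₂ : ε ≤ ε₂ := (min_le_left _ _).trans (min_le_right _ _)
  have hεε₃ : ε ≤ ε₃ / 2 := min_le_right _ _
  refine ⟨ε, lt_min (lt_min hε₁ hε₂) (half_pos hε₃), ?_⟩
  set χ : (Fin n → ℝ) → ℝ := fun y => clamp ((3 * R / 4 - ‖y‖) / (R / 4)) with hχ
  have hχc : Continuous χ := continuous_clamp.comp (by fun_prop)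
  have hχ1 : ∀ y, ‖y‖ ≤ R / 2 → χ y = 1 := fun y hy =>
    clamp_of_one_le ((one_le_div (by linarith)).2 (by linarith))
  have hχ0 : ∀ y, 3 * R / 4 ≤ ‖y‖ → χ y = 0 := fun y hy =>
    clamp_of_nonpos (div_nonpos_of_nonpos_of_nonneg (by linarith) (by linarith))
  have key : ∀ q ∈ ball q₀ ε, ∀ G : M → M, Continuous G → (∀ p, dist (F p) (G p) < ε) →
      GoodAt G q → ∃ g : W → Fin n → ℝ, Continuous g ∧
        (∀ w, w ∉ {w : W | ‖e (F w) - e q₀‖ ≤ 3 * R / 4} → g w = f w) ∧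
        ‖e q - e q₀‖ < 3 * R / 4 ∧ Simple (fun w => g w - (e q - e q₀)) univ ∧
        fiberPar G q = par (fun w => g w - (e q - e q₀)) univ := by
    intro q hq G hG hFG hgood
    have hq3 := h3 (ball_subset_ball (by linarith) hq)
    have hqs : q ∈ e.source := hq3.1
    have hqv : ‖e q - e q₀‖ < R / 8 := by
      have : e q ∈ ball (e q₀) (R / 8) := hq3.2
      rwa [mem_ball, dist_eq_norm] at this
    have hFK : ∀ w : W, F w ∈ K := fun w => ⟨e (F w), ball_subset_closedBall w.2.2,
      e.left_inv w.2.1⟩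
    have hGs : ∀ w : W, G w ∈ e.source := fun w => hKε (mem_thickening_iff.2
      ⟨F w, hFK w, by rw [dist_comm]; exact (hFG w).trans_le hεε₁⟩)
    have hGF : ∀ w : W, ‖e (G w) - e (F w)‖ < R / 8 := fun w => by
      have := hu ((hFG w).trans_le hεε₂) (hFK w)
      rw [← dist_eq_norm, dist_comm]
      exact this
    set g : W → Fin n → ℝ := fun w => f w + χ (f w) • (e (G w) - e (F w)) with hg
    have hgc : Continuous g := by
      have h1 : Continuous fun w : W => e (G w) :=
        e.continuousOn.comp_continuous (hG.comp continuous_subtype_val) hGs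
      have h2 : Continuous fun w : W => e (F w) :=
        e.continuousOn.comp_continuous (hF.comp continuous_subtype_val) fun w => w.2.1
      exact hfc.add ((hχc.comp hfc).smul (h1.sub h2))
    have hg1 : ∀ w, ‖f w‖ ≤ R / 2 → g w = e (G w) - e q₀ := fun w hw => by
      change f w + χ (f w) • (e (G w) - e (F w)) = _
      rw [hχ1 _ hw, one_smul]
      simp only [hf]
      abel
    have hgz : ∀ w, g w - (e q - e q₀) = 0 → ‖f w‖ < R / 2 := by
      intro w hw
      have h1 : f w = (e q - e q₀) - χ (f w) • (e (G w) - e (F w)) := by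
        rw [← sub_eq_zero.1 hw]
        simp [hg]
      have h2 : ‖χ (f w) • (e (G w) - e (F w))‖ ≤ R / 8 := by
        rw [norm_smul, Real.norm_of_nonneg (clamp_mem _).1]
        exact (mul_le_of_le_one_left (norm_nonneg _) (clamp_mem _).2).trans (hGF w).le
      have h3 := norm_sub_le (e q - e q₀) (χ (f w) • (e (G w) - e (F w)))
      rw [← h1] at h3
      linarith
    have hgq : ∀ w, g w - (e q - e q₀) = 0 → G w = q := by
      intro w hw
      have h1 := hg1 w (hgz w hw).le
      rw [h1, sub_sub_sub_cancel_right, sub_eq_zero] at hw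
      exact e.injOn (hGs w) hqs hw
    refine ⟨g, hgc, fun w hw => ?_, by linarith, fun w _ hw => ?_, ?_⟩
    · simp only [hg]
      rw [hχ0 (f w) (le_of_lt (not_le.1 hw)), zero_smul, add_zero]
    · obtain ⟨U, hU, hinj⟩ := hgood w (hgq w hw)
      refine Simple.congr (f := fun w : W => e (G w) - e q) ⟨(↑) ⁻¹' U,
        continuous_subtype_val.continuousAt.preimage_mem_nhds hU, fun a ha b hb hab => ?_⟩ ?_
      · exact Subtype.ext (hinj ha hb (e.injOn (hGs a) (hGs b) (sub_left_injective hab)))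
      · filter_upwards [(isOpen_lt hfc.norm continuous_const).mem_nhds (hgz w hw)] with a ha
        rw [hg1 a (le_of_lt ha)]
        abel
    · unfold par fiberPar
      rw [← (Subtype.val_injective (p := fun p => p ∈ W)).injOn.ncard_image]
      congr 2
      ext p
      constructor
      · intro hp
        have hp : G p = q := hp
        have hFp : F p ∈ ball q₀ ε₃ := by
          have h1 := dist_triangle (F p) (G p) q₀
          have h2 := hFG p
          rw [hp] at h1 h2
          rw [mem_ball] at hq ⊢
          linarith
        have hFp3 := h3 hFp
        have hFpR : e (F p) ∈ ball (e q₀) (R / 8) := hFp3.2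
        have hpW : p ∈ W := ⟨hFp3.1, ball_subset_ball (by linarith) hFpR⟩
        refine ⟨⟨p, hpW⟩, ⟨mem_univ _, ?_⟩, rfl⟩
        change g ⟨p, hpW⟩ - (e q - e q₀) = 0
        rw [hg1 ⟨p, hpW⟩ ?_]
        · simp [hp]
        · rw [mem_ball, dist_eq_norm] at hFpR
          simp only [hf]
          linarith
      · rintro ⟨w, ⟨-, hw⟩, rfl⟩
        exact hgq w hw
  intro q₁ hq₁ q₂ hq₂ F₁ F₂ hF₁ hF₂ hd₁ hd₂ hg₁ hg₂
  obtain ⟨g₁, c₁, o₁, v₁, s₁, p₁⟩ := key q₁ hq₁ F₁ hF₁ hd₁ hg₁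
  obtain ⟨g₂, c₂, o₂, v₂, s₂, p₂⟩ := key q₂ hq₂ F₂ hF₂ hd₂ hg₂
  have hcpt := isCompact_chart_norm_le e hF hRt (show 3 * R / 4 < R by linarith)
  rw [p₁, p₂]
  exact par_sub_eq_par_sub (exists_chart_opens hch W) (f := f) hcpt c₁ c₂ hcpt o₁ o₂ v₁ v₂ s₁ s₂

/-- A self-map of a closed connected manifold which is the identity near `y` and has `{y}` as its
fibre over `y` is surjective. -/
theorem surjective_of_fiber_singleton [ConnectedSpace M]
    (hch : ∀ p : M, ∃ e : OpenPartialHomeomorph M (Fin n → ℝ), p ∈ e.source)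
    {F : M → M} (hF : Continuous F) {y : M} (hy : ∀ᶠ p in 𝓝 y, F p = p)
    (hfib : ∀ p, F p = y → p = y) : Function.Surjective F := by
  by_contra hsurj
  obtain ⟨x, hx⟩ := not_forall.1 hsurj
  set S : Set M := {q | ∀ ε > 0, ∃ F' : M → M, Continuous F' ∧ (∀ p, dist (F p) (F' p) < ε) ∧
    GoodAt F' q ∧ fiberPar F' q = 1} with hS
  have hloc : ∀ q₀, ∃ ε > 0, ∀ q₁ ∈ ball q₀ ε, ∀ q₂ ∈ ball q₀ ε, q₁ ∈ S → q₂ ∈ S := by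
    intro q₀
    obtain ⟨ε, hε, h⟩ := exists_fiberPar_eq hch hF q₀
    refine ⟨ε, hε, fun q₁ hq₁ q₂ hq₂ hqS ε' hε' => ?_⟩
    obtain ⟨F₁, hF₁, hd₁, hg₁, hp₁⟩ := hqS ε hε
    obtain ⟨F₂, hF₂, hd₂, hg₂⟩ := exists_goodAt_approx hch hF q₂ (lt_min hε hε')
    refine ⟨F₂, hF₂, fun p => (hd₂ p).trans_le (min_le_right _ _), hg₂, ?_⟩
    rw [← hp₁]
    exact h q₂ hq₂ q₁ hq₁ F₂ F₁ hF₂ hF₁ (fun p => (hd₂ p).trans_le (min_le_left _ _)) hd₁ hg₂ hg₁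
  have hclopen : IsClopen S := by
    constructor
    · rw [← isOpen_compl_iff, isOpen_iff_mem_nhds]
      intro q hq
      obtain ⟨ε, hε, h⟩ := hloc q
      filter_upwards [ball_mem_nhds q hε] with q' hq' hq'S
      exact hq (h q' hq' q (mem_ball_self hε) hq'S)
    · rw [isOpen_iff_mem_nhds]
      intro q hq
      obtain ⟨ε, hε, h⟩ := hloc q
      filter_upwards [ball_mem_nhds q hε] with q' hq'
      exact h q (mem_ball_self hε) q' hq' hq
  have hyS : y ∈ S := by
    intro ε hε
    refine ⟨F, hF, fun _ => by simpa using hε, fun p hp => ?_, ?_⟩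
    · rw [hfib p hp]
      refine ⟨_, hy, fun a ha b hb hab => ?_⟩
      rwa [show F a = a from ha, show F b = b from hb] at hab
    · have : {p | F p = y} = {y} := by
        ext p
        exact ⟨hfib p, fun h => h ▸ hy.self_of_nhds⟩
      simp [fiberPar, this]
  have hxS : x ∈ S := by
    rcases isClopen_iff.1 hclopen with h | h
    · simp [h] at hyS
    · simp [h]
  have hxr : (range F)ᶜ ∈ 𝓝 x :=
    (isCompact_range hF).isClosed.isOpen_compl.mem_nhds fun ⟨p, hp⟩ => hx ⟨p, hp⟩
  obtain ⟨ε, hε, hεr⟩ := Metric.mem_nhds_iff.1 hxr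
  obtain ⟨F', -, hd, -, hp⟩ := hxS ε hε
  have : {p | F' p = x} = ∅ := by
    ext p
    simp only [mem_ofPred_eq, mem_empty_iff_false, iff_false]
    intro h
    refine hεr (?_ : F p ∈ ball x ε) ⟨p, rfl⟩
    rw [← h]
    exact hd p
  simp [fiberPar, this] at hp

end Global

theorem exists_openPartialHomeomorph_of_isTopManifold {M : Type*} [TopologicalSpace M]
    (hM : IsTopManifold n M) (x : M) :
    ∃ e : OpenPartialHomeomorph M (Fin n → ℝ), x ∈ e.source := by
  obtain ⟨U, V, hU, hxU, hV, ⟨φ⟩⟩ := hM x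
  have : Nonempty U := ⟨⟨x, hxU⟩⟩
  let i := hU.isOpenEmbedding_subtypeVal.toOpenPartialHomeomorph
  let j := ((EuclideanSpace.equiv (Fin n) ℝ).toHomeomorph.isOpenEmbedding.comp
    (hV.isOpenEmbedding_subtypeVal.comp φ.isOpenEmbedding)).toOpenPartialHomeomorph
  exact ⟨i.symm.trans j, by simpa [i, j] using hxU⟩

theorem locallyConnectedSpace_of_openPartialHomeomorph {M : Type*} [TopologicalSpace M]
    (hch : ∀ p : M, ∃ e : OpenPartialHomeomorph M (Fin n → ℝ), p ∈ e.source) :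
    LocallyConnectedSpace M := by
  choose e he using hch
  let _ : ChartedSpace (Fin n → ℝ) M :=
    { atlas := range e
      chartAt := e
      mem_chart_source := he
      chart_mem_atlas := mem_range_self }
  exact ChartedSpace.locallyConnectedSpace (Fin n → ℝ) M

theorem frontier_connectedComponentIn_compl_subset {X : Type*} [TopologicalSpace X]
    [LocallyConnectedSpace X] {S : Set X} (hS : IsClosed S) (z : X) :
    frontier (connectedComponentIn Sᶜ z) ⊆ S := by
  intro p hp
  by_contra hpS
  rw [hS.isOpen_compl.connectedComponentIn.frontier_eq] at hp
  obtain ⟨q, hqp, hqz⟩ := mem_closure_iff.1 hp.1 _ (hS.isOpen_compl.connectedComponentIn (x := p))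
    (mem_connectedComponentIn hpS)
  apply hp.2
  rw [connectedComponentIn_eq hqz, ← connectedComponentIn_eq hqp]
  exact mem_connectedComponentIn hpS

/-- Cutting off a contraction of `ball z r'` inside `B`: a continuous map into `B` which fixes a
given closed set `S` contained in a smaller ball. -/
theorem exists_continuous_eqOn_id_of_contraction {M : Type*} [MetricSpace M] {z : M} {r r' : ℝ}
    {h : ℝ → M → M} (hr : r < r') (hr' : 0 < r') {S B : Set M} (hS : IsClosed S)
    (hSr : ∀ p ∈ S, dist p z < r)
    (hc : ContinuousOn (fun p : ℝ × M => h p.1 p.2) (Icc 0 1 ×ˢ ball z r'))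
    (h0 : ∀ p ∈ ball z r', h 0 p = p) {c : M} (h1 : ∀ p ∈ ball z r', h 1 p = c)
    (hB : ∀ t ∈ Icc (0 : ℝ) 1, ∀ p ∈ ball z r', h t p ∈ B) :
    ∃ G : M → M, Continuous G ∧ (∀ p ∈ S, G p = p) ∧ ∀ p, G p ∈ B := by
  classical
  obtain ⟨l, l0, l1, l01⟩ := exists_continuous_zero_one_of_isClosed hS
    (isClosed_le (continuous_const (y := r)) (continuous_id.dist (continuous_const (y := z))))
    (disjoint_left.2 fun p hp hp' => (hSr p hp).not_ge hp')
  have hcB : c ∈ B := h1 z (mem_ball_self hr') ▸ hB 1 (right_mem_Icc.2 zero_le_one) z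
    (mem_ball_self hr')
  refine ⟨fun p => if p ∈ ball z r' then h (l p) p else c, ?_, fun p hp => ?_, fun p => ?_⟩
  · rw [continuous_iff_continuousAt]
    intro p
    by_cases hp : p ∈ ball z r'
    · have hcont : ContinuousOn (fun p => h (l p) p) (ball z r') :=
        hc.comp (l.continuous.prodMk continuous_id).continuousOn fun q hq => ⟨l01 q, hq⟩
      refine (hcont.continuousAt (isOpen_ball.mem_nhds hp)).congr ?_
      filter_upwards [isOpen_ball.mem_nhds hp] with q hq
      rw [if_pos hq]
    · refine (continuousAt_const (y := c)).congr ?_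
      have hrp : r < dist p z := hr.trans_le (not_lt.1 hp)
      filter_upwards [(isOpen_lt continuous_const
        (continuous_id.dist continuous_const)).mem_nhds hrp] with q hq
      split_ifs with hqr
      · have hl : l q = 1 := l1 (le_of_lt hq)
        rw [hl, h1 q hqr]
      · rfl
  · have hpr : p ∈ ball z r' := (hSr p hp).trans hr
    have hl : l p = 0 := l0 hp
    dsimp only
    rw [if_pos hpr, hl, h0 p hpr]
  · dsimp only
    split_ifs with hp
    exacts [hB _ (l01 p) p hp, hcB]

end SepDeg

end

/-- **Corollary 2.2.** Let `M` be a closed, connected, `L`-linearly locally contractible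
metric `n`-manifold. If `S ⊆ M` is closed, `U` and `V` are distinct connected components
of `M \ S`, and `B(x,r) ⊆ U`, `B(y,r) ⊆ V` for some points `x, y` and `r > 0`, then
`diam S ≥ r / L`. -/
theorem diam_of_separating_set (n : ℕ) (L : ℝ) (hn : 1 ≤ n) (hL : 1 ≤ L)
    (M : Type) [MetricSpace M] [CompactSpace M] [ConnectedSpace M]
    (hM : IsTopManifold n M) (hLLC : IsLLC L M)
    (S : Set M) (hS : IsClosed S) (U V : Set M)
    (hU : ∃ z ∈ Sᶜ, U = connectedComponentIn Sᶜ z)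
    (hV : ∃ z ∈ Sᶜ, V = connectedComponentIn Sᶜ z)
    (hUV : U ≠ V)
    (r : ℝ) (hr : 0 < r) (x y : M) (hx : ball x r ⊆ U) (hy : ball y r ⊆ V) :
    r / L ≤ diam S := by
  classical
  by_contra! hlt
  have hch := SepDeg.exists_openPartialHomeomorph_of_isTopManifold hM
  have := SepDeg.locallyConnectedSpace_of_openPartialHomeomorph hch
  obtain ⟨u, -, hUu⟩ := hU
  obtain ⟨v, -, hVv⟩ := hV
  have hUS : U ⊆ Sᶜ := hUu ▸ connectedComponentIn_subset _ _
  have hdisj : ∀ p ∈ U, p ∉ V := fun p hpU hpV => hUV <| by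
    rw [hUu] at hpU
    rw [hVv] at hpV
    rw [hUu, hVv, connectedComponentIn_eq hpU, connectedComponentIn_eq hpV]
  have hxU : x ∈ U := hx (mem_ball_self hr)
  have hyV : y ∈ V := hy (mem_ball_self hr)
  have hyU : y ∉ U := fun h => hdisj y h hyV
  have hS_ne : S.Nonempty := by
    by_contra hne
    rw [Set.not_nonempty_iff_eq_empty] at hne
    refine hyU ?_
    rw [hUu, hne, Set.compl_empty, connectedComponentIn_univ,
      PreconnectedSpace.connectedComponent_eq_univ]
    exact Set.mem_univ y
  obtain ⟨z, hz⟩ := hS_ne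
  obtain ⟨r₁, hr₁, hr₁r⟩ := exists_between hlt
  obtain ⟨r₂, hr₂, hr₂r⟩ := exists_between hr₁r
  have hL0 : 0 < L := one_pos.trans_le hL
  have hr₂0 : 0 < r₂ := diam_nonneg.trans_lt (hr₁.trans hr₂)
  have hdiam : r ≤ diam (Set.univ : Set M) := by
    have h1 : r ≤ dist y x := not_lt.1 fun h => hyU (hx h)
    exact h1.trans (dist_le_diam_of_mem isCompact_univ.isBounded (Set.mem_univ _) (Set.mem_univ _))
  obtain ⟨h, hc, h0, ⟨c, h1⟩, hB⟩ := hLLC z r₂ hr₂0 (hr₂r.le.trans (by gcongr))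
  obtain ⟨G, hG, hGS, hGB⟩ := SepDeg.exists_continuous_eqOn_id_of_contraction hr₂ hr₂0 hS
    (fun p hp => (dist_le_diam_of_mem hS.isCompact.isBounded hp hz).trans_lt hr₁) hc h0 h1 hB
  have hLr : L * r₂ < r := by rwa [lt_div_iff₀' hL0] at hr₂r
  have hxB : x ∉ ball z (L * r₂) := fun h => hUS (hx (mem_ball_comm.1 (h.trans hLr))) hz
  have hyB : y ∉ ball z (L * r₂) := fun h =>
    (hVv ▸ connectedComponentIn_subset _ _ : V ⊆ Sᶜ) (hy (mem_ball_comm.1 (h.trans hLr))) hz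
  have hF : Continuous fun p => if p ∈ U then G p else p :=
    Continuous.if (fun p hp => hGS p
      (SepDeg.frontier_connectedComponentIn_compl_subset hS u (hUu ▸ hp))) hG continuous_id
  have hVo : IsOpen V := hVv ▸ hS.isOpen_compl.connectedComponentIn
  obtain ⟨p, hp⟩ := SepDeg.surjective_of_fiber_singleton hch hF (y := y)
    (by
      filter_upwards [hVo.mem_nhds hyV] with p hp
      exact if_neg fun h => hdisj p h hp)
    (fun p hp => by
      split_ifs at hp with h
      exacts [(hyB (hp ▸ hGB p)).elim, hp]) x
  dsimp only at hp
  split_ifs at hp with h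
  exacts [hxB (hp ▸ hGB p), h (hp ▸ hxU)]
end

section
/- For each n ≥ 1 there is a constant C_n ≥ 1 with the following property. If k < n and E ⊆ Δ_n is a closed set with H_k(E) < ∞, then there is a continuous map p : Δ_n → Δ_n that fixes ∂Δ_n pointwise and satisfies p(E) ⊆ ∂Δ_n and H_k(p(E)) ≤ C_n · H_k(E). -/
open Metric MeasureTheory

/-- The standard `n`-simplex `Δₙ ⊆ ℝ^{n+1}`: the convex hull of the standard basis
vectors, i.e., points with nonnegative coordinates summing to `1`. -/
def stdSimplexSet (n : ℕ) : Set (EuclideanSpace ℝ (Fin (n + 1))) :=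
  {x | (∀ i, 0 ≤ x i) ∧ ∑ i, x i = 1}

/-- The boundary `∂Δₙ`: points of `Δₙ` having at least one coordinate equal to `0`. -/
def stdSimplexBoundary (n : ℕ) : Set (EuclideanSpace ℝ (Fin (n + 1))) :=
  {x ∈ stdSimplexSet n | ∃ i, x i = 0}

/-- The gauge of the simplex centred at `a`: on `stdSimplexSet n` it vanishes only at `a` and
equals `1` exactly on the boundary. -/
noncomputable def simplexGauge {n : ℕ} (a x : EuclideanSpace ℝ (Fin (n + 1))) : ℝ :=
  Finset.univ.sup' Finset.univ_nonempty fun i => 1 - x i / a i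

/-- The radial projection away from `a`, made continuous by truncating the gauge below at `s`. -/
noncomputable def radialPush {n : ℕ} (a : EuclideanSpace ℝ (Fin (n + 1))) (s : ℝ)
    (x : EuclideanSpace ℝ (Fin (n + 1))) : EuclideanSpace ℝ (Fin (n + 1)) :=
  a + (max (simplexGauge a x) s)⁻¹ • (x - a)

section Gauge

variable {n : ℕ} {a x y : EuclideanSpace ℝ (Fin (n + 1))} {δ s : ℝ}

lemma le_simplexGauge (i : Fin (n + 1)) : 1 - x i / a i ≤ simplexGauge a x :=
  Finset.le_sup' (fun i => 1 - x i / a i) (Finset.mem_univ i)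

lemma continuous_simplexGauge (a : EuclideanSpace ℝ (Fin (n + 1))) :
    Continuous (simplexGauge a) :=
  Continuous.finset_sup'_apply _ fun i _ => by fun_prop

lemma simplexGauge_sub_le (hδ : 0 < δ) (ha : ∀ i, δ ≤ a i) :
    simplexGauge a x - simplexGauge a y ≤ δ⁻¹ * dist x y := by
  rw [sub_le_iff_le_add]
  refine Finset.sup'_le _ _ fun i _ => ?_
  have hi := le_simplexGauge (a := a) (x := y) i
  have ha_pos : 0 < a i := hδ.trans_le (ha i)
  have hxy : y i - x i ≤ dist x y := by
    have := PiLp.norm_apply_le (y - x) i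
    rw [dist_comm, dist_eq_norm]
    exact (le_abs_self _).trans this
  have : (y i - x i) / a i ≤ δ⁻¹ * dist x y := by
    rw [div_eq_inv_mul]
    calc (a i)⁻¹ * (y i - x i) ≤ (a i)⁻¹ * dist x y := by gcongr
      _ ≤ δ⁻¹ * dist x y := by gcongr; exact ha i
  rw [sub_div] at this
  linarith

lemma abs_simplexGauge_sub_le (hδ : 0 < δ) (ha : ∀ i, δ ≤ a i) :
    |simplexGauge a x - simplexGauge a y| ≤ δ⁻¹ * dist x y :=
  abs_sub_le_iff.2 ⟨simplexGauge_sub_le hδ ha, dist_comm x y ▸ simplexGauge_sub_le hδ ha⟩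

lemma sub_le_mul_simplexGauge (ha : ∀ i, 0 < a i) (i : Fin (n + 1)) :
    a i - x i ≤ a i * simplexGauge a x := by
  have h := mul_le_mul_of_nonneg_left (le_simplexGauge (a := a) (x := x) i) (ha i).le
  rwa [mul_sub, mul_one, mul_div_cancel₀ _ (ha i).ne'] at h

lemma simplexGauge_nonneg (ha : ∀ i, 0 < a i) (has : a ∈ stdSimplexSet n)
    (hx : x ∈ stdSimplexSet n) : 0 ≤ simplexGauge a x := by
  have h := Finset.sum_le_sum fun i (_ : i ∈ Finset.univ) =>
    sub_le_mul_simplexGauge (x := x) ha i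
  rwa [Finset.sum_sub_distrib, ← Finset.sum_mul, has.2, hx.2, sub_self, one_mul] at h

lemma simplexGauge_le_one (ha : ∀ i, 0 < a i) (hx : x ∈ stdSimplexSet n) :
    simplexGauge a x ≤ 1 :=
  Finset.sup'_le _ _ fun i _ => by
    have := div_nonneg (hx.1 i) (ha i).le
    linarith

lemma simplexGauge_eq_one (ha : ∀ i, 0 < a i) (hx : x ∈ stdSimplexBoundary n) :
    simplexGauge a x = 1 := by
  obtain ⟨hx, i, hi⟩ := hx
  refine (simplexGauge_le_one ha hx).antisymm ?_
  simpa [hi] using le_simplexGauge (a := a) (x := x) i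

lemma dist_le_mul_simplexGauge (ha : ∀ i, 0 < a i) (has : a ∈ stdSimplexSet n)
    (hx : x ∈ stdSimplexSet n) : dist x a ≤ (n + 1 : ℝ) ^ 2 * simplexGauge a x := by
  have hg := simplexGauge_nonneg ha has hx
  have hle : ∀ i, a i - x i ≤ simplexGauge a x := fun i =>
    (sub_le_mul_simplexGauge ha i).trans <| mul_le_of_le_one_left hg <|
      has.2 ▸ Finset.single_le_sum (fun j _ => has.1 j) (Finset.mem_univ i)
  have habs : ∀ i, |x i - a i| ≤ (n + 1 : ℝ) * simplexGauge a x := fun i => by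
    have hsum := Finset.single_le_sum
      (f := fun j => simplexGauge a x - (a j - x j))
      (fun j _ => sub_nonneg.2 (hle j)) (Finset.mem_univ i)
    simp only [Finset.sum_sub_distrib, has.2, hx.2, Finset.sum_const, Finset.card_univ,
      Fintype.card_fin, nsmul_eq_mul] at hsum
    push_cast at hsum
    have hn : (0 : ℝ) ≤ n * simplexGauge a x := by positivity
    rw [abs_le]
    constructor
    · linarith [hle i]
    · linarith
  rw [dist_eq_norm]
  refine abs_le_of_sq_le_sq' ?_ (by positivity) |>.2
  rw [EuclideanSpace.norm_sq_eq]
  calc ∑ i, ‖(x - a) i‖ ^ 2 ≤ ∑ _i : Fin (n + 1), ((n + 1 : ℝ) * simplexGauge a x) ^ 2 := by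
        gcongr with i
        exact habs i
    _ = (n + 1 : ℝ) ^ 3 * simplexGauge a x ^ 2 := by
        simp only [Finset.sum_const, Finset.card_univ, Fintype.card_fin, nsmul_eq_mul]
        push_cast
        ring
    _ ≤ (n + 1 : ℝ) ^ 4 * simplexGauge a x ^ 2 := by
        gcongr
        · linarith [n.cast_nonneg (α := ℝ)]
        · norm_num
    _ = ((n + 1 : ℝ) ^ 2 * simplexGauge a x) ^ 2 := by ring

lemma continuous_radialPush (a : EuclideanSpace ℝ (Fin (n + 1))) (hs : 0 < s) :
    Continuous (radialPush a s) := by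
  have := continuous_simplexGauge a
  unfold radialPush
  fun_prop (disch := exact fun x => (lt_max_of_lt_right hs).ne')

lemma radialPush_mem (ha : ∀ i, 0 < a i) (has : a ∈ stdSimplexSet n) (hs : 0 < s)
    (hx : x ∈ stdSimplexSet n) : radialPush a s x ∈ stdSimplexSet n := by
  have hm : 0 < max (simplexGauge a x) s := lt_max_of_lt_right hs
  refine ⟨fun i => ?_, ?_⟩
  · have h : a i - x i ≤ a i * max (simplexGauge a x) s :=
      (sub_le_mul_simplexGauge ha i).trans
        (mul_le_mul_of_nonneg_left (le_max_left _ _) (ha i).le)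
    rw [← div_le_iff₀ hm, div_eq_inv_mul] at h
    simp only [radialPush, PiLp.add_apply, PiLp.smul_apply, PiLp.sub_apply, smul_eq_mul]
    linarith
  · simp [radialPush, Finset.sum_add_distrib, ← Finset.mul_sum, has.2, hx.2]

lemma radialPush_eq_self (ha : ∀ i, 0 < a i) (hs : s ≤ 1) (hx : x ∈ stdSimplexBoundary n) :
    radialPush a s x = x := by
  simp [radialPush, simplexGauge_eq_one ha hx, hs]

lemma radialPush_mem_boundary (ha : ∀ i, 0 < a i) (has : a ∈ stdSimplexSet n) (hs : 0 < s)
    (hx : x ∈ stdSimplexSet n) (hsx : s ≤ simplexGauge a x) :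
    radialPush a s x ∈ stdSimplexBoundary n := by
  refine ⟨radialPush_mem ha has hs hx, ?_⟩
  obtain ⟨i, -, hi⟩ := Finset.exists_mem_eq_sup' Finset.univ_nonempty fun i => 1 - x i / a i
  refine ⟨i, ?_⟩
  change simplexGauge a x = 1 - x i / a i at hi
  have hg := (hs.trans_le hsx).ne'
  have hxa : x i - a i = -(a i * simplexGauge a x) := by
    rw [hi]
    field_simp [(ha i).ne']
    ring
  simp only [radialPush, PiLp.add_apply, PiLp.smul_apply, PiLp.sub_apply, smul_eq_mul,
    max_eq_left hsx, hxa]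
  field_simp
  ring

lemma dist_radialPush_le (hδ : 0 < δ) (ha : ∀ i, δ ≤ a i) (has : a ∈ stdSimplexSet n)
    (hs : 0 < s) (hy : y ∈ stdSimplexSet n) :
    dist (radialPush a s x) (radialPush a s y) ≤
      (1 + (n + 1 : ℝ) ^ 2 * δ⁻¹) * (max (simplexGauge a x) s)⁻¹ * dist x y := by
  have hya : ‖y - a‖ ≤ (n + 1 : ℝ) ^ 2 * max (simplexGauge a y) s := by
    rw [← dist_eq_norm]
    exact (dist_le_mul_simplexGauge (fun i => hδ.trans_le (ha i)) has hy).trans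
      (mul_le_mul_of_nonneg_left (le_max_left _ _) (by positivity))
  have hlip : |max (simplexGauge a y) s - max (simplexGauge a x) s| ≤ δ⁻¹ * dist x y :=
    (abs_max_sub_max_le_abs _ _ _).trans
      (dist_comm x y ▸ abs_simplexGauge_sub_le hδ ha)
  have hmx : 0 < max (simplexGauge a x) s := lt_max_of_lt_right hs
  have hmy : 0 < max (simplexGauge a y) s := lt_max_of_lt_right hs
  unfold radialPush
  set u := max (simplexGauge a x) s
  set v := max (simplexGauge a y) s
  have hsplit : a + u⁻¹ • (x - a) - (a + v⁻¹ • (y - a)) =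
      u⁻¹ • (x - y) + (u⁻¹ - v⁻¹) • (y - a) := by module
  have huv : |u⁻¹ - v⁻¹| = u⁻¹ * v⁻¹ * |v - u| := by
    rw [inv_sub_inv hmx.ne' hmy.ne', abs_div, abs_of_pos (mul_pos hmx hmy), div_eq_inv_mul,
      mul_inv]
  rw [dist_eq_norm, hsplit]
  refine (norm_add_le _ _).trans ?_
  rw [norm_smul, norm_smul, Real.norm_eq_abs, Real.norm_eq_abs, abs_of_pos (inv_pos.2 hmx), huv,
    ← dist_eq_norm x y]
  calc u⁻¹ * dist x y + u⁻¹ * v⁻¹ * |v - u| * ‖y - a‖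
      ≤ u⁻¹ * dist x y + u⁻¹ * v⁻¹ * (δ⁻¹ * dist x y) * ((n + 1 : ℝ) ^ 2 * v) := by gcongr
    _ = (1 + (n + 1 : ℝ) ^ 2 * δ⁻¹) * u⁻¹ * dist x y := by
        field_simp

end Gauge

open scoped ENNReal

/-- The point of the hyperplane `∑ i, x i = 1` whose last `n` coordinates are `y`. -/
noncomputable def hyperplanePoint {n : ℕ} (y : Fin n → ℝ) : EuclideanSpace ℝ (Fin (n + 1)) :=
  WithLp.toLp 2 (Fin.cons (1 - ∑ i, y i) y)

section Hyperplane

variable {n : ℕ}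

lemma continuous_hyperplanePoint : Continuous (hyperplanePoint (n := n)) := by
  refine (PiLp.continuous_toLp 2 _).comp (continuous_pi fun i => ?_)
  refine Fin.cases ?_ (fun j => ?_) i
  · simp only [Fin.cons_zero]
    fun_prop
  · simp only [Fin.cons_succ]
    fun_prop

lemma sum_hyperplanePoint (y : Fin n → ℝ) : ∑ i, hyperplanePoint y i = 1 := by
  simp [hyperplanePoint, Fin.sum_univ_succ]

/-- Forgetting the first coordinate does not increase distances. -/
lemma lipschitzWith_tail :
    LipschitzWith 1 fun (x : EuclideanSpace ℝ (Fin (n + 1))) (i : Fin n) => x i.succ :=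
  LipschitzWith.of_dist_le_mul fun x y => by
    rw [NNReal.coe_one, one_mul, dist_pi_le_iff dist_nonneg]
    intro i
    rw [dist_eq_norm, dist_eq_norm]
    exact PiLp.norm_apply_le (x - y) i.succ

lemma tail_hyperplanePoint (y : Fin n → ℝ) : (fun i : Fin n => hyperplanePoint y i.succ) = y := by
  ext i
  simp [hyperplanePoint]

lemma volume_preimage_hyperplanePoint_eq_zero {k : ℝ} (hk : k < n)
    {E : Set (EuclideanSpace ℝ (Fin (n + 1)))} (hE : μH[k] E ≠ ⊤) :
    volume (hyperplanePoint ⁻¹' E) = 0 := by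
  have hE0 : μH[(n : ℝ)] E = 0 := (Measure.hausdorffMeasure_zero_or_top hk E).resolve_right hE
  have himage := lipschitzWith_tail.hausdorffMeasure_image_le n.cast_nonneg E
  rw [hE0, mul_zero, nonpos_iff_eq_zero] at himage
  have hvol : (μH[(n : ℝ)] : Measure (Fin n → ℝ)) = volume := by
    simpa using hausdorffMeasure_pi_real (ι := Fin n)
  rw [← hvol]
  refine measure_mono_null (fun y hy => ?_) himage
  exact ⟨hyperplanePoint y, hy, tail_hyperplanePoint y⟩

lemma lintegral_measure_closedBall_hyperplanePoint_le
    (ν : Measure (EuclideanSpace ℝ (Fin (n + 1)))) [SFinite ν] {r : ℝ} (hr : 0 ≤ r) :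
    ∫⁻ y, ν (closedBall (hyperplanePoint y) r) ≤
      ENNReal.ofReal ((2 * r) ^ n) * ν Set.univ := by
  have hS : MeasurableSet {q : (Fin n → ℝ) × EuclideanSpace ℝ (Fin (n + 1)) |
      dist q.2 (hyperplanePoint q.1) ≤ r} :=
    (isClosed_le (continuous_snd.dist (continuous_hyperplanePoint.comp continuous_fst))
      continuous_const).measurableSet
  have h := (Measure.prod_apply (μ := volume) (ν := ν) hS).symm.trans (Measure.prod_apply_symm hS)
  refine h.trans_le ?_
  rw [← lintegral_const]
  refine lintegral_mono fun x => ?_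
  have hball := Real.volume_pi_closedBall (fun i : Fin n => x i.succ) hr
  rw [Fintype.card_fin] at hball
  rw [← hball]
  refine measure_mono fun y hy => ?_
  rw [mem_closedBall, ← tail_hyperplanePoint y, dist_comm]
  exact (lipschitzWith_tail.dist_le_mul x (hyperplanePoint y)).trans (by simpa using hy)

lemma measurable_measure_closedBall_hyperplanePoint
    (ν : Measure (EuclideanSpace ℝ (Fin (n + 1)))) [SFinite ν] (r : ℝ) :
    Measurable fun y : Fin n → ℝ => ν (closedBall (hyperplanePoint y) r) :=
  measurable_measure_prodMk_left (ν := ν)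
    (s := {q : (Fin n → ℝ) × EuclideanSpace ℝ (Fin (n + 1)) |
      dist q.2 (hyperplanePoint q.1) ≤ r})
    (isClosed_le (continuous_snd.dist (continuous_hyperplanePoint.comp continuous_fst))
      continuous_const).measurableSet

lemma le_hyperplanePoint {y : Fin n → ℝ}
    (hy : y ∈ Set.Icc (fun _ => (2 * (n + 1 : ℝ))⁻¹) (fun _ => (n + 1 : ℝ)⁻¹))
    (i : Fin (n + 1)) : (2 * (n + 1 : ℝ))⁻¹ ≤ hyperplanePoint y i := by
  refine Fin.cases ?_ (fun j => ?_) i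
  · have hsum : ∑ i, y i ≤ n * (n + 1 : ℝ)⁻¹ := by
      simpa using Finset.sum_le_sum fun i (_ : i ∈ Finset.univ) => hy.2 i
    have h1 : 1 - n * (n + 1 : ℝ)⁻¹ = (n + 1 : ℝ)⁻¹ := by
      field_simp
      ring
    have h2 : (2 * (n + 1 : ℝ))⁻¹ ≤ (n + 1 : ℝ)⁻¹ := by
      gcongr
      linarith [n.cast_nonneg (α := ℝ)]
    simp only [hyperplanePoint, Fin.cons_zero]
    linarith
  · simpa [hyperplanePoint] using hy.1 j

lemma volume_Icc_center :
    volume (Set.Icc (fun _ : Fin n => (2 * (n + 1 : ℝ))⁻¹) (fun _ => (n + 1 : ℝ)⁻¹)) =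
      ENNReal.ofReal ((2 * (n + 1 : ℝ))⁻¹ ^ n) := by
  rw [Real.volume_Icc_pi, Finset.prod_const, Finset.card_univ, Fintype.card_fin,
    ← ENNReal.ofReal_pow]
  · congr 2
    field_simp
    norm_num
  · field_simp
    norm_num

end Hyperplane

lemma pow_mul_pow_le {k n : ℕ} (hk : k < n) {K M : ℝ} (hK : 1 ≤ K) (hM : 1 ≤ M) (j : ℕ) :
    (K * 2 ^ (j + 1)) ^ k * (2 * (M / 2 ^ j)) ^ n ≤ (4 * K * M) ^ n * (1 / 2) ^ j := by
  obtain ⟨m, rfl⟩ : ∃ m, n = m + 1 := ⟨n - 1, by omega⟩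
  have hbase : 1 ≤ K * 2 ^ (j + 1) := one_le_mul_of_one_le_of_one_le hK (one_le_pow₀ one_le_two)
  calc (K * 2 ^ (j + 1)) ^ k * (2 * (M / 2 ^ j)) ^ (m + 1)
      ≤ (K * 2 ^ (j + 1)) ^ m * (2 * (M / 2 ^ j)) ^ (m + 1) := by
        gcongr ?_ * _
        exact pow_le_pow_right₀ hbase (by omega)
    _ = (4 * K * M) ^ m * (2 * M) * (1 / 2) ^ j := by
        rw [pow_succ (2 * (M / 2 ^ j)), ← mul_assoc, ← mul_pow, div_pow, one_pow]
        have : K * 2 ^ (j + 1) * (2 * (M / 2 ^ j)) = 4 * K * M := by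
          field_simp
          ring
        rw [this]
        ring
    _ ≤ (4 * K * M) ^ m * (4 * K * M) * (1 / 2) ^ j := by
        gcongr
        linarith
    _ = _ := by rw [pow_succ (4 * K * M)]

lemma hausdorffMeasure_image_radialPush_le {n : ℕ} {a : EuclideanSpace ℝ (Fin (n + 1))}
    {δ s : ℝ} (hδ : 0 < δ) (ha : ∀ i, δ ≤ a i) (has : a ∈ stdSimplexSet n) (hs : 0 < s)
    {E : Set (EuclideanSpace ℝ (Fin (n + 1)))} (hE : E ⊆ stdSimplexSet n)
    (hsE : ∀ x ∈ E, s ≤ simplexGauge a x) (k : ℕ) :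
    μH[(k : ℝ)] (radialPush a s '' E) ≤
      ∑' j : ℕ, ENNReal.ofReal (((1 + (n + 1 : ℝ) ^ 2 * δ⁻¹) * 2 ^ (j + 1)) ^ k) *
        μH[(k : ℝ)] (closedBall a ((n + 1 : ℝ) ^ 2 / 2 ^ j) ∩ E) := by
  have ha0 : ∀ i, 0 < a i := fun i => hδ.trans_le (ha i)
  set K : ℝ := 1 + (n + 1 : ℝ) ^ 2 * δ⁻¹ with hK
  have hK0 : 0 ≤ K := by positivity
  let A : ℕ → Set (EuclideanSpace ℝ (Fin (n + 1))) := fun j =>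
    {x ∈ E | (1 / 2 : ℝ) ^ (j + 1) < simplexGauge a x ∧ simplexGauge a x ≤ (1 / 2) ^ j}
  have hcover : radialPush a s '' E ⊆ ⋃ j, radialPush a s '' A j := by
    rw [← Set.image_iUnion]
    refine Set.image_mono fun x hx => ?_
    obtain ⟨j, hj⟩ := exists_nat_pow_near_of_lt_one (hs.trans_le (hsE x hx))
      (simplexGauge_le_one ha0 (hE hx)) (one_half_pos (α := ℝ)) one_half_lt_one
    exact Set.mem_iUnion.2 ⟨j, hx, hj⟩
  refine (measure_mono hcover).trans ((measure_iUnion_le _).trans (ENNReal.tsum_le_tsum fun j => ?_))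
  have hlip : LipschitzOnWith (Real.toNNReal (K * 2 ^ (j + 1))) (radialPush a s) (A j) := by
    refine LipschitzOnWith.of_dist_le_mul fun x hx y hy => ?_
    rw [Real.coe_toNNReal _ (by positivity)]
    refine (dist_radialPush_le hδ ha has hs (hE hy.1)).trans ?_
    rw [← hK]
    gcongr
    rw [← inv_inv ((2 : ℝ) ^ (j + 1)), ← inv_pow, ← one_div 2]
    gcongr
    exact hx.2.1.le.trans (le_max_left _ _)
  refine (hlip.hausdorffMeasure_image_le k.cast_nonneg).trans ?_
  rw [ENNReal.rpow_natCast, ENNReal.ofReal_pow (by positivity)]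
  refine mul_le_mul' le_rfl (measure_mono fun x hx => ⟨?_, hx.1⟩)
  rw [mem_closedBall, div_eq_mul_inv, ← inv_pow, ← one_div 2]
  exact (dist_le_mul_simplexGauge ha0 has (hE hx.1)).trans (by gcongr; exact hx.2.2)

/-- Averaging over the centre: some centre outside `E` has a controlled dyadic sum. -/
lemma exists_center {n k : ℕ} (hk : k < n) {K M : ℝ} (hK : 1 ≤ K) (hM : 1 ≤ M)
    {E : Set (EuclideanSpace ℝ (Fin (n + 1)))} (hE : μH[(k : ℝ)] E < ⊤) :
    ∃ a ∈ stdSimplexSet n, (∀ i, (2 * (n + 1 : ℝ))⁻¹ ≤ a i) ∧ a ∉ E ∧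
      ∑' j : ℕ, ENNReal.ofReal ((K * 2 ^ (j + 1)) ^ k) *
        μH[(k : ℝ)] (closedBall a (M / 2 ^ j) ∩ E) ≤
      ENNReal.ofReal (2 * (4 * K * M * (2 * (n + 1))) ^ n) * μH[(k : ℝ)] E := by
  set ν : Measure (EuclideanSpace ℝ (Fin (n + 1))) := μH[(k : ℝ)].restrict E
  have : IsFiniteMeasure ν := isFiniteMeasure_restrict.2 hE.ne
  have hν : ∀ a r, μH[(k : ℝ)] (closedBall a r ∩ E) = ν (closedBall a r) := fun a r =>
    (Measure.restrict_apply isClosed_closedBall.measurableSet).symm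
  have hνE : ν Set.univ = μH[(k : ℝ)] E := Measure.restrict_apply_univ E
  simp only [hν, ← hνE]
  set B : Set (Fin n → ℝ) := Set.Icc (fun _ => (2 * (n + 1 : ℝ))⁻¹) (fun _ => (n + 1 : ℝ)⁻¹)
  set F : (Fin n → ℝ) → ℝ≥0∞ := fun y =>
    ∑' j : ℕ, ENNReal.ofReal ((K * 2 ^ (j + 1)) ^ k) * ν (closedBall (hyperplanePoint y) (M / 2 ^ j))
  have hmeas : ∀ j : ℕ, Measurable fun y : Fin n → ℝ =>
      ENNReal.ofReal ((K * 2 ^ (j + 1)) ^ k) * ν (closedBall (hyperplanePoint y) (M / 2 ^ j)) :=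
    fun j => (measurable_measure_closedBall_hyperplanePoint ν _).const_mul _
  have hgeom : ∑' j : ℕ, ENNReal.ofReal ((1 / 2 : ℝ) ^ j) = ENNReal.ofReal 2 := by
    rw [← ENNReal.ofReal_tsum_of_nonneg (fun j => by positivity) summable_geometric_two,
      tsum_geometric_two]
  have hF : ∫⁻ y, F y ≤ ENNReal.ofReal (2 * (4 * K * M) ^ n) * ν Set.univ := by
    rw [lintegral_tsum fun j => (hmeas j).aemeasurable]
    calc ∑' j : ℕ, ∫⁻ y, ENNReal.ofReal ((K * 2 ^ (j + 1)) ^ k) *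
            ν (closedBall (hyperplanePoint y) (M / 2 ^ j))
        ≤ ∑' j : ℕ, ENNReal.ofReal ((4 * K * M) ^ n) * ν Set.univ *
            ENNReal.ofReal ((1 / 2 : ℝ) ^ j) := by
          refine ENNReal.tsum_le_tsum fun j => ?_
          rw [lintegral_const_mul _ (measurable_measure_closedBall_hyperplanePoint ν _)]
          refine (mul_le_mul' le_rfl
            (lintegral_measure_closedBall_hyperplanePoint_le ν (by positivity))).trans ?_
          rw [← mul_assoc, ← ENNReal.ofReal_mul (by positivity), mul_right_comm,
            ← ENNReal.ofReal_mul (by positivity)]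
          gcongr ENNReal.ofReal ?_ * _
          exact pow_mul_pow_le hk hK hM j
      _ = ENNReal.ofReal (2 * (4 * K * M) ^ n) * ν Set.univ := by
          rw [ENNReal.tsum_mul_left, hgeom, mul_right_comm, ← ENNReal.ofReal_mul (by positivity),
            mul_comm 2]
  have hB : volume B = ENNReal.ofReal ((2 * (n + 1 : ℝ))⁻¹ ^ n) := volume_Icc_center
  have hB0 : volume B ≠ 0 := by
    rw [hB]
    exact (ENNReal.ofReal_pos.2 (by positivity)).ne'
  have hnull : volume.restrict B (Bᶜ ∪ hyperplanePoint ⁻¹' E) = 0 := by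
    refine measure_union_null ?_ ?_
    · rw [Measure.restrict_apply measurableSet_Icc.compl, Set.compl_inter_self, measure_empty]
    · exact Measure.absolutelyContinuous_of_le Measure.restrict_le_self
        (volume_preimage_hyperplanePoint_eq_zero (Nat.cast_lt.2 hk) hE.ne)
  have hFm : Measurable F := Measurable.tsum hmeas
  have : IsFiniteMeasure (volume.restrict B) :=
    isFiniteMeasure_restrict.2 (hB ▸ ENNReal.ofReal_ne_top)
  obtain ⟨y, hy, hyF⟩ := exists_notMem_null_le_laverage
    (by simpa using hB0) hFm.aemeasurable hnull
  simp only [Set.mem_union, not_or, Set.mem_compl_iff, not_not] at hy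
  have hya := le_hyperplanePoint hy.1
  refine ⟨hyperplanePoint y, ⟨fun i => le_trans (by positivity) (hya i), sum_hyperplanePoint y⟩,
    hya, hy.2, hyF.trans ?_⟩
  rw [setLAverage_eq, hB]
  refine ENNReal.div_le_of_le_mul ((setLIntegral_le_lintegral _ _).trans (hF.trans_eq ?_))
  rw [mul_right_comm (ENNReal.ofReal _), ← ENNReal.ofReal_mul (by positivity)]
  congr 2
  rw [mul_assoc 2 (_ ^ n), ← mul_pow]
  congr 2
  field_simp

/-- **Lemma 3.1 (projection lemma).** For each `n ≥ 1` there is `Cₙ ≥ 1` such that: if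
`k < n` and `E ⊆ Δₙ` is closed with `H_k(E) < ∞`, then there is a continuous map
`p : Δₙ → Δₙ` fixing `∂Δₙ` pointwise, with `p(E) ⊆ ∂Δₙ` and `H_k(p(E)) ≤ Cₙ H_k(E)`. -/
theorem simplex_projection (n : ℕ) (hn : 1 ≤ n) :
    ∃ C : ℝ, 1 ≤ C ∧ ∀ k : ℕ, k < n →
      ∀ E : Set (EuclideanSpace ℝ (Fin (n + 1))),
        IsClosed E → E ⊆ stdSimplexSet n → μH[(k : ℝ)] E < ⊤ →
        ∃ p : EuclideanSpace ℝ (Fin (n + 1)) → EuclideanSpace ℝ (Fin (n + 1)),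
          ContinuousOn p (stdSimplexSet n) ∧
          Set.MapsTo p (stdSimplexSet n) (stdSimplexSet n) ∧
          (∀ x ∈ stdSimplexBoundary n, p x = x) ∧
          p '' E ⊆ stdSimplexBoundary n ∧
          μH[(k : ℝ)] (p '' E) ≤ ENNReal.ofReal C * μH[(k : ℝ)] E := by
  have hM : (1 : ℝ) ≤ (n + 1 : ℝ) ^ 2 := one_le_pow₀ (by linarith [n.cast_nonneg (α := ℝ)])
  have hδ : (0 : ℝ) < (2 * (n + 1 : ℝ))⁻¹ := by positivity
  have hK : (1 : ℝ) ≤ 1 + (n + 1 : ℝ) ^ 2 * (2 * (n + 1 : ℝ))⁻¹⁻¹ := by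
    rw [le_add_iff_nonneg_right]
    positivity
  refine ⟨max 1 (2 * (4 * (1 + (n + 1 : ℝ) ^ 2 * (2 * (n + 1 : ℝ))⁻¹⁻¹) * (n + 1 : ℝ) ^ 2 *
    (2 * (n + 1))) ^ n), le_max_left 1 _, fun k hk E hEc hEΔ hE => ?_⟩
  obtain ⟨a, has, ha, haE, hsum⟩ := exists_center hk hK hM hE
  have ha0 : ∀ i, 0 < a i := fun i => hδ.trans_le (ha i)
  obtain ⟨r, hr, hball⟩ := Metric.isOpen_iff.1 hEc.isOpen_compl a haE
  obtain ⟨s, hs, hs1, hsr⟩ : ∃ s : ℝ, 0 < s ∧ s ≤ 1 ∧ (n + 1 : ℝ) ^ 2 * s ≤ r :=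
    ⟨min 1 (r / (n + 1 : ℝ) ^ 2), by positivity, min_le_left _ _, by
      rw [← le_div_iff₀' (by positivity)]
      exact min_le_right _ _⟩
  have hsE : ∀ x ∈ E, s ≤ simplexGauge a x := fun x hx => by
    have hxr : r ≤ dist x a := not_lt.1 fun h => hball h hx
    exact le_of_mul_le_mul_left
      (hsr.trans (hxr.trans (dist_le_mul_simplexGauge ha0 has (hEΔ hx)))) (by positivity)
  refine ⟨radialPush a s, (continuous_radialPush a hs).continuousOn,
    fun x hx => radialPush_mem ha0 has hs hx, fun x hx => radialPush_eq_self ha0 hs1 hx, ?_, ?_⟩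
  · rintro _ ⟨x, hx, rfl⟩
    exact radialPush_mem_boundary ha0 has hs (hEΔ hx) (hsE x hx)
  · refine (hausdorffMeasure_image_radialPush_le hδ ha has hs hEΔ hsE k).trans (hsum.trans ?_)
    gcongr
    exact le_max_right _ _
end

section
/- For each pair of integers 1 ≤ k ≤ n there is a constant c_{k,n} > 0 with the following property. Let ℓ ≥ 1, let F be a nonempty family of nonempty subsets of {1,…,ℓ}, closed under taking nonempty subsets, with |σ| ≤ n+1 for every σ ∈ F, and let 𝒮 = ⋃_{σ∈F} conv{e_i : i ∈ σ} ⊆ ℝ^ℓ be the associated standard simplicial complex. If E ⊆ 𝒮 is a closed set with H_k(E) ≤ c_{k,n}, then there is a continuous map p : 𝒮 → 𝒮 such that p(conv{e_i : i ∈ σ}) ⊆ conv{e_i : i ∈ σ} for every σ ∈ F, and p(E) ⊆ 𝒮^{(k−1)}. -/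
open Metric MeasureTheory

/-- The geometric cell associated to a finite set `σ` of indices: the convex hull of the
corresponding standard basis vectors of `ℝ^ℓ`. -/
noncomputable def cellOf {ℓ : ℕ} (σ : Finset (Fin ℓ)) : Set (EuclideanSpace ℝ (Fin ℓ)) :=
  convexHull ℝ ((fun i => EuclideanSpace.single i (1 : ℝ)) '' (σ : Set (Fin ℓ)))

/-- The realization of the standard simplicial complex determined by a family `F` of
index sets: `𝒮 = ⋃_{σ ∈ F} conv{eᵢ : i ∈ σ} ⊆ ℝ^ℓ`. -/
noncomputable def realization {ℓ : ℕ} (F : Finset (Finset (Fin ℓ))) :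
    Set (EuclideanSpace ℝ (Fin ℓ)) :=
  ⋃ σ ∈ F, cellOf σ

/-- The `m`-skeleton of the standard simplicial complex determined by `F`: the union of
the cells of the simplices of `F` of dimension at most `m`. -/
noncomputable def skeleton {ℓ : ℕ} (F : Finset (Finset (Fin ℓ))) (m : ℕ) :
    Set (EuclideanSpace ℝ (Fin ℓ)) :=
  ⋃ σ ∈ F.filter (fun σ => σ.card ≤ m + 1), cellOf σ

theorem mem_cellOf_iff {ℓ : ℕ} {σ : Finset (Fin ℓ)} {x : EuclideanSpace ℝ (Fin ℓ)} :
    x ∈ cellOf σ ↔ (∀ i, 0 ≤ x i) ∧ (∀ i ∉ σ, x i = 0) ∧ ∑ i, x i = 1 := by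
  constructor
  · intro hx
    have hconv : Convex ℝ {x : EuclideanSpace ℝ (Fin ℓ) |
        (∀ i, 0 ≤ x i) ∧ (∀ i ∉ σ, x i = 0) ∧ ∑ i, x i = 1} := by
      rintro x ⟨hx₁, hx₂, hx₃⟩ y ⟨hy₁, hy₂, hy₃⟩ a b ha hb hab
      refine ⟨fun i => ?_, fun i hi => ?_, ?_⟩
      · have := mul_nonneg ha (hx₁ i)
        have := mul_nonneg hb (hy₁ i)
        simp only [PiLp.add_apply, PiLp.smul_apply, smul_eq_mul]
        linarith
      · simp [hx₂ i hi, hy₂ i hi]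
      · simp [Finset.sum_add_distrib, ← Finset.mul_sum, hx₃, hy₃, hab]
    refine convexHull_min ?_ hconv hx
    rintro _ ⟨j, hj, rfl⟩
    refine ⟨fun i => ?_, fun i hi => ?_, ?_⟩
    · by_cases h : i = j <;> simp [h]
    · have : i ≠ j := fun h => hi (h ▸ hj)
      simp [this]
    · simp
  · rintro ⟨h₁, h₂, h₃⟩
    have hx : x = ∑ i ∈ σ, x i • EuclideanSpace.single i (1 : ℝ) := by
      ext j
      by_cases hj : j ∈ σ
      · simp [Finset.sum_apply, Pi.single_apply, hj]
      · simp [Finset.sum_apply, Pi.single_apply, hj, h₂ j hj]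
    rw [hx]
    refine (convex_convexHull ℝ _).sum_mem (fun i _ => h₁ i) ?_ fun i hi =>
      subset_convexHull ℝ _ ⟨i, hi, rfl⟩
    rw [← h₃]
    exact Finset.sum_subset (Finset.subset_univ _) fun i _ hi => h₂ i hi

theorem pi_restrict_setOf_sub_mem_le {ι : Type*} [Fintype ι] (p : ι → Prop) [DecidablePred p]
    (i₀ : ι) (hi₀ : ¬ p i₀) (K : Set ({i // p i} → ℝ)) :
    Measure.pi (fun _ : ι => (volume : Measure ℝ).restrict (Set.Icc 0 1))
      {t | (fun i : {i // p i} => t i₀ - t i) ∈ K} ≤ volume K := by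
  have : IsProbabilityMeasure ((volume : Measure ℝ).restrict (Set.Icc 0 1)) := ⟨by simp⟩
  rw [← measure_toMeasurable K]
  set K' := toMeasurable volume K
  let S : Set (({i // p i} → ℝ) × ({i // ¬ p i} → ℝ)) :=
    {q | (fun i => q.2 ⟨i₀, hi₀⟩ - q.1 i) ∈ K'}
  have hS : MeasurableSet S :=
    (measurable_pi_lambda _ fun i => by fun_prop) (measurableSet_toMeasurable volume K)
  have hmp := measurePreserving_piEquivPiSubtypeProd
    (fun _ : ι => (volume : Measure ℝ).restrict (Set.Icc 0 1)) p
  calc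
    _ ≤ Measure.pi (fun _ : ι => (volume : Measure ℝ).restrict (Set.Icc 0 1))
        (MeasurableEquiv.piEquivPiSubtypeProd (fun _ : ι => ℝ) p ⁻¹' S) :=
      measure_mono fun t ht => subset_toMeasurable volume K ht
    _ = _ := hmp.measure_preimage hS.nullMeasurableSet
    _ = _ := Measure.prod_apply_symm hS
    _ ≤ ∫⁻ _, volume K' ∂Measure.pi
          (fun _ : {i // ¬ p i} => (volume : Measure ℝ).restrict (Set.Icc 0 1)) := by
      refine lintegral_mono fun v => ?_
      rw [← Measure.restrict_pi_pi]
      refine (Measure.restrict_apply_le _ _).trans (le_of_eq ?_)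
      exact (Measure.measurePreserving_sub_left volume
        (fun _ : {i // p i} => v ⟨i₀, hi₀⟩)).measure_preimage
          (measurableSet_toMeasurable volume K).nullMeasurableSet
    _ = _ := by simp

theorem abs_log_sub_log_le {δ a b : ℝ} (hδ : 0 < δ) (ha : δ ≤ a) (hb : δ ≤ b) :
    |Real.log a - Real.log b| ≤ δ⁻¹ * |a - b| := by
  wlog hab : b ≤ a generalizing a b
  · rw [abs_sub_comm, abs_sub_comm a]
    exact this hb ha (le_of_not_ge hab)
  have hb0 := hδ.trans_le hb
  have ha0 := hδ.trans_le ha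
  rw [abs_of_nonneg (sub_nonneg.2 (Real.log_le_log hb0 hab)), abs_of_nonneg (sub_nonneg.2 hab),
    ← Real.log_div ha0.ne' hb0.ne']
  calc
    _ ≤ a / b - 1 := Real.log_le_sub_one_of_pos (by positivity)
    _ = b⁻¹ * (a - b) := by field_simp
    _ ≤ _ := by
      have := sub_nonneg.2 hab
      gcongr

/-- The translations `t ∈ [0, 1]^ℓ` of the logarithms of the coordinates that make all coordinates
indexed by `I` equal at some point of `A` have measure bounded by the Hausdorff measure of `A`. -/
theorem measure_setOf_exists_mul_eq_mul_le {ℓ k : ℕ} {δ : ℝ} (hδ : 0 < δ) {I : Finset (Fin ℓ)}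
    (hI : I.card = k + 1) {A : Set (EuclideanSpace ℝ (Fin ℓ))} (hA : ∀ x ∈ A, ∀ i ∈ I, δ ≤ x i) :
    Measure.pi (fun _ : Fin ℓ => (volume : Measure ℝ).restrict (Set.Icc 0 1))
      {t | ∃ x ∈ A, ∀ i ∈ I, ∀ j ∈ I, Real.exp (t i) * x i = Real.exp (t j) * x j} ≤
      ((2 * δ⁻¹).toNNReal : ENNReal) ^ (k : ℝ) * μH[(k : ℝ)] A := by
  obtain ⟨i₀, hi₀⟩ : I.Nonempty := Finset.card_pos.1 (by omega)
  let f : EuclideanSpace ℝ (Fin ℓ) → {i // i ∈ I.erase i₀} → ℝ :=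
    fun x i => Real.log (x i) - Real.log (x i₀)
  have hf : LipschitzOnWith (2 * δ⁻¹).toNNReal f A := by
    refine LipschitzOnWith.of_dist_le_mul fun x hx y hy => ?_
    rw [Real.coe_toNNReal _ (by positivity), dist_pi_le_iff (by positivity)]
    rintro ⟨i, hi⟩
    have key : ∀ j ∈ I, |Real.log (x j) - Real.log (y j)| ≤ δ⁻¹ * dist x y := fun j hj =>
      (abs_log_sub_log_le hδ (hA x hx j hj) (hA y hy j hj)).trans <| by
        gcongr
        simpa [Real.dist_eq] using PiLp.dist_apply_le x y j
    have h₁ := abs_le.1 (key i (Finset.mem_of_mem_erase hi))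
    have h₀ := abs_le.1 (key i₀ hi₀)
    rw [Real.dist_eq, abs_le]
    constructor <;> simp only [f] <;> linarith [h₁.1, h₁.2, h₀.1, h₀.2]
  have hcard : Fintype.card {i // i ∈ I.erase i₀} = k := by
    rw [Fintype.card_coe, Finset.card_erase_of_mem hi₀, hI]
    rfl
  calc
    _ ≤ Measure.pi (fun _ : Fin ℓ => (volume : Measure ℝ).restrict (Set.Icc 0 1))
        {t | (fun i : {i // i ∈ I.erase i₀} => t i₀ - t i) ∈ f '' A} := by
      refine measure_mono ?_
      rintro t ⟨x, hx, ht⟩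
      refine ⟨x, hx, funext fun i => ?_⟩
      have hi := Finset.mem_of_mem_erase i.2
      have h := congrArg Real.log (ht i hi i₀ hi₀)
      rw [Real.log_mul (Real.exp_pos _).ne' (hδ.trans_le (hA x hx i hi)).ne',
        Real.log_mul (Real.exp_pos _).ne' (hδ.trans_le (hA x hx i₀ hi₀)).ne',
        Real.log_exp, Real.log_exp] at h
      simp only [f]
      linarith
    _ ≤ volume (f '' A) := by
      convert pi_restrict_setOf_sub_mem_le (· ∈ I.erase i₀) i₀ (Finset.notMem_erase i₀ I) (f '' A)
    _ = μH[(k : ℝ)] (f '' A) := by rw [← hausdorffMeasure_pi_real, hcard]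
    _ ≤ _ := hf.hausdorffMeasure_image_le k.cast_nonneg

theorem sum_measure_inter_le {α ι : Type*} [MeasurableSpace α] (μ : Measure α) {E : Set α}
    (hE : MeasurableSet E) (s : Finset ι) {C : ι → Set α} (hC : ∀ i ∈ s, MeasurableSet (C i))
    {N : ℕ} (hN : ∀ x ∈ E, ∃ t : Finset ι, t.card ≤ N ∧ ∀ i ∈ s, x ∈ C i → i ∈ t) :
    ∑ i ∈ s, μ (E ∩ C i) ≤ N * μ E := by
  classical
  calc
    _ = ∑ i ∈ s, ∫⁻ x in E, (C i).indicator 1 x ∂μ := by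
      refine Finset.sum_congr rfl fun i hi => ?_
      rw [lintegral_indicator_one (hC i hi), Measure.restrict_apply (hC i hi), Set.inter_comm]
    _ = ∫⁻ x in E, ∑ i ∈ s, (C i).indicator 1 x ∂μ :=
      (lintegral_finsetSum s fun i hi => measurable_one.indicator (hC i hi)).symm
    _ ≤ ∫⁻ _ in E, N ∂μ := by
      refine setLIntegral_mono' hE fun x hx => ?_
      obtain ⟨t, ht, hst⟩ := hN x hx
      simp only [Set.indicator_apply, Pi.one_apply, Finset.sum_boole]
      refine Nat.cast_le.2 ((Finset.card_le_card fun i hi => ?_).trans ht)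
      rw [Finset.mem_filter] at hi
      exact hst i hi.1 hi.2
    _ = _ := by simp

theorem exists_forall_not_mul_eq_mul {ℓ k N : ℕ} {δ : ℝ} (hδ : 0 < δ)
    {E : Set (EuclideanSpace ℝ (Fin ℓ))} (hE : IsClosed E)
    (hsupp : ∀ x ∈ E, ∃ σ : Finset (Fin ℓ), σ.card ≤ N ∧ ∀ i ∉ σ, x i = 0)
    (hlt : ((2 * δ⁻¹).toNNReal : ENNReal) ^ (k : ℝ) * ((2 ^ N : ℕ) * μH[(k : ℝ)] E) < 1) :
    ∃ t : Fin ℓ → ℝ, (∀ i, t i ∈ Set.Icc (0 : ℝ) 1) ∧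
      ∀ I : Finset (Fin ℓ), I.card = k + 1 → ∀ x ∈ E, (∀ i ∈ I, δ ≤ x i) →
        ¬ ∀ i ∈ I, ∀ j ∈ I, Real.exp (t i) * x i = Real.exp (t j) * x j := by
  have : IsProbabilityMeasure ((volume : Measure ℝ).restrict (Set.Icc 0 1)) := ⟨by simp⟩
  set P := Measure.pi (fun _ : Fin ℓ => (volume : Measure ℝ).restrict (Set.Icc 0 1)) with hP
  let C : Finset (Fin ℓ) → Set (EuclideanSpace ℝ (Fin ℓ)) := fun I => {x | ∀ i ∈ I, δ ≤ x i}
  let B : Finset (Fin ℓ) → Set (Fin ℓ → ℝ) := fun I =>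
    {t | ∃ x ∈ E ∩ C I, ∀ i ∈ I, ∀ j ∈ I, Real.exp (t i) * x i = Real.exp (t j) * x j}
  let s : Finset (Finset (Fin ℓ)) := Finset.univ.powersetCard (k + 1)
  have hC : ∀ I, MeasurableSet (C I) := fun I => by
    refine IsClosed.measurableSet ?_
    simp only [C, Set.ofPred_forall]
    exact isClosed_iInter fun i => isClosed_iInter fun _ =>
      isClosed_le continuous_const (by fun_prop)
  have hB : P (⋃ I ∈ s, B I) < 1 := by
    refine lt_of_le_of_lt ?_ hlt
    calc
      _ ≤ ∑ I ∈ s, P (B I) := measure_biUnion_finset_le _ _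
      _ ≤ ∑ I ∈ s, ((2 * δ⁻¹).toNNReal : ENNReal) ^ (k : ℝ) * μH[(k : ℝ)] (E ∩ C I) :=
        Finset.sum_le_sum fun I hI => measure_setOf_exists_mul_eq_mul_le hδ
          (Finset.mem_powersetCard.1 hI).2 fun x hx => hx.2
      _ ≤ _ := by
        rw [← Finset.mul_sum]
        gcongr
        refine sum_measure_inter_le _ hE.measurableSet s (fun I _ => hC I) fun x hx => ?_
        obtain ⟨σ, hσ, hxσ⟩ := hsupp x hx
        refine ⟨σ.powerset, ?_, fun I _ hxI => ?_⟩
        · rw [Finset.card_powerset]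
          exact Nat.pow_le_pow_right two_pos hσ
        · refine Finset.mem_powerset.2 fun i hi => ?_
          by_contra h
          have := hxI i hi
          rw [hxσ i h] at this
          linarith
  have hcube : P (Set.univ.pi fun _ => Set.Icc (0 : ℝ) 1) = 1 := by
    rw [hP, Measure.pi_pi]
    simp
  obtain ⟨t, ht, htB⟩ := Set.not_subset.1 fun h => (hB.trans_le hcube.ge).not_ge (measure_mono h)
  refine ⟨t, fun i => ht i (Set.mem_univ i), fun I hI x hx hδx hbal => htB ?_⟩
  exact Set.mem_biUnion (Finset.mem_powersetCard.2 ⟨Finset.subset_univ I, hI⟩)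
    ⟨x, ⟨hx, hδx⟩, hbal⟩

section ExcessWeight

variable {ι : Type*} [Fintype ι] [DecidableEq ι]

/-- A weight of the index `i` that, for nonnegative `y`, is positive exactly when `y i` is positive
and among the `k` largest coordinates of `y`, strictly above the `(k + 1)`-st largest. -/
def excessWeight (k : ℕ) (y : ι → ℝ) (i : ι) : ℝ :=
  y i * ∏ I ∈ (Finset.univ.powersetCard (k + 1)).filter (i ∈ ·), ∑ j ∈ I, max (y i - y j) 0

theorem continuous_excessWeight (k : ℕ) (i : ι) :
    Continuous fun y : ι → ℝ => excessWeight k y i := by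
  unfold excessWeight
  fun_prop

theorem excessWeight_nonneg (k : ℕ) {y : ι → ℝ} {i : ι} (hy : 0 ≤ y i) :
    0 ≤ excessWeight k y i :=
  mul_nonneg hy <| Finset.prod_nonneg fun _ _ => Finset.sum_nonneg fun _ _ => le_max_right _ _

theorem excessWeight_eq_zero (k : ℕ) {y : ι → ℝ} {i : ι} (hy : y i = 0) :
    excessWeight k y i = 0 := by
  simp [excessWeight, hy]

theorem card_filter_excessWeight_ne_zero_le (k : ℕ) (y : ι → ℝ) :
    (Finset.univ.filter fun i => excessWeight k y i ≠ 0).card ≤ k := by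
  by_contra! h
  obtain ⟨I, hI, hcard⟩ := Finset.exists_subset_card_eq (Nat.succ_le_of_lt h)
  obtain ⟨i, hi, hmin⟩ := I.exists_min_image y (Finset.card_pos.1 (by omega))
  refine (Finset.mem_filter.1 (hI hi)).2 ?_
  refine mul_eq_zero_of_right _ (Finset.prod_eq_zero (i := I) ?_ ?_)
  · simp [hcard, hi]
  · exact Finset.sum_eq_zero fun j hj => max_eq_right (sub_nonpos.2 (hmin j hj))

theorem excessWeight_pos {k : ℕ} {y : ι → ℝ} {i : ι} (hy : 0 < y i) (hmax : ∀ j, y j ≤ y i)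
    (h : ∀ I : Finset ι, I.card = k + 1 → ¬ ∀ j ∈ I, y j = y i) : 0 < excessWeight k y i := by
  refine mul_pos hy (Finset.prod_pos fun I hI => ?_)
  rw [Finset.mem_filter, Finset.mem_powersetCard] at hI
  obtain ⟨j, hj, hne⟩ : ∃ j ∈ I, y j ≠ y i := by simpa using h I hI.1.2
  refine Finset.sum_pos' (fun _ _ => le_max_right _ _) ⟨j, hj, ?_⟩
  exact lt_max_of_lt_left (sub_pos.2 (lt_of_le_of_ne (hmax j) hne))

end ExcessWeight

theorem exists_inv_le_apply_of_mem_cellOf {ℓ N : ℕ} {σ : Finset (Fin ℓ)} (hσ : σ.card ≤ N)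
    {x : EuclideanSpace ℝ (Fin ℓ)} (hx : x ∈ cellOf σ) : ∃ i, (N : ℝ)⁻¹ ≤ x i := by
  obtain ⟨h₁, h₂, h₃⟩ := mem_cellOf_iff.1 hx
  have hsum : ∑ i ∈ σ, x i = 1 := by
    rw [← h₃]
    exact Finset.sum_subset (Finset.subset_univ _) fun i _ hi => h₂ i hi
  have hne : σ.Nonempty := by
    rw [Finset.nonempty_iff_ne_empty]
    rintro rfl
    simp at hsum
  have hpos : (0 : ℝ) < σ.card := Nat.cast_pos.2 hne.card_pos
  obtain ⟨i, -, hi⟩ := Finset.exists_le_of_sum_le (s := σ) (f := fun _ => (σ.card : ℝ)⁻¹)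
    (g := fun i => x i) hne (by simp [hsum, hpos.ne'])
  exact ⟨i, (inv_anti₀ hpos (Nat.cast_le.2 hσ)).trans hi⟩

/-- The normalization to the standard simplex of a nonnegative vector. -/
noncomputable def simplexNormalize {ℓ : ℕ} (g : Fin ℓ → ℝ) : EuclideanSpace ℝ (Fin ℓ) :=
  WithLp.toLp 2 fun i => g i / ∑ j, g j

theorem simplexNormalize_mem_cellOf {ℓ : ℕ} {σ : Finset (Fin ℓ)} {g : Fin ℓ → ℝ}
    (hg : ∀ i, 0 ≤ g i) (hσ : ∀ i ∉ σ, g i = 0) (hpos : 0 < ∑ i, g i) : simplexNormalize g ∈ cellOf σ := by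
  refine mem_cellOf_iff.2 ⟨fun i => div_nonneg (hg i) hpos.le, fun i hi => ?_, ?_⟩
  · simp [simplexNormalize, hσ i hi]
  · simp only [simplexNormalize]
    rw [← Finset.sum_div, div_self hpos.ne']

theorem ContinuousOn.simplexNormalize {X : Type*} [TopologicalSpace X] {ℓ : ℕ} {s : Set X}
    {g : X → Fin ℓ → ℝ} (hg : ContinuousOn g s) (hpos : ∀ x ∈ s, 0 < ∑ i, g x i) :
    ContinuousOn (fun x => simplexNormalize (g x)) s := by
  have hi := continuousOn_pi.1 hg
  refine (PiLp.continuous_toLp 2 _).comp_continuousOn (continuousOn_pi.2 fun i => ?_)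
  exact (hi i).div (continuousOn_finsetSum _ fun j _ => hi j) fun x hx => (hpos x hx).ne'

/-- A map to the `(k - 1)`-skeleton on `E` exists as soon as the coordinates can be rescaled so that
no point of `E` has its `k + 1` largest rescaled coordinates all equal. -/
theorem exists_map_to_skeleton {ℓ k N : ℕ} (hk : 1 ≤ k) {F : Finset (Finset (Fin ℓ))}
    (hF : ∀ σ ∈ F, ∀ τ ⊆ σ, τ.Nonempty → τ ∈ F) (hN : ∀ σ ∈ F, σ.card ≤ N)
    {E : Set (EuclideanSpace ℝ (Fin ℓ))} (hE : IsClosed E) (hne : E.Nonempty)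
    (hEF : E ⊆ realization F) {t : Fin ℓ → ℝ} (ht : ∀ i, t i ∈ Set.Icc (0 : ℝ) 1)
    (hbal : ∀ I : Finset (Fin ℓ), I.card = k + 1 → ∀ x ∈ E, (∀ i ∈ I, (3 * N : ℝ)⁻¹ ≤ x i) →
      ¬ ∀ i ∈ I, ∀ j ∈ I, Real.exp (t i) * x i = Real.exp (t j) * x j) :
    ∃ p : EuclideanSpace ℝ (Fin ℓ) → EuclideanSpace ℝ (Fin ℓ),
      ContinuousOn p (realization F) ∧
      (∀ σ ∈ F, Set.MapsTo p (cellOf σ) (cellOf σ)) ∧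
      p '' E ⊆ skeleton F (k - 1) := by
  let y : EuclideanSpace ℝ (Fin ℓ) → Fin ℓ → ℝ := fun x i => Real.exp (t i) * x i
  let g : EuclideanSpace ℝ (Fin ℓ) → Fin ℓ → ℝ := fun x i =>
    excessWeight k (y x) i + infDist x E * y x i
  have hy : Continuous y := by fun_prop
  have hg : Continuous g := continuous_pi fun i =>
    ((continuous_excessWeight k i).comp hy).add
      ((continuous_infDist_pt E).mul ((continuous_apply i).comp hy))
  have hy_nonneg : ∀ {x}, (∀ i, 0 ≤ x i) → ∀ i, 0 ≤ y x i := fun hx i =>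
    mul_nonneg (Real.exp_pos _).le (hx i)
  have hg_nonneg : ∀ {x}, (∀ i, 0 ≤ x i) → ∀ i, 0 ≤ g x i := fun hx i =>
    add_nonneg (excessWeight_nonneg k (hy_nonneg hx i))
      (mul_nonneg infDist_nonneg (hy_nonneg hx i))
  have hg_zero : ∀ {x i}, x i = 0 → g x i = 0 := fun {x i} hx => by
    have : y x i = 0 := by simp [y, hx]
    simp [g, this, excessWeight_eq_zero k this]
  have hpos : ∀ σ ∈ F, ∀ x ∈ cellOf σ, 0 < ∑ i, g x i := by
    intro σ hσ x hx
    have hx₀ := (mem_cellOf_iff.1 hx).1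
    obtain ⟨m, hm⟩ := exists_inv_le_apply_of_mem_cellOf (hN σ hσ) hx
    have hNpos : (0 : ℝ) < N := by
      refine Nat.cast_pos.2 (Nat.pos_of_ne_zero fun h => ?_)
      have hσ0 : σ = ∅ := Finset.card_eq_zero.1 (by have := hN σ hσ; omega)
      simp [hσ0, cellOf] at hx
    obtain ⟨i, -, hi⟩ := Finset.univ.exists_max_image (y x) ⟨m, Finset.mem_univ m⟩
    have hyi : (N : ℝ)⁻¹ ≤ y x i := by
      refine (hm.trans ?_).trans (hi m (Finset.mem_univ m))
      exact le_mul_of_one_le_left (hx₀ m) (Real.one_le_exp (ht m).1)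
    have hyi₀ : 0 < y x i := (inv_pos.2 hNpos).trans_le hyi
    refine Finset.sum_pos' (fun j _ => hg_nonneg hx₀ j) ⟨i, Finset.mem_univ i, ?_⟩
    by_cases hxE : x ∈ E
    · refine add_pos_of_pos_of_nonneg ?_ (mul_nonneg infDist_nonneg hyi₀.le)
      refine excessWeight_pos hyi₀ (fun j => hi j (Finset.mem_univ j)) fun I hI hIi => ?_
      refine hbal I hI x hxE (fun j hj => ?_) fun j hj l hl => (hIi j hj).trans (hIi l hl).symm
      have h₁ : (N : ℝ)⁻¹ ≤ 3 * x j := by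
        rw [← hIi j hj] at hyi
        refine hyi.trans (mul_le_mul_of_nonneg_right ?_ (hx₀ j))
        exact (Real.exp_le_exp.2 (ht j).2).trans Real.exp_one_lt_three.le
      rw [mul_inv]
      linarith
    · have hdist : 0 < infDist x E := (hE.notMem_iff_infDist_pos hne).1 hxE
      exact add_pos_of_nonneg_of_pos (excessWeight_nonneg k hyi₀.le) (mul_pos hdist hyi₀)
  have hmem : ∀ {x}, x ∈ realization F → ∃ σ ∈ F, x ∈ cellOf σ := fun {x} hx => by
    simpa [realization] using hx
  refine ⟨fun x => simplexNormalize (g x), hg.continuousOn.simplexNormalize fun x hx => ?_,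
    fun σ hσ x hx => ?_, ?_⟩
  · obtain ⟨σ, hσ, hxσ⟩ := hmem hx
    exact hpos σ hσ x hxσ
  · obtain ⟨h₁, h₂, -⟩ := mem_cellOf_iff.1 hx
    exact simplexNormalize_mem_cellOf (hg_nonneg h₁) (fun i hi => hg_zero (h₂ i hi))
      (hpos σ hσ x hx)
  · rintro _ ⟨x, hxE, rfl⟩
    obtain ⟨σ, hσ, hx⟩ := hmem (hEF hxE)
    obtain ⟨h₁, h₂, -⟩ := mem_cellOf_iff.1 hx
    have hgx : g x = excessWeight k (y x) := by
      funext i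
      simp [g, infDist_zero_of_mem hxE]
    have hsum := hpos σ hσ x hx
    set τ := Finset.univ.filter fun i => excessWeight k (y x) i ≠ 0 with hτ
    have hτcard : τ.card ≤ k := card_filter_excessWeight_ne_zero_le k (y x)
    have hτσ : τ ⊆ σ := fun i hi => by
      by_contra h
      exact (Finset.mem_filter.1 hi).2 (hgx ▸ hg_zero (h₂ i h))
    have hτne : τ.Nonempty := by
      obtain ⟨i, -, hi⟩ := Finset.exists_ne_zero_of_sum_ne_zero hsum.ne'
      exact ⟨i, Finset.mem_filter.2 ⟨Finset.mem_univ i, hgx ▸ hi⟩⟩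
    refine Set.mem_biUnion (x := τ) ?_
      (simplexNormalize_mem_cellOf (hg_nonneg h₁) (fun i hi => ?_) hsum)
    · exact Finset.mem_coe.2 (Finset.mem_filter.2 ⟨hF σ hσ τ hτσ hτne, by omega⟩)
    · rw [hgx]
      simpa [hτ] using hi

/-- **Proposition 3.3.** For each `1 ≤ k ≤ n` there is `c_{k,n} > 0` such that: if `𝒮` is
a standard simplicial complex of dimension at most `n` and `E ⊆ 𝒮` is closed with
`H_k(E) ≤ c_{k,n}`, then there is a continuous map `p : 𝒮 → 𝒮` with `p(σ) ⊆ σ` for each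
sub-simplex `σ` and `p(E) ⊆ 𝒮^{(k-1)}`. -/
theorem complex_projection (k n : ℕ) (hk : 1 ≤ k) (hkn : k ≤ n) :
    ∃ c : ℝ, 0 < c ∧
      ∀ (ℓ : ℕ), 1 ≤ ℓ → ∀ F : Finset (Finset (Fin ℓ)),
        F.Nonempty → (∀ σ ∈ F, σ.Nonempty) →
        (∀ σ ∈ F, ∀ τ ⊆ σ, τ.Nonempty → τ ∈ F) →
        (∀ σ ∈ F, σ.card ≤ n + 1) →
        ∀ E : Set (EuclideanSpace ℝ (Fin ℓ)),
          IsClosed E → E ⊆ realization F → μH[(k : ℝ)] E ≤ ENNReal.ofReal c →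
          ∃ p : EuclideanSpace ℝ (Fin ℓ) → EuclideanSpace ℝ (Fin ℓ),
            ContinuousOn p (realization F) ∧
            (∀ σ ∈ F, Set.MapsTo p (cellOf σ) (cellOf σ)) ∧
            p '' E ⊆ skeleton F (k - 1) := by
  have hM : (0 : ℝ) < 2 * ((3 * (n + 1 : ℕ) : ℝ)⁻¹)⁻¹ := by positivity
  set M : ℝ := 2 * ((3 * (n + 1 : ℕ) : ℝ)⁻¹)⁻¹
  refine ⟨(2 * (M ^ k * 2 ^ (n + 1)))⁻¹, by positivity, ?_⟩
  intro ℓ _ F _ _ hF hcard E hE hEF hmeas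
  rcases E.eq_empty_or_nonempty with rfl | hne
  · exact ⟨id, continuousOn_id, fun σ _ x hx => hx, by simp⟩
  have hlt : (M.toNNReal : ENNReal) ^ (k : ℝ) * ((2 ^ (n + 1) : ℕ) * μH[(k : ℝ)] E) < 1 := by
    calc
      _ ≤ (M.toNNReal : ENNReal) ^ (k : ℝ) *
          ((2 ^ (n + 1) : ℕ) * ENNReal.ofReal (2 * (M ^ k * 2 ^ (n + 1)))⁻¹) := by gcongr
      _ = ENNReal.ofReal (M ^ k * (2 ^ (n + 1) * (2 * (M ^ k * 2 ^ (n + 1)))⁻¹)) := by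
        rw [ENNReal.ofReal_mul (by positivity), ENNReal.ofReal_mul (by positivity),
          ENNReal.ofReal_pow hM.le, ENNReal.ofReal_pow zero_le_two, ENNReal.rpow_natCast]
        simp [ENNReal.ofReal]
      _ = ENNReal.ofReal 2⁻¹ := by
        congr 1
        field_simp
      _ < 1 := by
        rw [← ENNReal.ofReal_one]
        exact (ENNReal.ofReal_lt_ofReal_iff one_pos).2 (by norm_num)
  obtain ⟨t, ht, hbal⟩ := exists_forall_not_mul_eq_mul (by positivity) hE (fun x hx => by
    obtain ⟨σ, hσ, hxσ⟩ : ∃ σ ∈ F, x ∈ cellOf σ := by simpa [realization] using hEF hx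
    exact ⟨σ, hcard σ hσ, (mem_cellOf_iff.1 hxσ).2.1⟩) hlt
  exact exists_map_to_skeleton hk hF hcard hE hne hEF ht hbal
end

section
/- Let (M,d) be a compact metric space that is D-doubling, and let ε > 0. Then there exists a finite open cover U_1,…,U_k of M such that: (i) diam(U_i) ≤ ε for each i; (ii) for every x ∈ M the ball B(x, ε/4) is contained in some U_i; and (iii) every point of M belongs to at most D of the sets U_i. -/
open Metric

/-- In a compact space, a set whose distinct points are at distance at least `δ > 0` from each
other is finite. -/
theorem finite_of_pairwise_le_dist {M : Type*} [PseudoMetricSpace M] [CompactSpace M] {δ : ℝ}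
    (hδ : 0 < δ) {s : Set M} (hs : s.Pairwise fun a b => δ ≤ dist a b) : s.Finite := by
  obtain ⟨t, -, ht, hcov⟩ := finite_cover_balls_of_compact (isCompact_univ (X := M)) (half_pos hδ)
  have hnear : ∀ x : M, ∃ y ∈ t, dist x y < δ / 2 := fun x => by
    simpa using hcov (Set.mem_univ x)
  choose f hft hf using hnear
  refine Set.Finite.of_finite_image (ht.subset (Set.image_subset_iff.2 fun x _ => hft x))
    (f := f) fun a ha b hb hab => ?_
  by_contra hne
  have hb' := hf b
  rw [← hab] at hb'
  linarith [hs ha hb hne, dist_triangle_right a b (f a), hf a]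

/-- A compact space contains a finite `δ`-separated set whose open `δ`-balls cover the space. -/
theorem exists_finset_pairwise_le_dist_forall_exists_dist_lt (M : Type*) [PseudoMetricSpace M]
    [CompactSpace M] {δ : ℝ} (hδ : 0 < δ) :
    ∃ s : Finset M, (s : Set M).Pairwise (fun a b => δ ≤ dist a b) ∧
      ∀ x, ∃ y ∈ s, dist x y < δ := by
  obtain ⟨s, hs⟩ := zorn_subset {s : Set M | s.Pairwise fun a b => δ ≤ dist a b}
    fun c hc hchain => ⟨⋃₀ c, (Set.pairwise_sUnion hchain.directedOn).2 fun a ha => hc ha,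
      fun a ha => Set.subset_sUnion_of_mem ha⟩
  have hsep : s.Pairwise fun a b => δ ≤ dist a b := hs.prop
  refine ⟨(finite_of_pairwise_le_dist hδ hsep).toFinset, by simpa using hsep, fun x => ?_⟩
  by_contra! hx
  simp only [Set.Finite.mem_toFinset] at hx
  have hins : (insert x s).Pairwise fun a b => δ ≤ dist a b :=
    hsep.insert fun b hb _ => ⟨hx b hb, dist_comm x b ▸ hx b hb⟩
  have hxs : x ∈ s := hs.le_of_ge hins (Set.subset_insert x s) (Set.mem_insert x s)
  have := hx x hxs
  rw [dist_self] at this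
  linarith

/-- **Lemma 4.1.** A compact `D`-doubling metric space admits, for each `ε > 0`, a finite
open cover by sets of diameter at most `ε`, with Lebesgue number at least `ε/4`, and with
multiplicity at most `D`. -/
theorem good_cover_exists (D : ℕ) (hD : 1 ≤ D) (M : Type) [MetricSpace M] [CompactSpace M]
    (hdub : IsDoubling D M) (ε : ℝ) (hε : 0 < ε) :
    ∃ (k : ℕ) (U : Fin k → Set M),
      (∀ i, IsOpen (U i)) ∧
      (⋃ i, U i) = Set.univ ∧
      (∀ i, diam (U i) ≤ ε) ∧
      (∀ x : M, ∃ i, ball x (ε / 4) ⊆ U i) ∧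
      (∀ x : M, {i : Fin k | x ∈ U i}.ncard ≤ D) := by
  classical
  obtain ⟨s, hsep, hnet⟩ :=
    exists_finset_pairwise_le_dist_forall_exists_dist_lt M (δ := ε / 4) (by positivity)
  let c : Fin s.card → M := fun i => s.equivFin.symm i
  have hc : Function.Injective c := Subtype.val_injective.comp s.equivFin.symm.injective
  have hcs : ∀ i, c i ∈ s := fun i => (s.equivFin.symm i).2
  have hleb : ∀ x : M, ∃ i, ball x (ε / 4) ⊆ ball (c i) (ε / 2) := fun x => by
    obtain ⟨y, hy, hxy⟩ := hnet x
    refine ⟨s.equivFin ⟨y, hy⟩, ball_subset_ball' ?_⟩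
    simp only [c, Equiv.symm_apply_apply]
    linarith
  refine ⟨s.card, fun i => ball (c i) (ε / 2), fun i => isOpen_ball, ?_, fun i => ?_, hleb,
    fun x => ?_⟩
  · refine Set.eq_univ_of_forall fun x => ?_
    obtain ⟨i, hi⟩ := hleb x
    exact Set.mem_iUnion.2 ⟨i, hi (mem_ball_self (by positivity))⟩
  · exact (diam_ball (by positivity)).trans (by linarith)
  · have hcard := hdub x (ε / 2) ((Finset.univ.filter fun i => x ∈ ball (c i) (ε / 2)).image c)
      (by
        intro y hy
        simp only [Finset.coe_image, Finset.coe_filter, Finset.mem_univ, true_and] at hy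
        obtain ⟨i, hi, rfl⟩ := hy
        exact mem_ball_comm.1 hi)
      (by
        intro a ha b hb hab
        obtain ⟨i, -, rfl⟩ := Finset.mem_image.1 ha
        obtain ⟨j, -, rfl⟩ := Finset.mem_image.1 hb
        linarith [hsep (hcs i) (hcs j) hab])
    rw [Finset.card_image_of_injective _ hc] at hcard
    simpa [Set.ncard_eq_toFinset_card'] using hcard
end

section
/- Let (M,d) be a compact metric space and let U_1,…,U_ℓ be a finite open cover of M such that for every x ∈ M the ball B(x,δ) is contained in some U_i (δ > 0), and every point of M belongs to at most N of the sets U_i. Then there exist continuous functions f_1,…,f_ℓ : M → [0,1] such that each f_i is Lipschitz with constant (4N+2)/δ, the support of each f_i (the closure of {x : f_i(x) ≠ 0}) is contained in U_i, and f_1(x) + ⋯ + f_ℓ(x) = 1 for every x ∈ M. -/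
open Metric

/-- A `1`-Lipschitz bump function subordinate to `U`: it is at least `δ / 2` at the centre of each
`δ`-ball inside `U`, and the closure of its support lies in `U`. -/
lemma exists_lipschitz_bump {M : Type*} [MetricSpace M] (U : Set M) {δ : ℝ}
    (hδ : 0 < δ) :
    ∃ g : M → ℝ, (∀ x, 0 ≤ g x) ∧ (∀ x y, |g x - g y| ≤ dist x y) ∧
      (∀ x, ball x δ ⊆ U → δ / 2 ≤ g x) ∧ closure {x | g x ≠ 0} ⊆ U := by
  by_cases hne : (Uᶜ).Nonempty
  · refine ⟨fun x => max (infDist x Uᶜ - δ / 2) 0, fun x => le_max_right _ _, fun x y => ?_,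
      fun x hx => ?_, ?_⟩
    · refine (abs_max_sub_max_le_abs _ _ _).trans ?_
      rw [sub_sub_sub_cancel_right, ← Real.dist_eq]
      simpa using (lipschitz_infDist_pt Uᶜ).dist_le_mul x y
    · have h : δ ≤ infDist x Uᶜ := (le_infDist hne).2 fun y hy => by
        by_contra! hlt
        exact hy (hx (mem_ball'.2 hlt))
      exact le_max_of_le_left (by linarith)
    · have hclosed : IsClosed {x | δ / 2 ≤ infDist x Uᶜ} :=
        isClosed_le continuous_const (continuous_infDist_pt _)
      have hsub : {x | max (infDist x Uᶜ - δ / 2) 0 ≠ 0} ⊆ {x | δ / 2 ≤ infDist x Uᶜ} := by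
        intro x hx
        by_contra hlt
        simp only [Set.mem_ofPred_eq, not_le] at hlt
        exact hx (max_eq_right (by linarith))
      intro x hx
      have hx' : δ / 2 ≤ infDist x Uᶜ := closure_minimal hsub hclosed hx
      by_contra hxU
      have h0 : infDist x Uᶜ = 0 := infDist_zero_of_mem hxU
      linarith
  · have hU' : U = Set.univ := by
      rwa [Set.not_nonempty_iff_eq_empty, Set.compl_empty_iff] at hne
    exact ⟨fun _ => δ, fun _ => hδ.le, fun x y => by simp, fun _ _ => by linarith,
      by simp [hU']⟩

/-- If at most `N` of the nonnegative `1`-Lipschitz functions `g i` are nonzero at each point, then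
their sum is `2 * N`-Lipschitz. -/
lemma abs_sum_sub_sum_le_of_ncard_support_le {M ι : Type*} [MetricSpace M] [Fintype ι]
    {g : ι → M → ℝ} (hg : ∀ i x y, |g i x - g i y| ≤ dist x y) {N : ℕ}
    (hN : ∀ x, {i | g i x ≠ 0}.ncard ≤ N) (x y : M) :
    |∑ i, g i x - ∑ i, g i y| ≤ 2 * N * dist x y := by
  classical
  have hcard (z : M) : (Finset.univ.filter fun i => g i z ≠ 0).card ≤ N := by
    rw [← Set.ncard_coe_finset]
    simpa using hN z
  set s := (Finset.univ.filter fun i => g i x ≠ 0) ∪ (Finset.univ.filter fun i => g i y ≠ 0)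
    with hs
  have hscard : (s.card : ℝ) ≤ 2 * N := by
    have := (Finset.card_union_le _ _).trans (add_le_add (hcard x) (hcard y))
    rw [← hs] at this
    exact_mod_cast this.trans (by omega)
  rw [← Finset.sum_sub_distrib]
  calc |∑ i, (g i x - g i y)| = |∑ i ∈ s, (g i x - g i y)| := by
        rw [Finset.sum_subset (Finset.subset_univ s)]
        intro i _ hi
        simp only [hs, Finset.mem_union, Finset.mem_filter, Finset.mem_univ, true_and, not_or,
          not_not] at hi
        rw [hi.1, hi.2, sub_zero]
    _ ≤ ∑ i ∈ s, |g i x - g i y| := Finset.abs_sum_le_sum_abs _ _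
    _ ≤ s.card * dist x y := by
        simpa using Finset.sum_le_sum fun i (_ : i ∈ s) => hg i x y
    _ ≤ 2 * N * dist x y := by gcongr

/-- Normalizing a summand `a` of `s` (and `b` of `t`) is Lipschitz when the totals are bounded
below. -/
lemma abs_div_sub_div_le {a b s t c D E : ℝ} (hc : 0 < c) (hs : c ≤ s) (ht : 0 < t)
    (hb : 0 ≤ b) (hbt : b ≤ t) (hab : |a - b| ≤ D) (hst : |s - t| ≤ E) :
    |a / s - b / t| ≤ (D + E) / c := by
  have hs0 : 0 < s := hc.trans_le hs
  have hEq : a / s - b / t = ((a - b) - b / t * (s - t)) / s := by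
    field_simp
    ring
  have hbt1 : |b / t| ≤ 1 := by
    rw [abs_of_nonneg (div_nonneg hb ht.le)]
    exact (div_le_one ht).2 hbt
  have hnum : |(a - b) - b / t * (s - t)| ≤ D + E := by
    refine (abs_sub _ _).trans (add_le_add hab ?_)
    rw [abs_mul]
    exact (mul_le_of_le_one_left (abs_nonneg _) hbt1).trans hst
  rw [hEq, abs_div, abs_of_pos hs0]
  exact div_le_div₀ ((abs_nonneg _).trans hnum) hnum hc hs

/-- **Lipschitz partition of unity.** Let `M` be a compact metric space with a finite open
cover `U₁, …, U_ℓ` having Lebesgue number `δ > 0` and multiplicity at most `N`. Then there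
are functions `fᵢ : M → [0,1]`, each `(4N+2)/δ`-Lipschitz with support contained in `Uᵢ`,
with `∑ᵢ fᵢ = 1`. -/
theorem lipschitz_partition_of_unity (M : Type) [MetricSpace M] [CompactSpace M]
    (ℓ : ℕ) (U : Fin ℓ → Set M) (hopen : ∀ i, IsOpen (U i))
    (hcov : (⋃ i, U i) = Set.univ)
    (δ : ℝ) (hδ : 0 < δ) (hLeb : ∀ x : M, ∃ i, ball x δ ⊆ U i)
    (N : ℕ) (hmult : ∀ x : M, {i : Fin ℓ | x ∈ U i}.ncard ≤ N) :
    ∃ f : Fin ℓ → M → ℝ,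
      (∀ i x, f i x ∈ Set.Icc (0 : ℝ) 1) ∧
      (∀ i, LipschitzWith (Real.toNNReal ((4 * N + 2) / δ)) (f i)) ∧
      (∀ i, closure {x | f i x ≠ 0} ⊆ U i) ∧
      (∀ x, ∑ i, f i x = 1) := by
  choose g hg0 hgLip hgδ hgU using fun i => exists_lipschitz_bump (U i) hδ
  have hle (i : Fin ℓ) (x : M) : g i x ≤ ∑ j, g j x :=
    Finset.single_le_sum (f := fun j => g j x) (fun j _ => hg0 j x) (Finset.mem_univ i)
  have hδS (x : M) : δ / 2 ≤ ∑ j, g j x := by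
    obtain ⟨i, hi⟩ := hLeb x
    exact (hgδ i x hi).trans (hle i x)
  have hS (x : M) : 0 < ∑ j, g j x := (half_pos hδ).trans_le (hδS x)
  have hN (x : M) : {i | g i x ≠ 0}.ncard ≤ N :=
    (Set.ncard_le_ncard (fun i hi => hgU i (subset_closure hi)) (Set.toFinite _)).trans (hmult x)
  refine ⟨fun i x => g i x / ∑ j, g j x, fun i x => ⟨div_nonneg (hg0 i x) (hS x).le,
    (div_le_one (hS x)).2 (hle i x)⟩, fun i => ?_, fun i => ?_, fun x => ?_⟩
  · refine LipschitzWith.of_dist_le_mul fun x y => ?_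
    rw [Real.coe_toNNReal _ (by positivity), Real.dist_eq]
    refine (abs_div_sub_div_le (half_pos hδ) (hδS x) (hS y) (hg0 i y) (hle i y) (hgLip i x y)
      (abs_sum_sub_sum_le_of_ncard_support_le hgLip hN x y)).trans_eq ?_
    field_simp
    ring
  · refine (closure_mono fun x hx => ?_).trans (hgU i)
    exact fun h0 => hx (by simp [h0])
  · rw [← Finset.sum_div, div_self (hS x).ne']
end

section
/- Let (M,d) be a compact metric space and let U_1,…,U_ℓ be a finite open cover of M such that for every x ∈ M the ball B(x,δ) is contained in some U_i (δ > 0), and every point of M belongs to at most N of the sets U_i. Then there exists a map f : M → ℝ^ℓ that is Lipschitz with constant (8N² + 4N)/δ (with respect to the Euclidean metric on ℝ^ℓ) and satisfies f(x) ∈ conv{e_i : 1 ≤ i ≤ ℓ, x ∈ U_i} for every x ∈ M, where e_1,…,e_ℓ are the standard basis vectors of ℝ^ℓ. In particular, f maps M into the nerve of the cover, i.e., into the union of the sets conv{e_{i_1},…,e_{i_m}} over all index sets with U_{i_1} ∩ ⋯ ∩ U_{i_m} ≠ ∅. -/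
open Metric

/-- The nerve of a finite open cover `U₁, …, U_ℓ` of `M`: the union of the convex hulls
`conv{e_{i₁}, …, e_{iₘ}}` over all index sets with `U_{i₁} ∩ ⋯ ∩ U_{iₘ} ≠ ∅`. -/
noncomputable def nerve {M : Type*} {ℓ : ℕ} (U : Fin ℓ → Set M) :
    Set (EuclideanSpace ℝ (Fin ℓ)) :=
  ⋃ σ ∈ {σ : Finset (Fin ℓ) | σ.Nonempty ∧ (⋂ i ∈ σ, U i).Nonempty}, cellOf σ

open Classical in
/-- The distance to the complement of `V`, truncated at `δ`; it is `δ` when `V` is everything. -/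
noncomputable def truncDistCompl {M : Type*} [PseudoMetricSpace M] (δ : ℝ) (V : Set M) (x : M) : ℝ :=
  if Vᶜ.Nonempty then min δ (infDist x Vᶜ) else δ

section TruncDistCompl

variable {M : Type*} [PseudoMetricSpace M] {δ : ℝ} {V : Set M} {x : M}

theorem truncDistCompl_nonneg (hδ : 0 ≤ δ) : 0 ≤ truncDistCompl δ V x := by
  unfold truncDistCompl
  split_ifs
  · exact le_min hδ infDist_nonneg
  · exact hδ

theorem truncDistCompl_of_notMem (hδ : 0 ≤ δ) (hx : x ∉ V) : truncDistCompl δ V x = 0 := by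
  have hx' : x ∈ Vᶜ := hx
  rw [truncDistCompl, if_pos ⟨x, hx'⟩, infDist_zero_of_mem hx', min_eq_right hδ]

theorem truncDistCompl_of_ball_subset (h : ball x δ ⊆ V) : truncDistCompl δ V x = δ := by
  unfold truncDistCompl
  split_ifs with hV
  · refine min_eq_left ((le_infDist hV).2 fun y hy => ?_)
    by_contra! hlt
    exact hy (h (mem_ball'.2 hlt))
  · rfl

theorem abs_truncDistCompl_sub_le (δ : ℝ) (V : Set M) (x y : M) :
    |truncDistCompl δ V x - truncDistCompl δ V y| ≤ dist x y := by
  unfold truncDistCompl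
  split_ifs
  · have h := (lipschitz_infDist_pt Vᶜ).const_min δ
    simpa [Real.dist_eq] using h.dist_le_mul x y
  · simp

end TruncDistCompl

theorem EuclideanSpace.norm_le_sum_abs {ι : Type*} [Fintype ι] (v : EuclideanSpace ℝ ι) :
    ‖v‖ ≤ ∑ i, |v i| := by
  rw [EuclideanSpace.norm_eq]
  refine Real.sqrt_le_iff.2 ⟨Finset.sum_nonneg fun i _ => abs_nonneg _, ?_⟩
  exact Finset.sum_sq_le_sq_sum_of_nonneg fun i _ => norm_nonneg (v i)

/-- Normalising nonnegative vectors of mass at least `δ` is `2 / δ`-Lipschitz for the `ℓ¹` norm. -/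
theorem sum_abs_div_sum_sub_le {ι : Type*} [Fintype ι] {a b : ι → ℝ} {δ : ℝ} (hδ : 0 < δ)
    (hb : ∀ i, 0 ≤ b i) (hsa : δ ≤ ∑ i, a i) (hsb : δ ≤ ∑ i, b i) :
    ∑ i, |a i / ∑ j, a j - b i / ∑ j, b j| ≤ 2 * (∑ i, |a i - b i|) / δ := by
  set S := ∑ j, a j with hS
  set T := ∑ j, b j with hT
  set D := ∑ i, |a i - b i|
  have hSpos : 0 < S := hδ.trans_le hsa
  have hTpos : 0 < T := hδ.trans_le hsb
  have hD : 0 ≤ D := Finset.sum_nonneg fun i _ => abs_nonneg _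
  have hST : |T - S| ≤ D := by
    rw [abs_sub_comm, hS, hT, ← Finset.sum_sub_distrib]
    exact Finset.abs_sum_le_sum_abs _ _
  have hpt (i : ι) : |a i / S - b i / T| ≤ |a i - b i| / S + b i * (D / (S * T)) := by
    have heq : a i / S - b i / T = (a i - b i) / S + b i * ((T - S) / (S * T)) := by
      field_simp
      ring
    rw [heq]
    refine (abs_add_le _ _).trans ?_
    rw [abs_div, abs_mul, abs_div, abs_of_pos hSpos, abs_of_nonneg (hb i),
      abs_of_pos (mul_pos hSpos hTpos)]
    have := hb i
    gcongr
  calc ∑ i, |a i / S - b i / T|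
      ≤ ∑ i, (|a i - b i| / S + b i * (D / (S * T))) := Finset.sum_le_sum fun i _ => hpt i
    _ = D / S + T * (D / (S * T)) := by
      rw [Finset.sum_add_distrib, ← Finset.sum_div, ← Finset.sum_mul]
    _ = 2 * D / S := by
      field_simp
      ring
    _ ≤ 2 * D / δ := by gcongr

/-- A family of functions, each `1`-Lipschitz and supported in a set of a cover of multiplicity
at most `N`, is `2 * N`-Lipschitz for the `ℓ¹` norm. -/
theorem sum_abs_sub_le_of_multiplicity {M ι : Type*} [PseudoMetricSpace M] [Fintype ι]
    {U : ι → Set M} {g : ι → M → ℝ} {N : ℕ} (hmult : ∀ x, {i | x ∈ U i}.ncard ≤ N)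
    (hg : ∀ i x, x ∉ U i → g i x = 0) (hlip : ∀ i x y, |g i x - g i y| ≤ dist x y) (x y : M) :
    ∑ i, |g i x - g i y| ≤ 2 * N * dist x y := by
  classical
  have hcard (z : M) : (Finset.univ.filter fun i => z ∈ U i).card ≤ N := by
    simpa [Set.ncard_eq_toFinset_card'] using hmult z
  set s := (Finset.univ.filter fun i => x ∈ U i) ∪ Finset.univ.filter fun i => y ∈ U i with hs
  have hsum : ∑ i, |g i x - g i y| = ∑ i ∈ s, |g i x - g i y| := by
    refine (Finset.sum_subset (Finset.subset_univ s) fun i _ hi => ?_).symm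
    simp only [hs, Finset.mem_union, Finset.mem_filter_univ, not_or] at hi
    simp [hg i x hi.1, hg i y hi.2]
  have hscard : (s.card : ℝ) ≤ 2 * N := by
    have h := Finset.card_union_le (Finset.univ.filter fun i => x ∈ U i)
      (Finset.univ.filter fun i => y ∈ U i)
    have hx := hcard x
    have hy := hcard y
    have : s.card ≤ 2 * N := h.trans (by omega)
    exact_mod_cast this
  rw [hsum]
  calc ∑ i ∈ s, |g i x - g i y| ≤ s.card • dist x y :=
        Finset.sum_le_card_nsmul _ _ _ fun i _ => hlip i x y
    _ ≤ 2 * N * dist x y := by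
      rw [nsmul_eq_mul]
      gcongr

theorem EuclideanSpace.mem_convexHull_single {ι : Type*} [Fintype ι] [DecidableEq ι] {s : Set ι}
    {v : EuclideanSpace ℝ ι} (hv : ∀ i, 0 ≤ v i) (hsum : ∑ i, v i = 1)
    (hs : ∀ i ∉ s, v i = 0) :
    v ∈ convexHull ℝ ((fun i => EuclideanSpace.single i (1 : ℝ)) '' s) := by
  classical
  have hfilter : ∑ i with i ∈ s, v i = 1 := by
    rw [← hsum]
    exact Finset.sum_filter_of_ne fun i _ hi => by_contra fun h => hi (hs i h)
  have hrep : v = ∑ i with i ∈ s, v i • EuclideanSpace.single i (1 : ℝ) := by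
    ext j
    simp only [WithLp.ofLp_sum, Finset.sum_apply, PiLp.smul_apply, PiLp.single_apply,
      smul_eq_mul, mul_ite, mul_one, mul_zero, Finset.sum_ite_eq, Finset.mem_filter_univ]
    split_ifs with h
    · rfl
    · exact hs j h
  rw [hrep]
  refine (convex_convexHull ℝ _).sum_mem (fun i _ => hv i) hfilter fun i hi => ?_
  exact subset_convexHull ℝ _ ⟨i, by simpa using hi, rfl⟩

/-- **The natural Lipschitz map to the nerve.** Let `M` be a compact metric space with a
finite open cover `U₁, …, U_ℓ` having Lebesgue number `δ > 0` and multiplicity at most `N`.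
Then there is an `(8N² + 4N)/δ`-Lipschitz map `f : M → ℝ^ℓ` with
`f(x) ∈ conv{eᵢ : x ∈ Uᵢ}` for every `x`; in particular `f` maps `M` into the nerve of
the cover. -/
theorem lipschitz_map_to_nerve (M : Type) [MetricSpace M] [CompactSpace M]
    (ℓ : ℕ) (U : Fin ℓ → Set M) (hopen : ∀ i, IsOpen (U i))
    (hcov : (⋃ i, U i) = Set.univ)
    (δ : ℝ) (hδ : 0 < δ) (hLeb : ∀ x : M, ∃ i, ball x δ ⊆ U i)
    (N : ℕ) (hmult : ∀ x : M, {i : Fin ℓ | x ∈ U i}.ncard ≤ N) :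
    ∃ f : M → EuclideanSpace ℝ (Fin ℓ),
      LipschitzWith (Real.toNNReal ((8 * N ^ 2 + 4 * N) / δ)) f ∧
      (∀ x : M, f x ∈
        convexHull ℝ {v | ∃ i, x ∈ U i ∧ v = EuclideanSpace.single i (1 : ℝ)}) ∧
      (∀ x : M, f x ∈ nerve U) := by
  set g : Fin ℓ → M → ℝ := fun i => truncDistCompl δ (U i)
  have hg0 (i : Fin ℓ) (x : M) : 0 ≤ g i x := truncDistCompl_nonneg hδ.le
  have hgU (i : Fin ℓ) (x : M) (hx : x ∉ U i) : g i x = 0 := truncDistCompl_of_notMem hδ.le hx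
  have hsum (x : M) : δ ≤ ∑ i, g i x := by
    obtain ⟨i, hi⟩ := hLeb x
    rw [← truncDistCompl_of_ball_subset hi]
    exact Finset.single_le_sum (f := fun i => g i x) (fun i _ => hg0 i x) (Finset.mem_univ i)
  set f : M → EuclideanSpace ℝ (Fin ℓ) := fun x => WithLp.toLp 2 fun i => g i x / ∑ j, g j x
    with hf
  have hhull (x : M) :
      f x ∈ convexHull ℝ ((fun i => EuclideanSpace.single i (1 : ℝ)) '' {i | x ∈ U i}) := by
    have hpos : 0 < ∑ i, g i x := hδ.trans_le (hsum x)
    refine EuclideanSpace.mem_convexHull_single (fun i => div_nonneg (hg0 i x) hpos.le) ?_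
      fun i hi => ?_
    · simp only [hf, ← Finset.sum_div]
      exact div_self hpos.ne'
    · simp [hf, hgU i x hi]
  refine ⟨f, LipschitzWith.of_dist_le' fun x y => ?_, fun x => ?_, fun x => ?_⟩
  · rw [dist_eq_norm]
    calc ‖f x - f y‖ ≤ ∑ i, |g i x / ∑ j, g j x - g i y / ∑ j, g j y| :=
          EuclideanSpace.norm_le_sum_abs (f x - f y)
      _ ≤ 2 * (∑ i, |g i x - g i y|) / δ :=
          sum_abs_div_sum_sub_le hδ (fun i => hg0 i y) (hsum x) (hsum y)
      _ ≤ 2 * (2 * N * dist x y) / δ := by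
          gcongr
          exact sum_abs_sub_le_of_multiplicity hmult hgU
            (fun i => abs_truncDistCompl_sub_le δ (U i)) x y
      _ = (0 + 4 * N) / δ * dist x y := by ring
      _ ≤ (8 * N ^ 2 + 4 * N) / δ * dist x y := by
          gcongr
          positivity
  · convert hhull x using 2
    ext v
    simp [eq_comm]
  · classical
    obtain ⟨i, hi⟩ := Set.mem_iUnion.1 (hcov.ge (Set.mem_univ x))
    refine Set.mem_biUnion (x := Finset.univ.filter fun i => x ∈ U i)
      ⟨⟨i, by simpa using hi⟩, x, ?_⟩ ?_
    · simp
    · simpa [cellOf] using hhull x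
end
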